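/- arXiv:2205.11076 — 7 statements merged into one kernel-verified Lean document; each statement's English description precedes it below -/
import Mathlib

section
/- Let V = F_q^n, T : V → V linear, and a ≥ b ≥ 0 integers. The number of pairs (W₁, W₂) with dim W₁ = a, dim W₂ = b, and W₂ ⊆ W₁ ∩ T⁻¹W₁ equals ∑_{j=0}^{b} N(b,j) · ((n-2b+j) choose (a-2b+j))_q, where N(b,j) is the number of b-dimensional subspaces U with dim(U ∩ T⁻¹U) = j. -/
def gaussBinom {R : Type*} [CommSemiring R] (q : R) : ℕ → ℕ → R
  | _, 0 => 1
  | 0, _ + 1 => 0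
  | n + 1, k + 1 => gaussBinom q n k + q ^ (k + 1) * gaussBinom q n (k + 1)

/-- Gaussian binomial with integer arguments: zero when the lower index is
negative or exceeds the upper index. -/
def gaussBinomZ {R : Type*} [CommRing R] (q : R) (n k : ℤ) : R :=
  if 0 ≤ k ∧ k ≤ n then gaussBinom q n.toNat k.toNat else 0

theorem gb_mul (q : ℤ) (n k : ℕ) :
    gaussBinom q n k * ∏ i ∈ Finset.range k, (q ^ k - q ^ i) =
      ∏ i ∈ Finset.range k, (q ^ n - q ^ i) := by
  have key : ∀ m k : ℕ, ∏ i ∈ Finset.range (k + 1), (q ^ (m + 1) - q ^ i) =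
      (q ^ (m + 1) - 1) * (q ^ k * ∏ i ∈ Finset.range k, (q ^ m - q ^ i)) := by
    intro m k
    rw [Finset.prod_range_succ']
    have : ∀ i ∈ Finset.range k, (q ^ (m + 1) - q ^ (i + 1)) = q * (q ^ m - q ^ i) := by
      intro i _
      ring
    rw [Finset.prod_congr rfl this, Finset.prod_mul_distrib]
    simp
    ring
  induction n generalizing k with
  | zero =>
    cases k with
    | zero => simp [gaussBinom]
    | succ k =>
      rw [Finset.prod_range_succ' (fun i => q ^ 0 - q ^ i)]
      simp [gaussBinom]
  | succ n ih =>
    cases k with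
    | zero => simp [gaussBinom]
    | succ k =>
      have h1 := ih k
      have h2 := ih (k + 1)
      rw [key k k, Finset.prod_range_succ (fun i => q ^ n - q ^ i)] at h2
      rw [key k k, key n k, gaussBinom]
      linear_combination (q ^ (k + 1) - 1) * q ^ k * h1 + q ^ (k + 1) * h2

section
variable {F V : Type*} [Field F] [AddCommGroup V] [Module F V]

/-- Independent tuples are grouped by their span. -/
noncomputable def liEquiv [FiniteDimensional F V] (k : ℕ) :
    {s : Fin k → V // LinearIndependent F s} ≃
      Σ W : {W : Submodule F V // Module.finrank F W = k},
        {s : Fin k → W.1 // LinearIndependent F s} where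
  toFun s := ⟨⟨Submodule.span F (Set.range s.1), by
      rw [finrank_span_eq_card s.2]; simp⟩,
    ⟨fun i => ⟨s.1 i, Submodule.subset_span ⟨i, rfl⟩⟩, linearIndependent_span s.2⟩⟩
  invFun x := ⟨fun i => (x.2.1 i : V), x.2.2.map' x.1.1.subtype (Submodule.ker_subtype _)⟩
  left_inv s := rfl
  right_inv := by
    rintro ⟨⟨W, hW⟩, ⟨s, hs⟩⟩
    have h0 : LinearIndependent F (fun i => (s i : V)) :=
      hs.map' W.subtype (Submodule.ker_subtype _)
    have h : Submodule.span F (Set.range fun i => (s i : V)) = W := by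
      apply Submodule.eq_of_le_of_finrank_eq
      · rw [Submodule.span_le]
        rintro _ ⟨i, rfl⟩
        exact (s i).2
      · rw [finrank_span_eq_card h0, hW]; simp
    refine Sigma.ext (Subtype.ext h) ?_
    have gen : ∀ (W' : Submodule F V) (hW' : Module.finrank F W' = k) (hh : W' = W)
        (s' : Fin k → W') (hs' : LinearIndependent F s') (_ : ∀ i, (s' i : V) = s i),
        HEq (⟨s', hs'⟩ : {s : Fin k → W' // LinearIndependent F s})
          (⟨s, hs⟩ : {s : Fin k → W // LinearIndependent F s}) := by
      intro W' hW' hh s' hs' he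
      subst hh
      apply heq_of_eq
      apply Subtype.ext
      funext i
      exact Subtype.ext (he i)
    exact gen _ (by rw [h, hW]) h _ (linearIndependent_span h0) (fun _ => rfl)

theorem card_sub [Fintype F] [Finite V] (k : ℕ) :
    (Nat.card {W : Submodule F V // Module.finrank F W = k} : ℤ) =
      gaussBinom (Fintype.card F : ℤ) (Module.finrank F V) k := by
  have hq : 1 < Fintype.card F := Fintype.one_lt_card
  have P : ∀ m : ℕ, k ≤ m → ((∏ i : Fin k, (Fintype.card F ^ m - Fintype.card F ^ i.val) : ℕ) : ℤ)
      = ∏ i ∈ Finset.range k, ((Fintype.card F : ℤ) ^ m - (Fintype.card F : ℤ) ^ i) := by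
    intro m hm
    rw [Fin.prod_univ_eq_prod_range (fun i => Fintype.card F ^ m - Fintype.card F ^ i) k,
      Nat.cast_prod]
    refine Finset.prod_congr rfl fun i hi => ?_
    rw [Nat.cast_sub (Nat.pow_le_pow_right hq.le (by simp at hi; omega))]
    push_cast
    rfl
  have hne : ∏ i ∈ Finset.range k, ((Fintype.card F : ℤ) ^ k - (Fintype.card F : ℤ) ^ i) ≠ 0 := by
    rw [Finset.prod_ne_zero_iff]
    intro i hi
    have : Fintype.card F ^ i < Fintype.card F ^ k :=
      Nat.pow_lt_pow_right hq (by simpa using hi)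
    have : (Fintype.card F : ℤ) ^ i < (Fintype.card F : ℤ) ^ k := by exact_mod_cast this
    omega
  apply mul_right_cancel₀ hne
  rw [gb_mul]
  by_cases hk : k ≤ Module.finrank F V
  · rw [← P _ hk, ← card_linearIndependent hk, Nat.card_congr (liEquiv k), ← P _ le_rfl]
    have := Fintype.ofFinite {W : Submodule F V // Module.finrank F W = k}
    rw [Nat.card_sigma]
    have h : ∀ W : {W : Submodule F V // Module.finrank F W = k},
        Nat.card {s : Fin k → W.1 // LinearIndependent F s} =
          ∏ i : Fin k, (Fintype.card F ^ k - Fintype.card F ^ i.val) := by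
      intro W
      rw [card_linearIndependent W.2.ge, W.2]
    rw [Finset.sum_congr rfl fun W _ => h W]
    simp [Nat.card_eq_fintype_card]
  · have : IsEmpty {W : Submodule F V // Module.finrank F W = k} :=
      ⟨fun W => hk (W.2 ▸ Submodule.finrank_le W.1)⟩
    have h0 : ∏ i ∈ Finset.range k, ((Fintype.card F : ℤ) ^ Module.finrank F V -
        (Fintype.card F : ℤ) ^ i) = 0 :=
      Finset.prod_eq_zero (i := Module.finrank F V) (by simp; omega) (by simp)
    rw [Nat.card_of_isEmpty, h0]
    simp

theorem finrank_comap_mkQ [FiniteDimensional F V] (S : Submodule F V) (U : Submodule F (V ⧸ S)) :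
    Module.finrank F (U.comap S.mkQ) = Module.finrank F U + Module.finrank F S := by
  have h1 := LinearMap.finrank_range_add_finrank_ker (S.mkQ.domRestrict (U.comap S.mkQ))
  have hle : S ≤ U.comap S.mkQ := Submodule.le_comap_mkQ S U
  rw [LinearMap.range_domRestrict, LinearMap.ker_domRestrict, Submodule.ker_mkQ,
    Submodule.map_comap_eq_of_surjective S.mkQ_surjective] at h1
  have h2 := (Submodule.submoduleOfEquivOfLe hle).finrank_eq
  rw [Submodule.submoduleOf] at h2
  rw [← h1, h2]

theorem card_above [Fintype F] [Finite V] (S : Submodule F V) (a : ℕ) :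
    (Nat.card {W : Submodule F V // Module.finrank F W = a ∧ S ≤ W} : ℤ) =
      gaussBinomZ (Fintype.card F : ℤ) ((Module.finrank F V : ℤ) - Module.finrank F S)
        ((a : ℤ) - Module.finrank F S) := by
  have hS := Submodule.finrank_le S
  unfold gaussBinomZ
  split_ifs with h
  · obtain ⟨h1, h2⟩ := h
    have e : {U : Submodule F (V ⧸ S) // Module.finrank F U = a - Module.finrank F S} ≃
        {W : Submodule F V // Module.finrank F W = a ∧ S ≤ W} :=
      { toFun := fun U => ⟨U.1.comap S.mkQ, by rw [finrank_comap_mkQ, U.2]; omega,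
          Submodule.le_comap_mkQ S U.1⟩
        invFun := fun W => ⟨W.1.map S.mkQ, by
          have h := finrank_comap_mkQ S (W.1.map S.mkQ)
          rw [Submodule.comap_map_mkQ, sup_eq_right.2 W.2.2, W.2.1] at h
          omega⟩
        left_inv := fun U => Subtype.ext
          (Submodule.map_comap_eq_of_surjective S.mkQ_surjective _)
        right_inv := fun W => Subtype.ext (by
          simp only [Submodule.comap_map_mkQ, sup_eq_right.2 W.2.2]) }
    have hfin : Finite (V ⧸ S) := Finite.of_surjective _ S.mkQ_surjective
    rw [← Nat.card_congr e, card_sub]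
    have := S.finrank_quotient_add_finrank
    congr 1 <;> omega
  · have : IsEmpty {W : Submodule F V // Module.finrank F W = a ∧ S ≤ W} :=
      ⟨fun W => h (by
        have h1 := Submodule.finrank_mono W.2.2
        have h2 := Submodule.finrank_le W.1
        rw [W.2.1] at h1 h2
        omega)⟩
    simp

theorem finrank_sup_map [FiniteDimensional F V] (T : V →ₗ[F] V) (U : Submodule F V) :
    Module.finrank F ↥(U ⊔ U.map T) + Module.finrank F ↥(U ⊓ U.comap T) =
      2 * Module.finrank F U := by
  have h1 := LinearMap.finrank_range_add_finrank_ker ((U.mkQ ∘ₗ T).domRestrict U)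
  have h2 := finrank_comap_mkQ U ((U.map T).map U.mkQ)
  rw [Submodule.comap_map_mkQ] at h2
  rw [LinearMap.range_domRestrict, LinearMap.ker_domRestrict, Submodule.map_comp,
    LinearMap.ker_comp, Submodule.ker_mkQ] at h1
  have h3 : Module.finrank F ((U.comap T).comap U.subtype) =
      Module.finrank F ↥(U ⊓ U.comap T) := by
    rw [← Submodule.finrank_map_subtype_eq U, Submodule.map_comap_subtype]
  rw [h3] at h1
  omega
end

/-- The number of pairs `(W₁, W₂)` of subspaces of `F^n` with `dim W₁ = a`,
`dim W₂ = b` and `W₂ ⊆ W₁ ∩ T⁻¹W₁` equals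
`∑_{j=0}^{b} N(b,j) ((n-2b+j) choose (a-2b+j))_q`, where `N(b,j)` is the number
of `b`-dimensional subspaces `U` with `dim (U ∩ T⁻¹U) = j`. -/
theorem card_pairs_eq_sum_Ncount' (F : Type*) [Field F] [Fintype F] (n : ℕ)
    (T : (Fin n → F) →ₗ[F] (Fin n → F)) (a b : ℕ) (hba : b ≤ a) :
    (Nat.card {P : Submodule F (Fin n → F) × Submodule F (Fin n → F) //
        Module.finrank F P.1 = a ∧ Module.finrank F P.2 = b ∧
          P.2 ≤ P.1 ⊓ P.1.comap T} : ℤ) =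
      ∑ j ∈ Finset.range (b + 1),
        (Nat.card {U : Submodule F (Fin n → F) //
            Module.finrank F U = b ∧ Module.finrank F ↥(U ⊓ U.comap T) = j} : ℤ) *
          gaussBinomZ (Fintype.card F : ℤ) ((n : ℤ) - 2 * b + j) ((a : ℤ) - 2 * b + j) := by
  classical
  let e : {P : Submodule F (Fin n → F) × Submodule F (Fin n → F) //
        Module.finrank F P.1 = a ∧ Module.finrank F P.2 = b ∧
          P.2 ≤ P.1 ⊓ P.1.comap T} ≃
      Σ U : {U : Submodule F (Fin n → F) // Module.finrank F U = b},
        {W : Submodule F (Fin n → F) // Module.finrank F W = a ∧ U.1 ⊔ U.1.map T ≤ W} :=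
    { toFun := fun P => ⟨⟨P.1.2, P.2.2.1⟩, ⟨P.1.1, P.2.1,
        sup_le (P.2.2.2.trans inf_le_left) (Submodule.map_le_iff_le_comap.2
          (P.2.2.2.trans inf_le_right))⟩⟩
      invFun := fun x => ⟨(x.2.1, x.1.1), x.2.2.1, x.1.2,
        le_inf (le_sup_left.trans x.2.2.2) (Submodule.map_le_iff_le_comap.1
          (le_sup_right.trans x.2.2.2))⟩
      left_inv := fun _ => rfl
      right_inv := fun _ => rfl }
  have := Fintype.ofFinite {U : Submodule F (Fin n → F) // Module.finrank F U = b}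
  rw [Nat.card_congr e, Nat.card_sigma, Nat.cast_sum]
  have hmaps : ∀ U ∈ (Finset.univ : Finset {U : Submodule F (Fin n → F) // Module.finrank F U = b}),
      Module.finrank F ↥(U.1 ⊓ U.1.comap T) ∈ Finset.range (b + 1) := by
    intro U _
    have := Submodule.finrank_mono (inf_le_left : U.1 ⊓ U.1.comap T ≤ U.1)
    rw [U.2] at this
    simp only [Finset.mem_range]
    omega
  rw [← Finset.sum_fiberwise_of_maps_to hmaps]
  refine Finset.sum_congr rfl fun j hj => ?_
  have hterm : ∀ U ∈ Finset.univ.filter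
      (fun U : {U : Submodule F (Fin n → F) // Module.finrank F U = b} =>
        Module.finrank F ↥(U.1 ⊓ U.1.comap T) = j),
      (Nat.card {W : Submodule F (Fin n → F) //
        Module.finrank F W = a ∧ U.1 ⊔ U.1.map T ≤ W} : ℤ) =
      gaussBinomZ (Fintype.card F : ℤ) ((n : ℤ) - 2 * b + j) ((a : ℤ) - 2 * b + j) := by
    intro U hU
    have hU' := (Finset.mem_filter.1 hU).2
    have h := finrank_sup_map T U.1
    rw [hU', U.2] at h
    rw [card_above, Module.finrank_fin_fun]
    congr 1 <;> omega
  rw [Finset.sum_congr rfl hterm, Finset.sum_const, nsmul_eq_mul]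
  congr 2
  rw [← Fintype.card_subtype, ← Nat.card_eq_fintype_card]
  exact Nat.card_congr (Equiv.subtypeSubtypeEquivSubtypeInter
    (fun U : Submodule F (Fin n → F) => Module.finrank F U = b)
    (fun U => Module.finrank F ↥(U ⊓ U.comap T) = j))
end

section
/- Fix m ≥ 0 and opening nodes 1 ≤ c₁ < … < c_m ≤ 2m within {1,…,2m}, and let r_j = #{i : c_i ≤ i + j − 1}. Then the sum of q^{v(σ)} over all fixed-point-free involutions σ of {1,…,2m} whose set of chord left-endpoints is exactly {c₁,…,c_m} equals ∏_{j=1}^m [r_j − (j−1)]_q, where v(σ) is the number of crossings of σ (pairs of chords (i,j), (k,l) with i < k < j < l) and [n]_q = 1 + q + … + q^{n−1}. -/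
open Polynomial

/-- The number of crossings of the chord diagram of a permutation `σ` of
`{0, …, N-1}`: pairs of chords `(i, σ i)`, `(k, σ k)` with `i < k < σ i < σ k`. -/
noncomputable def crossings {N : ℕ} (σ : Equiv.Perm (Fin N)) : ℕ :=
  Nat.card {p : Fin N × Fin N // p.1 < p.2 ∧ p.2 < σ p.1 ∧ σ p.1 < σ p.2}

open Finset in
lemma qc_choice {α : Type*} [LinearOrder α] (O : Finset α) (z : α) :
    ∑ o ∈ O.filter (· < z), (X : Polynomial ℤ) ^ ((O.filter (fun y => o < y ∧ y < z)).card) =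
      ∑ t ∈ Finset.range ((O.filter (· < z)).card), (X : Polynomial ℤ) ^ t := by
  have h : ∀ o, O.filter (fun y => o < y ∧ y < z) = (O.filter (· < z)).filter (fun y => o < y) := by
    intro o; ext y; simp only [Finset.mem_filter]; tauto
  simp only [h]
  generalize O.filter (· < z) = S
  induction S using Finset.induction_on_min with
  | empty => simp
  | insert a s ha ih =>
    have hn : a ∉ s := fun h => lt_irrefl _ (ha a h)
    rw [Finset.sum_insert hn, Finset.card_insert_of_notMem hn, Finset.sum_range_succ, add_comm, ← ih]
    congr 1
    · apply Finset.sum_congr rfl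
      intro o ho
      congr 2
      rw [Finset.filter_insert, if_neg (not_lt.mpr (ha o ho).le)]
    · congr 2
      rw [Finset.filter_insert, if_neg (lt_irrefl _), Finset.filter_true_of_mem ha]

/-- number of crossings of the matching `j ↦ (g j, x j)` -/
def qcW {α : Type*} [LinearOrder α] {n : ℕ} (x g : Fin n → α) : ℕ :=
  ∑ a, ∑ b, if a < b ∧ g a < g b ∧ g b < x a then 1 else 0

open Classical in
lemma qc_main {α : Type*} [LinearOrder α] [Fintype α] (n : ℕ) :
    ∀ (x : Fin n → α) (_ : Monotone x) (O : Finset α) (_ : O.card = n),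
    ∑ g : Fin n → α, (if Function.Injective g ∧ (∀ j, g j ∈ O) ∧ ∀ j, g j < x j
      then (X : Polynomial ℤ) ^ qcW x g else 0) =
    ∏ j : Fin n, ∑ t ∈ Finset.range ((O.filter (· < x j)).card - (j : ℕ)),
      (X : Polynomial ℤ) ^ t := by
  induction n with
  | zero => intro x hx O hO; simp [qcW, Function.injective_of_subsingleton]
  | succ n ih =>
    intro x hx O hO
    rw [← (Fin.consEquiv (fun _ : Fin (n+1) => α)).sum_comp, Fintype.sum_prod_type,
      Fin.prod_univ_succ]
    have key : ∀ o : α, ∑ g : Fin n → α,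
        (if Function.Injective (Fin.cons o g : Fin (n+1) → α) ∧
            (∀ j, (Fin.cons o g : Fin (n+1) → α) j ∈ O) ∧
            ∀ j, (Fin.cons o g : Fin (n+1) → α) j < x j
          then (X : Polynomial ℤ) ^ qcW x (Fin.cons o g : Fin (n+1) → α) else 0) =
        if o ∈ O.filter (· < x 0) then
          (X : Polynomial ℤ) ^ ((O.filter (fun y => o < y ∧ y < x 0)).card) *
          ∏ j : Fin n, ∑ t ∈ Finset.range ((O.filter (· < x j.succ)).card - ((j.succ : Fin (n+1)) : ℕ)),
            (X : Polynomial ℤ) ^ t else 0 := by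
      intro o
      split_ifs with ho
      · rw [Finset.mem_filter] at ho
        have := ih (fun j => x j.succ) (fun a b h => hx (Fin.succ_le_succ_iff.mpr h)) (O.erase o)
          (by rw [Finset.card_erase_of_mem ho.1, hO]; rfl)
        have e : ∀ j : Fin n, ((O.erase o).filter (· < x j.succ)).card - (j : ℕ) =
            (O.filter (· < x j.succ)).card - ((j.succ : Fin (n+1)) : ℕ) := by
          intro j
          rw [Finset.filter_erase, Finset.card_erase_of_mem]
          · simp; omega
          · simp [ho.1]; exact ho.2.trans_le (hx (Fin.zero_le _))
        simp only [e] at this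
        rw [← this, Finset.mul_sum]
        apply Finset.sum_congr rfl
        intro g _
        have hiff : (Function.Injective (Fin.cons o g : Fin (n+1) → α) ∧
            (∀ j, (Fin.cons o g : Fin (n+1) → α) j ∈ O) ∧
            ∀ j, (Fin.cons o g : Fin (n+1) → α) j < x j) ↔
            (Function.Injective g ∧ (∀ j, g j ∈ O.erase o) ∧ ∀ j, g j < x j.succ) := by
          rw [Fin.cons_injective_iff, Fin.forall_fin_succ, Fin.forall_fin_succ]
          simp only [Fin.cons_zero, Fin.cons_succ, Finset.mem_erase, Set.mem_range, not_exists]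
          constructor
          · rintro ⟨⟨h1, h2⟩, ⟨h3, h4⟩, h5, h6⟩
            exact ⟨h2, fun j => ⟨h1 j, h4 j⟩, h6⟩
          · rintro ⟨h1, h2, h3⟩
            exact ⟨⟨fun j => (h2 j).1, h1⟩, ⟨ho.1, fun j => (h2 j).2⟩, ho.2, h3⟩
        simp only [hiff]
        split_ifs with hg
        · obtain ⟨h1, h2, h3⟩ := hg
          rw [← pow_add]
          congr 1
          have him : Finset.univ.image g = O.erase o := by
            apply Finset.eq_of_subset_of_card_le
            · intro y hy
              simp only [Finset.mem_image, Finset.mem_univ, true_and] at hy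
              obtain ⟨j, rfl⟩ := hy
              exact h2 j
            · rw [Finset.card_image_of_injective _ h1, Finset.card_erase_of_mem ho.1, hO]; simp
          have hc : (O.filter (fun y => o < y ∧ y < x 0)).card =
              ∑ b, if o < g b ∧ g b < x 0 then 1 else 0 := by
            have : O.filter (fun y => o < y ∧ y < x 0) =
              (Finset.univ.image g).filter (fun y => o < y ∧ y < x 0) := by
              rw [him]; ext y; simp only [Finset.mem_filter, Finset.mem_erase]
              constructor
              · rintro ⟨a, b, c⟩; exact ⟨⟨b.ne', a⟩, b, c⟩
              · rintro ⟨⟨_, a⟩, b, c⟩; exact ⟨a, b, c⟩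
            rw [this, Finset.card_filter, Finset.sum_image (fun a _ b _ h => h1 h)]
          rw [hc]
          unfold qcW
          rw [Fin.sum_univ_succ]
          congr 1
          · rw [Fin.sum_univ_succ]; simp
          · apply Finset.sum_congr rfl
            intro a _
            rw [Fin.sum_univ_succ]; simp
        · simp
      · apply Finset.sum_eq_zero
        intro g _
        rw [if_neg]
        rintro ⟨_, h2, h3⟩
        exact ho (Finset.mem_filter.mpr ⟨h2 0, h3 0⟩)
    refine (Finset.sum_congr rfl (fun o _ => key o)).trans ?_
    rw [Finset.sum_ite_mem, Finset.univ_inter,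
      ← Finset.sum_mul, qc_choice]
    simp

lemma qc_count {m : ℕ} (c x : Fin m → Fin (2 * m)) (hc : StrictMono c) (hx : StrictMono x)
    (hcx : ∀ i j, c i ≠ x j) (hsurj : ∀ y, (∃ i, c i = y) ∨ ∃ j, x j = y) (i j : Fin m) :
    c i < x j ↔ (c i : ℕ) ≤ i + j := by
  have h : (c i : ℕ) = i + (Finset.univ.filter (fun b => x b < c i)).card := by
    have h1 : Finset.Iio (c i) = (Finset.Iio i).image c ∪
        (Finset.univ.filter (fun b => x b < c i)).image x := by
      ext y
      simp only [Finset.mem_Iio, Finset.mem_union, Finset.mem_image, Finset.mem_filter,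
        Finset.mem_univ, true_and]
      constructor
      · intro hy
        rcases hsurj y with ⟨a, rfl⟩ | ⟨b, rfl⟩
        · exact Or.inl ⟨a, hc.lt_iff_lt.mp hy, rfl⟩
        · exact Or.inr ⟨b, hy, rfl⟩
      · rintro (⟨a, h, rfl⟩ | ⟨b, h, rfl⟩)
        · exact hc h
        · exact h
    have h2 := congrArg Finset.card h1
    rw [Finset.card_union_of_disjoint, Finset.card_image_of_injective _ hc.injective,
      Finset.card_image_of_injective _ hx.injective, Fin.card_Iio, Fin.card_Iio] at h2
    · exact h2
    · rw [Finset.disjoint_left]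
      intro y hy hy'
      simp only [Finset.mem_image] at hy hy'
      obtain ⟨a, _, rfl⟩ := hy
      obtain ⟨b, _, hb⟩ := hy'
      exact hcx _ _ hb.symm
  constructor
  · intro hlt
    have : (Finset.univ.filter (fun b => x b < c i)).card ≤ (Finset.Iio j).card := by
      apply Finset.card_le_card
      intro b hb
      simp only [Finset.mem_filter, Finset.mem_univ, true_and] at hb
      exact Finset.mem_Iio.mpr (hx.lt_iff_lt.mp (hb.trans hlt))
    rw [Fin.card_Iio] at this
    omega
  · intro hle
    by_contra hn
    have hlt : x j < c i := lt_of_le_of_ne (not_lt.mp hn) (hcx i j).symm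
    have : (Finset.Iic j).card ≤ (Finset.univ.filter (fun b => x b < c i)).card := by
      apply Finset.card_le_card
      intro b hb
      simp only [Finset.mem_filter, Finset.mem_univ, true_and]
      exact (hx.monotone (Finset.mem_Iic.mp hb)).trans_lt hlt
    rw [Fin.card_Iic] at this
    omega

lemma qc_crossings {m : ℕ} (x : Fin m → Fin (2 * m)) (hx : StrictMono x)
    (σ : Equiv.Perm (Fin (2 * m))) (hσ : ∀ y, σ (σ y) = y)
    (hcl : ∀ y, σ y < y ↔ ∃ j, x j = y) : crossings σ = qcW x (fun j => σ (x j)) := by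
  classical
  unfold crossings qcW
  have : ∑ a, ∑ b, (if a < b ∧ σ (x a) < σ (x b) ∧ σ (x b) < x a then 1 else 0) =
      (Finset.univ.filter (fun p : Fin m × Fin m =>
        p.1 < p.2 ∧ σ (x p.1) < σ (x p.2) ∧ σ (x p.2) < x p.1)).card := by
    rw [Finset.card_filter, Fintype.sum_prod_type]
  rw [this, Nat.card_eq_fintype_card, Fintype.card_subtype]
  symm
  apply Finset.card_bij (fun p _ => (σ (x p.1), σ (x p.2)))
  · rintro ⟨a, b⟩ h
    simp only [Finset.mem_filter, Finset.mem_univ, true_and, hσ] at h ⊢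
    exact ⟨h.2.1, h.2.2, hx h.1⟩
  · rintro ⟨a, b⟩ _ ⟨a', b'⟩ _ h
    simp only [Prod.mk.injEq, EmbeddingLike.apply_eq_iff_eq] at h
    rw [hx.injective h.1, hx.injective h.2]
  · rintro ⟨y, z⟩ h
    simp only [Finset.mem_filter, Finset.mem_univ, true_and] at h
    obtain ⟨h1, h2, h3⟩ := h
    obtain ⟨a, ha⟩ := (hcl (σ y)).mp (by rw [hσ]; exact h1.trans h2)
    obtain ⟨b, hb⟩ := (hcl (σ z)).mp (by rw [hσ]; exact h2.trans h3)
    refine ⟨(a, b), ?_, ?_⟩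
    · simp only [Finset.mem_filter, Finset.mem_univ, true_and, ha, hb, hσ]
      refine ⟨?_, h1, h2⟩
      rw [← hx.lt_iff_lt, ha, hb]; exact h3
    · simp [ha, hb, hσ]

open Classical in
/-- For fixed opening nodes `c₀ < ⋯ < c_{m-1}` in `{0, …, 2m-1}`, the sum of
`q^{v(σ)}` over all fixed-point-free involutions `σ` of `{0, …, 2m-1}` whose set
of chord left-endpoints is exactly `{c₀, …, c_{m-1}}` equals
`∏_{j} [r_j - j]_q`, where `r_j = #{i : c_i ≤ i + j}` (0-indexed form of
`r_j = #{i : c_i ≤ i + j - 1}`). -/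
theorem sum_q_crossings_fixed_openings (m : ℕ) (c : Fin m → Fin (2 * m))
    (hc : StrictMono c) :
    ∑ σ : Equiv.Perm (Fin (2 * m)),
      (if σ * σ = 1 ∧ (∀ x, σ x ≠ x) ∧ (∀ x : Fin (2 * m), x < σ x ↔ ∃ i, c i = x)
        then (X : Polynomial ℤ) ^ crossings σ else 0) =
      ∏ j : Fin m,
        ∑ t ∈ Finset.range
          ((Finset.univ.filter fun i : Fin m => (c i : ℕ) ≤ (i : ℕ) + (j : ℕ)).card - (j : ℕ)),
          (X : Polynomial ℤ) ^ t := by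
  have hcardc : (Finset.univ.image c).card = m := by
    rw [Finset.card_image_of_injective _ hc.injective]; simp
  have hcard : ((Finset.univ.image c)ᶜ).card = m := by
    rw [Finset.card_compl, hcardc, Fintype.card_fin]; omega
  obtain ⟨x, hx, hxr⟩ : ∃ x : Fin m → Fin (2 * m), StrictMono x ∧
      ∀ y, (∃ j, x j = y) ↔ ¬ ∃ i, c i = y := by
    refine ⟨((Finset.univ.image c)ᶜ).orderEmbOfFin hcard, OrderEmbedding.strictMono _, ?_⟩
    intro y
    have := Finset.range_orderEmbOfFin ((Finset.univ.image c)ᶜ) hcard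
    have h2 := Set.ext_iff.mp this y
    rw [Set.mem_range] at h2
    rw [h2]
    simp
  have hcx : ∀ i j, c i ≠ x j := fun i j h => (hxr (x j)).mp ⟨j, rfl⟩ ⟨i, h⟩
  have hsurj : ∀ y, (∃ i, c i = y) ∨ ∃ j, x j = y := by
    intro y; rw [hxr]; exact Classical.em _
  have hmain := qc_main m x hx.monotone (Finset.univ.image c) hcardc
  have hR : ∀ j : Fin m, ((Finset.univ.image c).filter (· < x j)).card =
      (Finset.univ.filter fun i : Fin m => (c i : ℕ) ≤ (i : ℕ) + (j : ℕ)).card := by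
    intro j
    rw [Finset.filter_image, Finset.card_image_of_injective _ hc.injective]
    congr 1
    ext i
    simp only [Finset.mem_filter, Finset.mem_univ, true_and]
    exact qc_count c x hc hx hcx hsurj i j
  simp only [hR] at hmain
  rw [← hmain, ← Finset.sum_filter, ← Finset.sum_filter]
  have hP : ∀ σ : Equiv.Perm (Fin (2 * m)),
      (σ * σ = 1 ∧ (∀ x, σ x ≠ x) ∧ (∀ x : Fin (2 * m), x < σ x ↔ ∃ i, c i = x)) →
      (∀ y, σ (σ y) = y) ∧ (∀ y, σ y < y ↔ ∃ j, x j = y) := by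
    rintro σ ⟨h1, h2, h3⟩
    refine ⟨fun y => by rw [← Equiv.Perm.mul_apply, h1]; rfl, fun y => ?_⟩
    rw [hxr, ← h3, not_lt]
    exact ⟨le_of_lt, fun h => lt_of_le_of_ne h (h2 y)⟩
  apply Finset.sum_bij (fun σ _ j => σ (x j))
  · intro σ hσ
    simp only [Finset.mem_filter, Finset.mem_univ, true_and] at hσ ⊢
    obtain ⟨hi, hcl⟩ := hP σ hσ
    refine ⟨fun a b h => hx.injective (σ.injective h), fun j => ?_, fun j => (hcl _).mpr ⟨j, rfl⟩⟩
    simp only [Finset.mem_image, Finset.mem_univ, true_and]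
    rw [← hσ.2.2, hi]
    exact (hcl _).mpr ⟨j, rfl⟩
  · intro σ hσ τ hτ h
    simp only [Finset.mem_filter, Finset.mem_univ, true_and] at hσ hτ
    obtain ⟨hi, hcl⟩ := hP σ hσ
    obtain ⟨hi', hcl'⟩ := hP τ hτ
    ext1 y
    rcases hsurj y with hy | ⟨j, rfl⟩
    · have := (hσ.2.2 y).mpr hy
      obtain ⟨j, hj⟩ := (hcl (σ y)).mp (by rwa [hi])
      have h4 := congrFun h j
      simp only [hj, hi] at h4
      rw [h4, hi']
      rw [← h4]
    · exact congrFun h j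
  · intro g hg
    simp only [Finset.mem_filter, Finset.mem_univ, true_and] at hg
    obtain ⟨h1, h2, h3⟩ := hg
    have him : Finset.univ.image g = Finset.univ.image c := by
      apply Finset.eq_of_subset_of_card_le
      · intro y hy
        simp only [Finset.mem_image, Finset.mem_univ, true_and] at hy
        obtain ⟨j, rfl⟩ := hy
        exact h2 j
      · rw [Finset.card_image_of_injective _ h1, hcardc]; simp
    have hgc : ∀ y, (∃ j, g j = y) ↔ ∃ i, c i = y := by
      intro y
      have := Finset.ext_iff.mp him y
      simpa using this
    have hbij : Function.Bijective (Sum.elim g x) := by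
      constructor
      · apply Function.Injective.sumElim h1 hx.injective
        intro a b h
        obtain ⟨i, hi⟩ := (hgc (g a)).mp ⟨a, rfl⟩
        exact hcx i b (hi.trans h)
      · intro y
        rcases hsurj y with hy | ⟨j, hj⟩
        · obtain ⟨j, hj⟩ := (hgc y).mpr hy
          exact ⟨Sum.inl j, hj⟩
        · exact ⟨Sum.inr j, hj⟩
    let e := Equiv.ofBijective _ hbij
    let σ : Equiv.Perm (Fin (2 * m)) := (e.symm.trans (Equiv.sumComm _ _)).trans e
    have hσx : ∀ j, σ (x j) = g j := by
      intro j
      have : e.symm (x j) = Sum.inr j := by rw [Equiv.symm_apply_eq]; rfl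
      simp only [σ, Equiv.trans_apply, this]; rfl
    have hσg : ∀ j, σ (g j) = x j := by
      intro j
      have : e.symm (g j) = Sum.inl j := by rw [Equiv.symm_apply_eq]; rfl
      simp only [σ, Equiv.trans_apply, this]; rfl
    have hcases : ∀ y, (∃ j, g j = y) ∨ ∃ j, x j = y := by
      intro y; rw [hgc]; exact hsurj y
    refine ⟨σ, ?_, funext hσx⟩
    simp only [Finset.mem_filter, Finset.mem_univ, true_and]
    refine ⟨?_, ?_, ?_⟩
    · ext1 y
      rw [Equiv.Perm.mul_apply]
      rcases hcases y with ⟨j, rfl⟩ | ⟨j, rfl⟩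
      · rw [hσg, hσx]; rfl
      · rw [hσx, hσg]; rfl
    · intro y
      rcases hcases y with ⟨j, rfl⟩ | ⟨j, rfl⟩
      · rw [hσg]; exact (h3 j).ne'
      · rw [hσx]; exact (h3 j).ne
    · intro y
      rcases hcases y with ⟨j, rfl⟩ | ⟨j, rfl⟩
      · rw [hσg, ← hgc]; exact ⟨fun _ => ⟨j, rfl⟩, fun _ => h3 j⟩
      · rw [hσx]
        exact ⟨fun h => absurd h (h3 j).not_gt, fun h => absurd h ((hxr _).mp ⟨j, rfl⟩)⟩
  · intro σ hσ
    simp only [Finset.mem_filter, Finset.mem_univ, true_and] at hσ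
    obtain ⟨hi, hcl⟩ := hP σ hσ
    rw [qc_crossings x hx σ hi hcl]
end

section
/- For every nonnegative integer m, the Touchard polynomial T_m(q) = ∑_σ q^{v(σ)}, summed over all fixed-point-free involutions σ of {1,…,2m} with v(σ) the number of crossings, satisfies T_m(q) = ∑_{1 ≤ c₁ < … < c_m ≤ 2m} ∏_{j=1}^m [r_j − (j−1)]_q, where for each choice of c₁ < … < c_m, r_j = #{i : c_i ≤ i + j − 1}, and [n]_q = 1 + q + … + q^{n−1}. -/
open Polynomial

open Classical in
/-- weight: crossings plus fixed points under arcs -/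
noncomputable def tw {n : ℕ} (σ : Equiv.Perm (Fin n)) : ℕ :=
  ∑ i, ∑ k, if i < k ∧ k < σ i ∧ (σ i < σ k ∨ σ k = k) then 1 else 0

noncomputable def tfix {n : ℕ} (σ : Equiv.Perm (Fin n)) : ℕ :=
  ∑ i, if σ i = i then 1 else 0

noncomputable def qn (n : ℕ) : Polynomial ℤ := ∑ t ∈ Finset.range n, (X : Polynomial ℤ) ^ t

def tG (n : ℕ) : Equiv.Perm (Fin (n+1)) ≃ Option (Fin n) × Equiv.Perm (Fin n) :=
  (Equiv.permCongr finSuccEquivLast).trans Equiv.Perm.decomposeOption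

lemma tG_none_cast {n : ℕ} (e : Equiv.Perm (Fin n)) (i : Fin n) :
    (tG n).symm (none, e) i.castSucc = (e i).castSucc := by
  simp [tG, Equiv.permCongr]

lemma tG_none_last {n : ℕ} (e : Equiv.Perm (Fin n)) :
    (tG n).symm (none, e) (Fin.last n) = Fin.last n := by
  simp [tG, Equiv.permCongr]

lemma tG_some_cast {n : ℕ} (e : Equiv.Perm (Fin n)) (f i : Fin n) :
    (tG n).symm (some f, e) i.castSucc = if e i = f then Fin.last n else (e i).castSucc := by
  by_cases h : e i = f
  · simp [tG, Equiv.permCongr, h]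
  · simp [tG, Equiv.permCongr, h, Equiv.swap_apply_of_ne_of_ne]

lemma tG_some_last {n : ℕ} (e : Equiv.Perm (Fin n)) (f : Fin n) :
    (tG n).symm (some f, e) (Fin.last n) = f.castSucc := by
  simp [tG, Equiv.permCongr]

lemma sum_tG {n : ℕ} (F : Equiv.Perm (Fin (n+1)) → Polynomial ℤ) :
    ∑ σ, F σ = ∑ e, (F ((tG n).symm (none, e)) + ∑ f, F ((tG n).symm (some f, e))) := by
  rw [← Equiv.sum_comp (tG n).symm, Fintype.sum_prod_type_right]
  simp [Fintype.sum_option]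

def tinv {n : ℕ} (σ : Equiv.Perm (Fin n)) : Prop := ∀ x, σ (σ x) = x

lemma tinv_none {n : ℕ} (e : Equiv.Perm (Fin n)) : tinv ((tG n).symm (none, e)) ↔ tinv e := by
  simp [tinv, Fin.forall_fin_succ', tG_none_cast, tG_none_last]

lemma tinv_some {n : ℕ} (e : Equiv.Perm (Fin n)) (f : Fin n) :
    tinv ((tG n).symm (some f, e)) ↔ tinv e ∧ e f = f := by
  unfold tinv
  rw [Fin.forall_fin_succ', tG_some_last, tG_some_cast]
  constructor
  · rintro ⟨h1, h2⟩
    have hf : e f = f := by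
      by_contra h
      rw [if_neg h] at h2
      exact (Fin.castSucc_lt_last _).ne h2
    refine ⟨fun x => ?_, hf⟩
    by_cases hx : e x = f
    · have : x = f := e.injective (hx.trans hf.symm)
      subst this; rw [hf, hf]
    · have := h1 x
      rw [tG_some_cast, if_neg hx, tG_some_cast] at this
      split_ifs at this with h3
      · exact absurd this.symm (Fin.castSucc_lt_last _).ne
      · exact Fin.castSucc_injective _ this
  · rintro ⟨h1, hf⟩
    refine ⟨fun x => ?_, by simp [hf]⟩
    rw [tG_some_cast]
    by_cases hx : e x = f
    · rw [if_pos hx, tG_some_last]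
      congr 1
      rw [← h1 x, hx, hf]
    · rw [if_neg hx, tG_some_cast, h1, if_neg]
      rintro rfl
      exact hx hf

lemma tfix_none {n : ℕ} (e : Equiv.Perm (Fin n)) :
    tfix ((tG n).symm (none, e)) = tfix e + 1 := by
  unfold tfix
  rw [Fin.sum_univ_castSucc]
  simp only [tG_none_cast, tG_none_last, Fin.castSucc_inj, if_true]

lemma tfix_some {n : ℕ} (e : Equiv.Perm (Fin n)) (f : Fin n) (hf : e f = f) :
    tfix ((tG n).symm (some f, e)) + 1 = tfix e := by
  unfold tfix
  rw [Fin.sum_univ_castSucc, tG_some_last, if_neg (Fin.castSucc_lt_last _).ne, add_zero]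
  have h1 : (1 : ℕ) = ∑ i, if i = f then 1 else 0 := by simp
  refine (congrArg (_ + ·) h1).trans ?_
  rw [← Finset.sum_add_distrib]
  refine Finset.sum_congr rfl fun i _ => ?_
  rw [tG_some_cast]
  by_cases hi : i = f
  · subst hi
    simp [hf, (Fin.castSucc_lt_last _).ne']
  · have : e i ≠ f := fun h => hi (e.injective (h.trans hf.symm))
    simp [hi, this]

lemma tw_none {n : ℕ} (e : Equiv.Perm (Fin n)) :
    tw ((tG n).symm (none, e)) = tw e := by
  unfold tw
  have h2 : ∀ k : Fin (n+1), ¬ (Fin.last n < k) := fun k => Fin.not_lt.2 (Fin.le_last _)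
  simp only [Fin.sum_univ_castSucc, tG_none_cast, tG_none_last, h2, false_and, and_false,
    if_false, Finset.sum_const_zero, add_zero, Fin.castSucc_lt_castSucc_iff, Fin.castSucc_inj]

lemma tw_some {n : ℕ} (e : Equiv.Perm (Fin n)) (f : Fin n) (hf : e f = f) :
    tw ((tG n).symm (some f, e)) = tw e + ∑ k, if f < k ∧ e k = k then 1 else 0 := by
  unfold tw
  have h1 : (∑ k, if f < k ∧ e k = k then 1 else 0) =
      ∑ i, ∑ k, if i = f ∧ f < k ∧ e k = k then 1 else 0 := by
    symm
    rw [Finset.sum_eq_single f]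
    · simp only [true_and]
    · intro b _ hb; simp [hb]
    · simp
  rw [h1, ← Finset.sum_add_distrib, Fin.sum_univ_castSucc]
  have h2 : ∀ k : Fin (n+1), ¬ (Fin.last n < k) := fun k => Fin.not_lt.2 (Fin.le_last _)
  simp only [h2, false_and, if_false, Finset.sum_const_zero, add_zero]
  refine Finset.sum_congr rfl fun i _ => ?_
  rw [← Finset.sum_add_distrib, Fin.sum_univ_castSucc]
  simp only [h2, false_and, and_false, if_false, add_zero]
  refine Finset.sum_congr rfl fun k _ => ?_
  rw [tG_some_cast, tG_some_cast]
  have inj : ∀ i, e i = f ↔ i = f := fun i =>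
    ⟨fun h => e.injective (h.trans hf.symm), fun h => by rw [h, hf]⟩
  simp only [inj]
  by_cases hi : i = f
  · subst hi
    by_cases hk : k = i
    · subst hk; simp
    · have : ¬ (i < k ∧ k < i) := fun h => absurd h.1 (not_lt.2 h.2.le)
      simp only [hf, hk, if_true, if_false, Fin.castSucc_lt_castSucc_iff, Fin.castSucc_lt_last,
        h2, false_or, true_and, Fin.castSucc_inj]
      have h4 : ¬ (i < k ∧ k < i ∧ (i < e k ∨ e k = k)) := fun h => this ⟨h.1, h.2.1⟩
      rw [if_neg h4, zero_add]
  · by_cases hk : k = f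
    · subst hk; simp [hi, hf, Fin.castSucc_lt_last]
    · simp [hi, hk]

lemma sum_rank {α : Type*} [LinearOrder α] (S : Finset α) :
    ∑ f ∈ S, (X : Polynomial ℤ) ^ (S.filter (fun k => f < k)).card = qn S.card := by
  induction S using Finset.induction_on_min with
  | empty => simp [qn]
  | insert a s h ih =>
    have ha : a ∉ s := fun h' => lt_irrefl _ (h a h')
    rw [Finset.sum_insert ha, Finset.card_insert_of_notMem ha, qn, Finset.sum_range_succ, ← qn,
      ← ih, add_comm]
    congr 1
    · refine Finset.sum_congr rfl fun f hf => ?_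
      rw [Finset.filter_insert, if_neg (not_lt.2 (h f hf).le)]
    · rw [Finset.filter_insert, if_neg (lt_irrefl _), Finset.filter_true_of_mem h]

open Classical in
noncomputable def tA (n m : ℕ) : Polynomial ℤ :=
  ∑ σ : Equiv.Perm (Fin n), if tinv σ ∧ tfix σ + n = 2 * m then X ^ tw σ else 0

lemma tA_succ (n m : ℕ) : tA (n+1) m =
    (if m = 0 then 0 else tA n (m-1)) + tA n m * qn (2 * m - n) := by
  classical
  have hm : (if m = 0 then 0 else tA n (m-1)) =
      ∑ e : Equiv.Perm (Fin n), if tinv e ∧ tfix e + 1 + (n + 1) = 2 * m then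
        (X : Polynomial ℤ) ^ tw e else 0 := by
    split_ifs with h
    · subst h; simp
    · unfold tA
      refine Finset.sum_congr rfl fun e _ => ?_
      congr 1
      simp only [eq_iff_iff]
      refine and_congr_right fun _ => ?_
      omega
  rw [hm, tA, sum_tG, tA, Finset.sum_mul, ← Finset.sum_add_distrib]
  refine Finset.sum_congr rfl fun e _ => ?_
  rw [tinv_none, tfix_none, tw_none]
  congr 1
  have key : ∀ f, (if tinv ((tG n).symm (some f, e)) ∧
      tfix ((tG n).symm (some f, e)) + (n + 1) = 2 * m then
        (X : Polynomial ℤ) ^ tw ((tG n).symm (some f, e)) else 0) =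
      if e f = f then (if tinv e ∧ tfix e + n = 2 * m then X ^ tw e else 0) *
        X ^ ((Finset.univ.filter (fun k => e k = k)).filter (fun k => f < k)).card else 0 := by
    intro f
    rw [tinv_some]
    by_cases hf : e f = f
    · have h1 := tfix_some e f hf
      have h2 : tfix ((tG n).symm (some f, e)) + (n + 1) = tfix e + n := by omega
      rw [h2, tw_some e f hf]
      have h3 : (∑ k, if f < k ∧ e k = k then 1 else 0) =
        ((Finset.univ.filter (fun k => e k = k)).filter (fun k => f < k)).card := by
        rw [Finset.filter_filter, Finset.card_filter]
        simp only [and_comm]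
      rw [h3, pow_add]
      simp [hf]
    · simp [hf]
  simp only [key]
  rw [← Finset.sum_filter, ← Finset.mul_sum, sum_rank]
  split_ifs with h
  · congr 2
    have : tfix e = (Finset.univ.filter (fun k => e k = k)).card := by
      rw [Finset.card_filter]; rfl
    omega
  · simp

/-- rank statistic of a set of openings -/
def tr (S : Finset ℕ) (j : ℕ) : ℕ :=
  (S.filter fun s => s ≤ (S.filter fun t => t < s).card + j).card

noncomputable def tR (n m : ℕ) : Polynomial ℤ :=
  ∑ S ∈ Finset.powersetCard m (Finset.range n), ∏ j ∈ Finset.range (n - m), qn (tr S j - j)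

lemma tr_insert (n j : ℕ) (S : Finset ℕ) (hS : S ⊆ Finset.range n) (hj : j < n - S.card) :
    tr (insert n S) j = tr S j := by
  unfold tr
  have hlt : ∀ s ∈ S, s < n := fun s hs => Finset.mem_range.1 (hS hs)
  have h1 : (insert n S).filter (fun t => t < n) = S := by
    rw [Finset.filter_insert, if_neg (lt_irrefl _), Finset.filter_true_of_mem hlt]
  rw [Finset.filter_insert, h1, if_neg (by omega)]
  congr 1
  refine Finset.filter_congr fun s hs => ?_
  rw [Finset.filter_insert, if_neg (not_lt.2 (hlt s hs).le)]

lemma tr_last (n : ℕ) (S : Finset ℕ) (hS : S ⊆ Finset.range n) :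
    tr S (n - S.card) = S.card := by
  unfold tr
  congr 1
  refine Finset.filter_true_of_mem fun s hs => ?_
  have hs' : s < n := Finset.mem_range.1 (hS hs)
  have h1 := Finset.card_le_card (s := Finset.range s \ S.filter (fun t => t < s))
    (t := Finset.range n \ S) (by
      intro x; simp only [Finset.mem_sdiff, Finset.mem_range, Finset.mem_filter]
      intro h
      exact ⟨by omega, fun hx => h.2 ⟨hx, h.1⟩⟩)
  rw [Finset.card_sdiff_of_subset hS, Finset.card_sdiff_of_subset (by
    intro x; simp), Finset.card_range, Finset.card_range] at h1
  omega

lemma tR_succ (n m : ℕ) : tR (n+1) m =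
    (if m = 0 then 0 else tR n (m-1)) + tR n m * qn (2 * m - n) := by
  have hB : ∑ S ∈ Finset.powersetCard m (Finset.range n),
      ∏ j ∈ Finset.range (n + 1 - m), qn (tr S j - j) = tR n m * qn (2 * m - n) := by
    rw [tR, Finset.sum_mul]
    refine Finset.sum_congr rfl fun S hS => ?_
    rw [Finset.mem_powersetCard] at hS
    obtain ⟨hS, hc⟩ := hS
    have hle := Finset.card_le_card hS
    rw [Finset.card_range] at hle
    have h1 : n + 1 - m = (n - m) + 1 := by omega
    rw [h1, Finset.prod_range_succ]
    subst hc
    rw [tr_last n S hS]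
    congr 2
    omega
  cases m with
  | zero =>
    rw [if_pos rfl, zero_add, ← hB, tR]
    simp
  | succ m =>
    rw [if_neg (by omega), ← hB, tR, Finset.range_add_one,
      Finset.powersetCard_succ_insert Finset.notMem_range_self, Finset.sum_union, add_comm]
    · congr 1
      rw [Finset.sum_image]
      · rw [tR]
        refine Finset.sum_congr rfl fun S hS => ?_
        simp only [Nat.add_sub_cancel] at *
        rw [Finset.mem_powersetCard] at hS
        have h1 : n + 1 - (m + 1) = n - m := by omega
        rw [h1]
        refine Finset.prod_congr rfl fun j hj => ?_
        rw [tr_insert n j S hS.1]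
        rw [hS.2]; exact Finset.mem_range.1 hj
      · intro S hS T hT h
        have hS := (Finset.mem_powersetCard.1 hS).1
        have hT := (Finset.mem_powersetCard.1 hT).1
        have h1 : n ∉ S := fun h => by simpa using hS h
        have h2 : n ∉ T := fun h => by simpa using hT h
        rw [← Finset.erase_insert h1, ← Finset.erase_insert h2]
        exact congrArg (fun U => Finset.erase U n) h
    · rw [Finset.disjoint_left]
      intro S hS hS'
      obtain ⟨T, _, rfl⟩ := Finset.mem_image.1 hS'
      have := (Finset.mem_powersetCard.1 hS).1 (Finset.mem_insert_self n T)
      simp at this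

lemma tA_eq_tR (n : ℕ) : ∀ m, tA n m = tR n m := by
  induction n with
  | zero =>
    intro m
    cases m with
    | zero => simp [tA, tR, tinv, tfix, tw]
    | succ m => simp [tA, tR, tinv, tfix, tw]
  | succ n ih => intro m; rw [tA_succ, tR_succ, ih, ih]

lemma crossings_eq_tw {n : ℕ} (σ : Equiv.Perm (Fin n)) (h : ∀ x, σ x ≠ x) :
    crossings σ = tw σ := by
  classical
  rw [crossings, Nat.card_eq_fintype_card, Fintype.card_subtype, Finset.card_filter, tw,
    Fintype.sum_prod_type]
  simp [h]

lemma sum_c_eq (n m : ℕ) (hm : n = 2 * m) :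
    ∑ c : {c : Fin m → Fin n // StrictMono c},
        ∏ j : Fin m, qn
            ((Finset.univ.filter fun i : Fin m =>
                ((c : Fin m → Fin n) i : ℕ) ≤ (i : ℕ) + (j : ℕ)).card - (j : ℕ)) = tR n m := by
  unfold tR
  have inj : ∀ c : {c : Fin m → Fin n // StrictMono c},
      StrictMono (fun i => ((c : Fin m → Fin n) i : ℕ)) := fun c i j h => c.2 h
  refine Finset.sum_bij (fun c _ => Finset.univ.image (fun i => ((c : Fin m → Fin n) i : ℕ)))
    ?_ ?_ ?_ ?_
  · intro c _
    rw [Finset.mem_powersetCard]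
    refine ⟨?_, ?_⟩
    · intro x hx
      obtain ⟨i, _, rfl⟩ := Finset.mem_image.1 hx
      simp
    · rw [Finset.card_image_of_injective _ (inj c).injective]; simp
  · intro c _ d _ h
    have h2 : Set.range (fun i => ((c : Fin m → Fin n) i : ℕ)) =
        Set.range (fun i => ((d : Fin m → Fin n) i : ℕ)) := by
      have := congrArg (fun s : Finset ℕ => (s : Set ℕ)) h
      simpa using this
    have h3 := (StrictMono.range_inj (inj c) (inj d)).1 h2
    apply Subtype.ext
    funext i
    exact Fin.ext (congrFun h3 i)
  · intro S hS
    rw [Finset.mem_powersetCard] at hS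
    refine ⟨⟨fun i => ⟨S.orderEmbOfFin hS.2 i,
      Finset.mem_range.1 (hS.1 (Finset.orderEmbOfFin_mem S hS.2 i))⟩, ?_⟩, Finset.mem_univ _, ?_⟩
    · intro i j h
      exact (S.orderEmbOfFin hS.2).strictMono h
    · simp
  · intro c _
    have h1 : n - m = m := by omega
    rw [h1, Finset.prod_range]
    refine Finset.prod_congr rfl fun j _ => ?_
    congr 2
    rw [tr, Finset.filter_image, Finset.card_image_of_injective _ (inj c).injective]
    congr 1
    refine Finset.filter_congr fun i _ => ?_
    rw [Finset.filter_image, Finset.card_image_of_injective _ (inj c).injective]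
    have : (Finset.univ.filter fun t : Fin m =>
        ((c : Fin m → Fin n) t : ℕ) < ((c : Fin m → Fin n) i : ℕ)) = Finset.Iio i := by
      ext t
      simpa using (inj c).lt_iff_lt
    rw [this, Fin.card_Iio]

open Classical in
/-- The Touchard polynomial `T_m(q) = ∑_σ q^{v(σ)}`, summed over fixed-point-free
involutions of `{0, …, 2m-1}`, equals
`∑_{c₀ < ⋯ < c_{m-1}} ∏_j [r_j - j]_q` where, for each strictly increasing
sequence `c` of opening nodes, `r_j = #{i : c_i ≤ i + j}` (0-indexed). -/
theorem touchard_polynomial_eq_sum_over_openings (m : ℕ) :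
    ∑ σ : Equiv.Perm (Fin (2 * m)),
      (if σ * σ = 1 ∧ (∀ x, σ x ≠ x) then (X : Polynomial ℤ) ^ crossings σ else 0) =
      ∑ c : {c : Fin m → Fin (2 * m) // StrictMono c},
        ∏ j : Fin m,
          ∑ t ∈ Finset.range
            ((Finset.univ.filter fun i : Fin m =>
                ((c : Fin m → Fin (2 * m)) i : ℕ) ≤ (i : ℕ) + (j : ℕ)).card - (j : ℕ)),
            (X : Polynomial ℤ) ^ t := by
  have h := (sum_c_eq (2 * m) m rfl).trans (tA_eq_tR (2 * m) m).symm
  unfold qn at h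
  rw [h, tA]
  refine Finset.sum_congr rfl fun σ _ => ?_
  have hiff : (σ * σ = 1 ∧ ∀ x, σ x ≠ x) ↔ (tinv σ ∧ tfix σ + 2 * m = 2 * m) := by
    refine and_congr ?_ ?_
    · rw [Equiv.ext_iff]; rfl
    · simp [tfix]
  by_cases hσ : σ * σ = 1 ∧ ∀ x, σ x ≠ x
  · rw [if_pos hσ, if_pos (hiff.1 hσ), crossings_eq_tw σ hσ.2]
  · rw [if_neg hσ, if_neg (fun h => hσ (hiff.2 h))]
end

section
/- Let T ∈ M_{2m}(F_q) be a diagonal matrix with 2m distinct diagonal entries. Then the number of m-dimensional subspaces W ⊆ F_q^{2m} with W + T W = F_q^{2m} equals (q−1)^m · q^{binom(m,2)} · T_m(q), where T_m(q) = ∑_σ q^{v(σ)} is the generating polynomial of fixed-point-free involutions of {1,…,2m} by number of crossings. -/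
/-- Weight: number of crossings, where a fixed point counts as an open half-arc. -/
def arcWt {n : ℕ} (f : Fin n → Fin n) : ℕ :=
  ∑ i, ∑ k, if i < k ∧ k < f i ∧ (f i < f k ∨ f k = k) then 1 else 0

def fixPts {n : ℕ} (f : Fin n → Fin n) : Finset (Fin n) := Finset.univ.filter (fun i => f i = i)

open Classical in
noncomputable def invSet (n h : ℕ) : Finset (Fin n → Fin n) :=
  Finset.univ.filter (fun f => (∀ i, f (f i) = i) ∧ (fixPts f).card = h)

noncomputable def invSum (q n h : ℕ) : ℕ := ∑ f ∈ invSet n h, q ^ arcWt f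

def extFix {n : ℕ} (f : Fin n → Fin n) : Fin (n+1) → Fin (n+1) :=
  Fin.snoc (α := fun _ => Fin (n+1)) (fun i => (f i).castSucc) (Fin.last n)

def extMatch {n : ℕ} (f : Fin n → Fin n) (a : Fin n) : Fin (n+1) → Fin (n+1) :=
  Fin.snoc (α := fun _ => Fin (n+1)) (fun i => if i = a then Fin.last n else (f i).castSucc)
    a.castSucc

def restr {n : ℕ} (g : Fin (n+1) → Fin (n+1)) : Fin n → Fin n := fun i =>
  if h : g i.castSucc = Fin.last n then i else (g i.castSucc).castPred h

@[simp] lemma extFix_castSucc {n : ℕ} (f : Fin n → Fin n) (i : Fin n) :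
    extFix f i.castSucc = (f i).castSucc := by simp [extFix]
@[simp] lemma extFix_last {n : ℕ} (f : Fin n → Fin n) :
    extFix f (Fin.last n) = Fin.last n := by simp [extFix]
@[simp] lemma extMatch_castSucc {n : ℕ} (f : Fin n → Fin n) (a i : Fin n) :
    extMatch f a i.castSucc = if i = a then Fin.last n else (f i).castSucc := by simp [extMatch]
@[simp] lemma extMatch_last {n : ℕ} (f : Fin n → Fin n) (a : Fin n) :
    extMatch f a (Fin.last n) = a.castSucc := by simp [extMatch]

lemma card_fixPts {n : ℕ} (f : Fin n → Fin n) :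
    (fixPts f).card = ∑ i, if f i = i then 1 else 0 := by
  simp [fixPts]

lemma not_last_lt {n : ℕ} (x : Fin (n+1)) : ¬ Fin.last n < x := not_lt.2 (Fin.le_last x)

lemma arcWt_extFix {n : ℕ} (f : Fin n → Fin n) : arcWt (extFix f) = arcWt f := by
  simp [arcWt, Fin.sum_univ_castSucc, not_last_lt, -Finset.sum_boole]

lemma card_extFix {n : ℕ} (f : Fin n → Fin n) :
    (fixPts (extFix f)).card = (fixPts f).card + 1 := by
  simp [card_fixPts, Fin.sum_univ_castSucc, -Finset.sum_boole]

lemma arcWt_extMatch {n : ℕ} (f : Fin n → Fin n) (a : Fin n)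
    (ha : f a = a) :
    arcWt (extMatch f a) = arcWt f + ((fixPts f).filter (a < ·)).card := by
  have h2 : ((fixPts f).filter (a < ·)).card =
      ∑ i, ∑ k, if i = a then (if a < k ∧ f k = k then 1 else 0) else 0 := by
    rw [Finset.sum_comm]
    simp [fixPts, Finset.filter_filter, and_comm]
  rw [h2, arcWt, arcWt, ← Finset.sum_add_distrib, Fin.sum_univ_castSucc]
  simp only [not_last_lt, false_and, if_false, Finset.sum_const_zero, add_zero]
  refine Finset.sum_congr rfl fun i _ => ?_
  rw [← Finset.sum_add_distrib, Fin.sum_univ_castSucc]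
  simp only [not_last_lt, false_and, and_false, if_false, add_zero]
  refine Finset.sum_congr rfl fun k _ => ?_
  by_cases hi : i = a
  · subst hi
    by_cases hk : k = i
    · subst hk; simp
    · have : ¬ (k < i ∧ i < k) := fun h => lt_asymm h.1 h.2
      have h3 : ¬ (i < k ∧ k < i ∧ (i < f k ∨ f k = k)) := fun h => lt_asymm h.1 h.2.1
      simp [hk, ha, not_last_lt, Fin.castSucc_lt_last, h3]
  · by_cases hk : k = a
    · subst hk
      simp [hi, ha, Fin.castSucc_lt_last]
    · simp [hi, hk]

lemma card_extMatch {n : ℕ} (f : Fin n → Fin n) (a : Fin n) (ha : f a = a) :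
    (fixPts (extMatch f a)).card + 1 = (fixPts f).card := by
  have : (fixPts f).card = ∑ i, ((if i ≠ a ∧ f i = i then 1 else 0) + if i = a then 1 else 0) := by
    rw [card_fixPts]
    refine Finset.sum_congr rfl fun i _ => ?_
    by_cases hi : i = a <;> simp [hi, ha]
  rw [this, Finset.sum_add_distrib, card_fixPts, Fin.sum_univ_castSucc]
  have h1 : ∀ i : Fin n, (if extMatch f a i.castSucc = i.castSucc then 1 else 0) =
      (if i ≠ a ∧ f i = i then 1 else 0) := by
    intro i
    by_cases hi : i = a
    · simp [hi, (Fin.castSucc_lt_last _).ne']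
    · simp [hi]
  simp only [h1]
  simp [(Fin.castSucc_lt_last _).ne]

lemma sum_pow_card_filter {α : Type*} [LinearOrder α] (q : ℕ) (s : Finset α) :
    ∑ a ∈ s, q ^ (s.filter (a < ·)).card = ∑ i ∈ Finset.range s.card, q ^ i := by
  induction s using Finset.induction_on_min with
  | empty => simp
  | insert a s hs ih =>
    have ha : a ∉ s := fun h => lt_irrefl _ (hs a h)
    rw [Finset.sum_insert ha, Finset.card_insert_of_notMem ha, Finset.sum_range_succ, ← ih, add_comm]
    congr 1
    · refine Finset.sum_congr rfl fun b hb => ?_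
      rw [Finset.filter_insert, if_neg (not_lt.2 (hs b hb).le)]
    · rw [Finset.filter_insert, if_neg (lt_irrefl _), Finset.filter_true_of_mem hs]

lemma mem_invSet {n h : ℕ} {f : Fin n → Fin n} :
    f ∈ invSet n h ↔ (∀ i, f (f i) = i) ∧ (fixPts f).card = h := by simp [invSet]

lemma extFix_restr {n : ℕ} (g : Fin (n+1) → Fin (n+1)) (hg : ∀ i, g (g i) = i)
    (hl : g (Fin.last n) = Fin.last n) : extFix (restr g) = g := by
  funext i
  induction i using Fin.lastCases with
  | last => simp [hl]
  | cast i =>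
    have : g i.castSucc ≠ Fin.last n := fun h => by
      have := hg i.castSucc
      rw [h, hl] at this
      exact (Fin.castSucc_lt_last i).ne' this
    simp [restr, this]

lemma extMatch_restr {n : ℕ} (g : Fin (n+1) → Fin (n+1)) (hg : ∀ i, g (g i) = i)
    (a : Fin n) (hl : g (Fin.last n) = a.castSucc) : extMatch (restr g) a = g := by
  have ha : g a.castSucc = Fin.last n := by rw [← hl, hg]
  funext i
  induction i using Fin.lastCases with
  | last => simp [hl]
  | cast i =>
    by_cases hi : i = a
    · simp [hi, ha]
    · have : g i.castSucc ≠ Fin.last n := fun h => by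
        have := hg i.castSucc
        rw [h, hl] at this
        exact hi (Fin.castSucc_injective _ this.symm)
      simp [restr, this, hi]

lemma restr_extFix {n : ℕ} (f : Fin n → Fin n) : restr (extFix f) = f := by
  funext i
  simp [restr, (Fin.castSucc_lt_last _).ne]

lemma restr_extMatch {n : ℕ} (f : Fin n → Fin n) (a : Fin n) (ha : f a = a) :
    restr (extMatch f a) = f := by
  funext i
  by_cases hi : i = a
  · simp [restr, hi, ha]
  · simp [restr, hi, (Fin.castSucc_lt_last _).ne]

lemma extFix_inv {n : ℕ} (f : Fin n → Fin n) :
    (∀ i, extFix f (extFix f i) = i) ↔ ∀ i, f (f i) = i := by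
  simp [Fin.forall_fin_succ']

lemma extMatch_inv {n : ℕ} (f : Fin n → Fin n) (a : Fin n) (ha : f a = a)
    (hf : ∀ i, f (f i) = i) (i) : extMatch f a (extMatch f a i) = i := by
  induction i using Fin.lastCases with
  | last => simp
  | cast i =>
    by_cases hi : i = a
    · simp [hi]
    · have : f i ≠ a := fun h => hi (by rw [← hf i, h, ha])
      simp [hi, this, hf]

lemma restr_inv {n : ℕ} (g : Fin (n+1) → Fin (n+1)) (hg : ∀ i, g (g i) = i) (i) :
    restr g (restr g i) = i := by
  by_cases h : g i.castSucc = Fin.last n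
  · simp [restr, h]
  · simp [restr, h, hg, (Fin.castSucc_lt_last _).ne]

lemma invSum_fix (q n h : ℕ) :
    ∑ g ∈ (invSet (n+1) (h+1)).filter (fun g => g (Fin.last n) = Fin.last n), q ^ arcWt g
      = invSum q n h := by
  refine Finset.sum_bij' (fun g _ => restr g) (fun f _ => extFix f) ?_ ?_ ?_ ?_ ?_
  · intro g hg
    simp only [Finset.mem_filter, mem_invSet] at hg ⊢
    refine ⟨restr_inv g hg.1.1, ?_⟩
    have := card_extFix (restr g)
    rw [extFix_restr g hg.1.1 hg.2] at this
    omega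
  · intro f hf
    simp only [Finset.mem_filter, mem_invSet] at hf ⊢
    exact ⟨⟨(extFix_inv f).2 hf.1, by rw [card_extFix, hf.2]⟩, by simp⟩
  · intro g hg
    simp only [Finset.mem_filter, mem_invSet] at hg
    exact extFix_restr g hg.1.1 hg.2
  · intro f hf
    exact restr_extFix f
  · intro g hg
    simp only [Finset.mem_filter, mem_invSet] at hg
    rw [← arcWt_extFix (restr g), extFix_restr g hg.1.1 hg.2]

lemma invSum_fix_zero (q n : ℕ) :
    ∑ g ∈ (invSet (n+1) 0).filter (fun g => g (Fin.last n) = Fin.last n), q ^ arcWt g = 0 := by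
  rw [Finset.sum_eq_zero]
  intro g hg
  simp only [Finset.mem_filter, mem_invSet, fixPts, Finset.card_eq_zero,
    Finset.filter_eq_empty_iff] at hg
  exact absurd hg.2 (hg.1.2 (Finset.mem_univ _))

lemma invSum_match (q n h : ℕ) :
    ∑ g ∈ (invSet (n+1) h).filter (fun g => ¬ g (Fin.last n) = Fin.last n), q ^ arcWt g
      = (∑ i ∈ Finset.range (h+1), q ^ i) * invSum q n (h+1) := by
  have h1 : (∑ i ∈ Finset.range (h+1), q ^ i) * invSum q n (h+1) =
      ∑ x ∈ (invSet n (h+1)).sigma (fun f => fixPts f), q ^ arcWt (extMatch x.1 x.2) := by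
    rw [Finset.sum_sigma, invSum, Finset.mul_sum]
    refine Finset.sum_congr rfl fun f hf => ?_
    rw [mem_invSet] at hf
    rw [← hf.2, ← sum_pow_card_filter, Finset.sum_mul]
    refine Finset.sum_congr rfl fun a ha => ?_
    simp only [fixPts, Finset.mem_filter] at ha
    rw [arcWt_extMatch f a ha.2, pow_add, mul_comm]
  rw [h1]
  symm
  refine Finset.sum_bij (fun x _ => extMatch x.1 x.2) ?_ ?_ ?_ ?_
  · rintro ⟨f, a⟩ hx
    simp only [Finset.mem_sigma, mem_invSet] at hx
    have ha : f a = a := by simpa [fixPts] using hx.2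
    simp only [Finset.mem_filter, mem_invSet]
    refine ⟨⟨extMatch_inv f a ha hx.1.1, ?_⟩, by simp [(Fin.castSucc_lt_last _).ne]⟩
    have := card_extMatch f a ha
    omega
  · rintro ⟨f, a⟩ hx ⟨f', a'⟩ hx' he
    simp only [Finset.mem_sigma, mem_invSet] at hx hx'
    have ha : f a = a := by simpa [fixPts] using hx.2
    have ha' : f' a' = a' := by simpa [fixPts] using hx'.2
    simp only at he
    have e1 : f = f' := by rw [← restr_extMatch f a ha, he, restr_extMatch f' a' ha']
    have e2 : a = a' := by simpa using congrFun he (Fin.last n)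
    rw [e1, e2]
  · intro g hg
    simp only [Finset.mem_filter, mem_invSet] at hg
    obtain ⟨a, ha⟩ : ∃ a : Fin n, a.castSucc = g (Fin.last n) := Fin.exists_castSucc_eq.2 hg.2
    have hga : g a.castSucc = Fin.last n := by rw [ha, hg.1.1]
    have hr := extMatch_restr g hg.1.1 a ha.symm
    have hfa : restr g a = a := by simp [restr, hga]
    refine ⟨⟨restr g, a⟩, ?_, hr⟩
    simp only [Finset.mem_sigma, mem_invSet]
    refine ⟨⟨restr_inv g hg.1.1, ?_⟩, by simp [fixPts, hfa]⟩
    have := card_extMatch (restr g) a hfa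
    rw [hr] at this
    omega
  · intros; rfl

lemma invSum_succ_zero (q n : ℕ) : invSum q (n+1) 0 = invSum q n 1 := by
  rw [invSum, ← Finset.sum_filter_add_sum_filter_not _ (fun g => g (Fin.last n) = Fin.last n),
    invSum_fix_zero, invSum_match]
  simp

lemma invSum_succ_succ (q n h : ℕ) : invSum q (n+1) (h+1) =
    invSum q n h + (∑ i ∈ Finset.range (h+2), q ^ i) * invSum q n (h+2) := by
  rw [invSum, ← Finset.sum_filter_add_sum_filter_not _ (fun g => g (Fin.last n) = Fin.last n),
    invSum_fix, invSum_match]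

lemma invSum_zero_zero (q : ℕ) : invSum q 0 0 = 1 := by
  have : invSet 0 0 = {id} := by
    ext f
    simp [mem_invSet, fixPts, Subsingleton.elim f id]
  simp [invSum, this, arcWt]

lemma invSum_of_lt (q : ℕ) : ∀ n h, n < h → invSum q n h = 0 := by
  intro n h hn
  rw [invSum, Finset.sum_eq_zero]
  intro f hf
  rw [mem_invSet] at hf
  have := Finset.card_le_univ (fixPts f)
  simp at this
  omega

open Classical in
lemma perm_sum_eq (q N : ℕ) :
    (∑ σ : Equiv.Perm (Fin N),
      (if σ * σ = 1 ∧ (∀ x, σ x ≠ x) then q ^ crossings σ else 0)) = invSum q N 0 := by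
  rw [← Finset.sum_filter, invSum]
  refine Finset.sum_bij (fun σ _ => ⇑σ) ?_ ?_ ?_ ?_
  · intro σ hσ
    simp only [Finset.mem_filter, Finset.mem_univ, true_and] at hσ
    rw [mem_invSet]
    refine ⟨fun i => ?_, by simp [fixPts, hσ.2]⟩
    rw [← Equiv.Perm.mul_apply, hσ.1]; rfl
  · intro σ _ τ _ h
    exact DFunLike.coe_injective h
  · intro f hf
    rw [mem_invSet] at hf
    refine ⟨Function.Involutive.toPerm f hf.1, ?_, rfl⟩
    simp only [Finset.mem_filter, Finset.mem_univ, true_and]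
    refine ⟨Equiv.ext fun i => hf.1 i, fun x hx => ?_⟩
    have hx' : f x = x := hx
    have : x ∈ fixPts f := by simpa [fixPts] using hx'
    rw [Finset.card_eq_zero.1 hf.2] at this
    simp at this
  · intro σ hσ
    simp only [Finset.mem_filter, Finset.mem_univ, true_and] at hσ
    congr 1
    rw [crossings, Nat.card_eq_fintype_card, Fintype.card_subtype, arcWt, Finset.card_filter,
      Fintype.sum_prod_type]
    simp [hσ.2]
section LinPart
variable {F V : Type*} [Field F] [AddCommGroup V] [Module F V]

def cyl (W : Submodule F V) : Submodule F (F × V) :=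
  LinearMap.range ((LinearMap.id : F →ₗ[F] F).prodMap W.subtype)

def gr (W : Submodule F V) (φ : Module.Dual F W) : Submodule F (F × V) :=
  LinearMap.range (φ.prod W.subtype)

def liftOp (S : V →ₗ[F] V) : (F × V) →ₗ[F] (F × V) := (0 : F →ₗ[F] F).prodMap S

lemma mem_cyl {W : Submodule F V} {x : F × V} : x ∈ cyl W ↔ x.2 ∈ W := by
  constructor
  · rintro ⟨y, rfl⟩; simp
  · intro h; exact ⟨(x.1, ⟨x.2, h⟩), by simp⟩

lemma mem_gr {W : Submodule F V} {φ : Module.Dual F W} {x : F × V} :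
    x ∈ gr W φ ↔ ∃ w : W, (φ w, (w : V)) = x := Iff.rfl

lemma finrank_cyl [FiniteDimensional F V] (W : Submodule F V) :
    Module.finrank F (cyl W) = Module.finrank F W + 1 := by
  rw [cyl, LinearMap.finrank_range_of_inj]
  · simp [add_comm]
  · rintro ⟨a, b⟩ ⟨c, d⟩ h
    simpa using h

lemma finrank_gr (W : Submodule F V) (φ : Module.Dual F W) :
    Module.finrank F (gr W φ) = Module.finrank F W := by
  rw [gr, LinearMap.finrank_range_of_inj]
  intro a b h
  have := congrArg Prod.snd h
  simpa using this

lemma map_snd_cyl (W : Submodule F V) : (cyl W).map (LinearMap.snd F F V) = W := by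
  ext v
  simp [Submodule.mem_map, mem_cyl]

lemma map_snd_gr (W : Submodule F V) (φ : Module.Dual F W) :
    (gr W φ).map (LinearMap.snd F F V) = W := by
  ext v
  simp [Submodule.mem_map, mem_gr]

lemma e_notMem_gr (W : Submodule F V) (φ : Module.Dual F W) : ((1 : F), (0 : V)) ∉ gr W φ := by
  rintro ⟨w, hw⟩
  have h2 : (w : V) = 0 := congrArg Prod.snd hw
  have h1 : φ w = 1 := congrArg Prod.fst hw
  have : w = 0 := by simpa using h2
  simp [this] at h1

lemma gr_injective (W : Submodule F V) : Function.Injective (gr W) := by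
  intro φ ψ h
  ext w
  have : (φ w, (w : V)) ∈ gr W ψ := h ▸ mem_gr.2 ⟨w, rfl⟩
  obtain ⟨w', hw'⟩ := this
  have h2 : (w' : V) = w := congrArg Prod.snd hw'
  have h1 : ψ w' = φ w := congrArg Prod.fst hw'
  rw [← h1, Subtype.ext h2]

lemma cyl_of_mem (U : Submodule F (F × V)) (h : ((1 : F), (0 : V)) ∈ U) :
    cyl (U.map (LinearMap.snd F F V)) = U := by
  ext ⟨a, v⟩
  rw [mem_cyl]
  constructor
  · rintro ⟨⟨b, v'⟩, hb, hv⟩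
    have hv : v' = v := hv
    subst hv
    have := U.add_mem hb (U.smul_mem (a - b) h)
    simpa using this
  · intro h; exact ⟨_, h, rfl⟩

lemma exists_gr (U : Submodule F (F × V)) (h : ((1 : F), (0 : V)) ∉ U) :
    ∃ φ, gr (U.map (LinearMap.snd F F V)) φ = U := by
  have key : ∀ a : F, (a, (0 : V)) ∈ U → a = 0 := by
    intro a ha
    by_contra h0
    apply h
    have := U.smul_mem a⁻¹ ha
    simpa [h0] using this
  have inj : ∀ (a b : F) (v : V), (a, v) ∈ U → (b, v) ∈ U → a = b := by
    intro a b v ha hb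
    have := U.sub_mem ha hb
    rw [Prod.mk_sub_mk, sub_self] at this
    exact sub_eq_zero.1 (key _ this)
  have ex : ∀ w : U.map (LinearMap.snd F F V), ∃ a : F, (a, (w : V)) ∈ U := by
    rintro ⟨w, ⟨⟨a, v⟩, hu, hw⟩⟩
    have hw : v = w := hw
    subst hw
    exact ⟨a, hu⟩
  choose g hg using ex
  refine ⟨{ toFun := g, map_add' := ?_, map_smul' := ?_ }, ?_⟩
  · intro x y
    refine inj _ _ _ (hg _) ?_
    simpa using U.add_mem (hg x) (hg y)
  · intro c x
    refine inj _ _ _ (hg _) ?_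
    simpa using U.smul_mem c (hg x)
  · ext ⟨a, v⟩
    constructor
    · rintro ⟨w, hw⟩
      rw [← hw]
      exact hg w
    · intro hav
      refine ⟨⟨v, ⟨_, hav, rfl⟩⟩, ?_⟩
      exact Prod.ext (inj _ _ _ (hg _) hav) rfl

lemma map_snd_sup (S : V →ₗ[F] V) (U : Submodule F (F × V)) :
    (U ⊔ U.map (liftOp S)).map (LinearMap.snd F F V) =
      U.map (LinearMap.snd F F V) ⊔ (U.map (LinearMap.snd F F V)).map S := by
  rw [Submodule.map_sup, ← Submodule.map_comp, ← Submodule.map_comp]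
  rfl

lemma top_iff (U : Submodule F (F × V)) :
    U = ⊤ ↔ ((1 : F), (0 : V)) ∈ U ∧ U.map (LinearMap.snd F F V) = ⊤ := by
  constructor
  · rintro rfl
    simp [LinearMap.range_eq_top.2 LinearMap.snd_surjective]
  · rintro ⟨h1, h2⟩
    rw [← cyl_of_mem U h1, h2]
    ext x; simp [mem_cyl]

lemma cyl_good (S : V →ₗ[F] V) (W : Submodule F V) :
    cyl W ⊔ (cyl W).map (liftOp S) = ⊤ ↔ W ⊔ W.map S = ⊤ := by
  rw [top_iff, map_snd_sup, map_snd_cyl]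
  refine and_iff_right (Submodule.mem_sup_left ?_)
  simp [mem_cyl]

lemma gr_good (S : V →ₗ[F] V) (W : Submodule F V) (φ : Module.Dual F W) :
    gr W φ ⊔ (gr W φ).map (liftOp S) = ⊤ ↔
      W ⊔ W.map S = ⊤ ∧ φ ∉ ((W.map S).comap W.subtype).dualAnnihilator := by
  rw [top_iff, map_snd_sup, map_snd_gr, and_comm]
  refine and_congr_right fun _ => ?_
  rw [Submodule.mem_dualAnnihilator]
  push Not
  constructor
  · intro h
    obtain ⟨y, ⟨w, rfl⟩, z, ⟨_, ⟨w', rfl⟩, rfl⟩, he⟩ := Submodule.mem_sup.1 h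
    have h2 : (w : V) + S w' = 0 := congrArg Prod.snd he
    have h1 : φ w + 0 = 1 := congrArg Prod.fst he
    refine ⟨w, ⟨-w', W.neg_mem w'.2, ?_⟩, ?_⟩
    · simp only [map_neg, Submodule.subtype_apply]
      exact (eq_neg_of_add_eq_zero_left h2).symm
    · rw [add_zero] at h1; simp [h1]
  · rintro ⟨w, ⟨y, hy, hyw⟩, hw⟩
    have h1 : (φ w, (w : V)) ∈ gr W φ := ⟨w, rfl⟩
    have h2 : ((0 : F), S y) ∈ (gr W φ).map (liftOp S) :=
      ⟨(φ ⟨y, hy⟩, y), ⟨⟨y, hy⟩, rfl⟩, rfl⟩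
    have h3 := Submodule.smul_mem _ (φ w)⁻¹
      (Submodule.sub_mem _ (Submodule.mem_sup_left h1) (Submodule.mem_sup_right h2))
    have hyw : S y = w := hyw
    simpa [hyw, hw] using h3

variable [Finite V]

noncomputable def goodSet (S : V →ₗ[F] V) (k : ℕ) : Finset (Submodule F V) :=
  (Set.toFinite {W : Submodule F V | Module.finrank F W = k ∧ W ⊔ W.map S = ⊤}).toFinset

lemma mem_goodSet {S : V →ₗ[F] V} {k : ℕ} {W : Submodule F V} :
    W ∈ goodSet S k ↔ Module.finrank F W = k ∧ W ⊔ W.map S = ⊤ := by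
  simp [goodSet]

lemma natCard_good (S : V →ₗ[F] V) (k : ℕ) :
    Nat.card {W : Submodule F V // Module.finrank F W = k ∧ W ⊔ W.map S = ⊤} =
      (goodSet S k).card := by
  rw [goodSet, ← Set.ncard_eq_toFinset_card]
  rfl

lemma goodSet_eq_empty (S : V →ₗ[F] V) (k : ℕ) (h : 2 * k < Module.finrank F V) :
    (goodSet S k).card = 0 := by
  have : FiniteDimensional F V := Module.Finite.of_finite
  rw [Finset.card_eq_zero, Finset.eq_empty_iff_forall_notMem]
  intro W hW
  rw [mem_goodSet] at hW
  have h1 := Submodule.finrank_sup_add_finrank_inf_eq W (W.map S)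
  have h2 := Submodule.finrank_map_le S W
  rw [hW.2, finrank_top] at h1
  omega

lemma goodSet_eq_empty' (S : V →ₗ[F] V) (k : ℕ) (h : Module.finrank F V < k) :
    (goodSet S k).card = 0 := by
  have : FiniteDimensional F V := Module.Finite.of_finite
  rw [Finset.card_eq_zero, Finset.eq_empty_iff_forall_notMem]
  intro W hW
  rw [mem_goodSet] at hW
  have h2 := Submodule.finrank_le W
  omega

lemma card_dual_good [Fintype F] (S : V →ₗ[F] V) (hS : Function.Injective S) (k : ℕ)
    (W : Submodule F V) (hW : W ∈ goodSet S k) :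
    Nat.card {φ : Module.Dual F W // φ ∉ ((W.map S).comap W.subtype).dualAnnihilator} =
      Fintype.card F ^ k - Fintype.card F ^ (Module.finrank F V - k) := by
  have : FiniteDimensional F V := Module.Finite.of_finite
  rw [mem_goodSet] at hW
  have : Finite (Module.Dual F W) := Module.finite_of_finite F
  have h1 := Submodule.finrank_sup_add_finrank_inf_eq W (W.map S)
  rw [hW.2, finrank_top, hW.1, ← (Submodule.equivMapOfInjective S hS W).finrank_eq, hW.1] at h1
  have h2 := Subspace.finrank_add_finrank_dualAnnihilator_eq ((W.map S).comap W.subtype)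
  rw [← Submodule.finrank_map_subtype_eq, Submodule.map_comap_subtype, hW.1] at h2
  have h3 : Module.finrank F ((W.map S).comap W.subtype).dualAnnihilator =
      Module.finrank F V - k := by omega
  have h4 := Module.natCard_eq_pow_finrank (K := F)
    (V := ((W.map S).comap W.subtype).dualAnnihilator)
  have h5 := Module.natCard_eq_pow_finrank (K := F) (V := Module.Dual F W)
  rw [Subspace.dual_finrank_eq, hW.1] at h5
  rw [h3] at h4
  rw [← Nat.card_eq_fintype_card, ← h4, ← h5]
  classical
  rw [← Nat.card_congr (Equiv.sumCompl (· ∈ ((W.map S).comap W.subtype).dualAnnihilator)),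
    Nat.card_sum]
  exact (Nat.add_sub_cancel_left _ _).symm

lemma goodSet_rec [Fintype F] (S : V →ₗ[F] V) (hS : Function.Injective S) (k : ℕ) :
    (goodSet (liftOp S) k).card = (match k with | 0 => 0 | j + 1 => (goodSet S j).card) +
      (Fintype.card F ^ k - Fintype.card F ^ (Module.finrank F V - k)) * (goodSet S k).card := by
  have : FiniteDimensional F V := Module.Finite.of_finite
  classical
  rw [← Finset.card_filter_add_card_filter_not (fun U => ((1 : F), (0 : V)) ∈ U)]
  congr 1
  · cases k with
    | zero =>
      simp only [Finset.card_eq_zero, Finset.filter_eq_empty_iff]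
      intro U hU he
      rw [mem_goodSet, Submodule.finrank_eq_zero] at hU
      rw [hU.1] at he
      simp at he
    | succ j =>
      symm
      refine Finset.card_bij (fun W _ => cyl W) ?_ ?_ ?_
      · intro W hW
        rw [mem_goodSet] at hW
        rw [Finset.mem_filter, mem_goodSet, finrank_cyl, cyl_good, hW.1]
        exact ⟨⟨rfl, hW.2⟩, by simp [mem_cyl]⟩
      · intro W _ W' _ h
        rw [← map_snd_cyl W, h, map_snd_cyl]
      · intro U hU
        rw [Finset.mem_filter, mem_goodSet] at hU
        have := cyl_of_mem U hU.2
        refine ⟨_, ?_, this⟩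
        rw [mem_goodSet, ← cyl_good, this]
        refine ⟨?_, hU.1.2⟩
        have h := finrank_cyl (U.map (LinearMap.snd F F V))
        rw [this, hU.1.1] at h
        omega
  · rw [Finset.card_eq_sum_card_fiberwise (f := fun U => U.map (LinearMap.snd F F V))
      (t := goodSet S k)]
    · rw [Finset.sum_const_nat, mul_comm]
      intro W hW
      rw [← card_dual_good S hS k W hW]
      rw [mem_goodSet] at hW
      have : Finite (Module.Dual F W) := Module.finite_of_finite F
      letI := Fintype.ofFinite (Module.Dual F W)
      rw [Nat.card_eq_fintype_card, Fintype.card_subtype]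
      symm
      refine Finset.card_bij (fun φ _ => gr W φ) ?_ ?_ ?_
      · intro φ hφ
        simp only [Finset.mem_filter, Finset.mem_univ, true_and] at hφ
        rw [Finset.mem_filter, Finset.mem_filter, mem_goodSet, finrank_gr, gr_good, map_snd_gr]
        exact ⟨⟨⟨hW.1, hW.2, hφ⟩, e_notMem_gr W φ⟩, rfl⟩
      · intro φ _ ψ _ h
        exact gr_injective W h
      · intro U hU
        rw [Finset.mem_filter, Finset.mem_filter, mem_goodSet] at hU
        obtain ⟨⟨⟨h1, h2⟩, h3⟩, rfl⟩ := hU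
        obtain ⟨φ, hφ⟩ := exists_gr U h3
        refine ⟨φ, ?_, hφ⟩
        rw [← hφ, gr_good] at h2
        simpa using h2.2
    · intro U hU
      simp only [Finset.coe_filter, Set.mem_ofPred_eq, mem_goodSet] at hU
      obtain ⟨φ, hφ⟩ := exists_gr U hU.2
      simp only [SetLike.mem_coe, mem_goodSet]
      obtain ⟨⟨h1, h2⟩, h3⟩ := hU
      rw [← hφ, finrank_gr] at h1
      rw [← hφ, gr_good] at h2
      exact ⟨h1, h2.1⟩

lemma sup_map_sub (T : V →ₗ[F] V) (c : F) (W : Submodule F V) :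
    W ⊔ W.map (T - c • LinearMap.id) = W ⊔ W.map T := by
  apply le_antisymm
  · refine sup_le le_sup_left ?_
    rintro _ ⟨w, hw, rfl⟩
    exact Submodule.sub_mem _ (Submodule.mem_sup_right ⟨w, hw, rfl⟩)
      (Submodule.mem_sup_left (W.smul_mem c hw))
  · refine sup_le le_sup_left ?_
    rintro _ ⟨w, hw, rfl⟩
    have h1 : (T - c • (LinearMap.id : V →ₗ[F] V)) w ∈ W ⊔ W.map (T - c • LinearMap.id) :=
      Submodule.mem_sup_right ⟨w, hw, rfl⟩
    have h2 : c • w ∈ W ⊔ W.map (T - c • LinearMap.id) :=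
      Submodule.mem_sup_left (W.smul_mem c hw)
    simpa using Submodule.add_mem _ h1 h2

lemma goodSet_sub (T : V →ₗ[F] V) (c : F) (k : ℕ) :
    goodSet (T - c • LinearMap.id) k = goodSet T k := by
  ext W
  rw [mem_goodSet, mem_goodSet, sup_map_sub]

lemma goodSet_conj {V' : Type*} [AddCommGroup V'] [Module F V'] [Finite V'] (e : V' ≃ₗ[F] V)
    (T : V →ₗ[F] V) (T' : V' →ₗ[F] V') (h : ∀ x, T (e x) = e (T' x)) (k : ℕ) :
    (goodSet T k).card = (goodSet T' k).card := by
  symm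
  have hm : ∀ W : Submodule F V', (W.map (e : V' →ₗ[F] V)).map T =
      (W.map T').map (e : V' →ₗ[F] V) := by
    intro W
    rw [← Submodule.map_comp, ← Submodule.map_comp]
    congr 1
    ext x
    exact h x
  have hinj := Submodule.map_injective_of_injective (f := (e : V' →ₗ[F] V)) e.injective
  have hg : ∀ W : Submodule F V', W.map (e : V' →ₗ[F] V) ∈ goodSet T k ↔ W ∈ goodSet T' k := by
    intro W
    rw [mem_goodSet, mem_goodSet, hm, ← Submodule.map_sup, LinearEquiv.finrank_map_eq]
    refine and_congr_right fun _ => ?_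
    have ht : (⊤ : Submodule F V) = (⊤ : Submodule F V').map (e : V' →ₗ[F] V) := by
      simp
    rw [ht, hinj.eq_iff]
  refine Finset.card_bij (fun W _ => W.map (e : V' →ₗ[F] V)) ?_ ?_ ?_
  · intro W hW
    exact (hg W).2 hW
  · intro W _ W' _ hh
    exact hinj hh
  · intro U hU
    have : (U.comap (e : V' →ₗ[F] V)).map (e : V' →ₗ[F] V) = U :=
      Submodule.map_comap_eq_of_surjective e.surjective U
    refine ⟨_, ?_, this⟩
    rw [← hg, this]
    exact hU
end LinPart

lemma diag_rec {F : Type*} [Field F] [Fintype F] {n : ℕ} (d : Fin (n+1) → F)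
    (hd : Function.Injective d) (k : ℕ) :
    (goodSet (Matrix.toLin' (Matrix.diagonal d)) k).card =
      (match k with
        | 0 => 0
        | j + 1 => (goodSet (Matrix.toLin' (Matrix.diagonal (fun i : Fin n => d i.succ))) j).card) +
      (Fintype.card F ^ k - Fintype.card F ^ (n - k)) *
        (goodSet (Matrix.toLin' (Matrix.diagonal (fun i : Fin n => d i.succ))) k).card := by
  set S := Matrix.toLin' (Matrix.diagonal (fun i : Fin n => d i.succ)) - d 0 • LinearMap.id with hSdef
  have hSa : ∀ x i, S x i = (d i.succ - d 0) * x i := by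
    intro x i
    simp [hSdef, Matrix.mulVec_diagonal, sub_mul]
  have hS : Function.Injective S := by
    intro x y h
    funext i
    have := congrFun h i
    rw [hSa, hSa] at this
    refine mul_left_cancel₀ ?_ this
    rw [sub_ne_zero]
    exact fun h => Fin.succ_ne_zero i (hd h)
  have h1 : (goodSet (Matrix.toLin' (Matrix.diagonal d)) k).card =
      (goodSet (liftOp S) k).card := by
    rw [← goodSet_sub _ (d 0)]
    refine goodSet_conj (Fin.consLinearEquiv F (fun _ : Fin (n+1) => F)) _ _ ?_ k
    rintro ⟨a, v⟩
    funext i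
    refine Fin.cases ?_ (fun i => ?_) i
    · simp [Matrix.mulVec_diagonal, liftOp]
    · simp [Matrix.mulVec_diagonal, liftOp, hSa, sub_mul]
  rw [h1, goodSet_rec S hS]
  simp only [hSdef, goodSet_sub, Module.finrank_fin_fun]

lemma factor_eq (q c h : ℕ) (hq : 1 ≤ q) :
    q ^ (c + h) - q ^ c = (q - 1) * q ^ c * ∑ i ∈ Finset.range h, q ^ i := by
  obtain ⟨r, rfl⟩ := Nat.exists_eq_add_of_le hq
  have := geom_sum_mul_add r h
  rw [add_comm r 1] at this
  rw [Nat.add_sub_cancel_left, pow_add, ← this]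
  apply Nat.sub_eq_of_eq_add
  ring
lemma diag_count {F : Type*} [Field F] [Fintype F] : ∀ (n : ℕ) (d : Fin n → F)
    (_ : Function.Injective d) (c h : ℕ) (_ : n = 2 * c + h),
    (goodSet (Matrix.toLin' (Matrix.diagonal d)) (c + h)).card =
      (Fintype.card F - 1) ^ c * Fintype.card F ^ (c * (c - 1) / 2) *
        invSum (Fintype.card F) n h := by
  intro n
  induction n with
  | zero =>
    intro d hd c h hn
    obtain ⟨rfl, rfl⟩ : c = 0 ∧ h = 0 := by omega
    have : goodSet (Matrix.toLin' (Matrix.diagonal d)) (0 + 0) = {⊥} := by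
      ext W
      rw [mem_goodSet, Subsingleton.elim W ⊥]
      simp [Subsingleton.elim (⊥ : Submodule F (Fin 0 → F)) ⊤]
    rw [this, invSum_zero_zero]
    simp
  | succ n ih =>
    intro d hd c h hn
    have hq : 1 ≤ Fintype.card F := Fintype.card_pos
    have ih' := ih (fun i => d i.succ) (fun i j hij => Fin.succ_injective _ (hd hij))
    rw [diag_rec d hd]
    set q := Fintype.card F
    have hfr : Module.finrank F (Fin n → F) = n := Module.finrank_fin_fun F
    cases c with
    | zero =>
      obtain ⟨rfl⟩ : h = n + 1 := by omega
      have e := ih' 0 n (by omega)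
      have z := goodSet_eq_empty' (Matrix.toLin' (Matrix.diagonal (fun i : Fin n => d i.succ)))
        (n + 1) (by omega)
      simp only [zero_add, Nat.add_eq] at e ⊢
      rw [e, z, invSum_succ_succ, invSum_of_lt q n (n+2) (by omega)]
      simp
    | succ c =>
      have hc : (c + 1) * (c + 1 - 1) / 2 = c + c * (c - 1) / 2 := by
        rw [← Nat.choose_two_right, ← Nat.choose_two_right, Nat.choose_succ_succ]
        simp
      have e1 := ih' c (h + 1) (by omega)
      have e2 : n - (c + 1 + h) = c := by omega
      have hf := factor_eq q c (h + 1) hq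
      rw [show c + (h + 1) = c + 1 + h by omega] at e1 hf
      rw [e1, e2, hf, hc]
      cases h with
      | zero =>
        have z := goodSet_eq_empty (Matrix.toLin' (Matrix.diagonal (fun i : Fin n => d i.succ)))
          c (by omega)
        simp only
        rw [z, invSum_succ_zero]
        simp
        ring
      | succ h =>
        have e3 := ih' (c + 1) h (by omega)
        rw [hc] at e3
        simp only [Nat.add_eq]
        rw [e3, invSum_succ_succ]
        ring

open Classical in
/-- If `T` is a diagonal `2m × 2m` matrix over `F_q` with distinct diagonal
entries, then the number of `m`-dimensional `T`-splitting subspaces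
(`W + T W = F_q^{2m}`) is `(q-1)^m q^{binom(m,2)} T_m(q)`, where
`T_m(q) = ∑_σ q^{v(σ)}` is the generating polynomial of fixed-point-free
involutions of `{1, …, 2m}` by number of crossings, evaluated at `q = |F_q|`. -/
theorem card_splitting_subspaces_diagonal (F : Type*) [Field F] [Fintype F]
    (m : ℕ) (d : Fin (2 * m) → F) (hd : Function.Injective d) :
    Nat.card {W : Submodule F (Fin (2 * m) → F) //
        Module.finrank F W = m ∧
          W ⊔ W.map (Matrix.toLin' (Matrix.diagonal d)) = ⊤} =
      (Fintype.card F - 1) ^ m * Fintype.card F ^ (m * (m - 1) / 2) *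
        ∑ σ : Equiv.Perm (Fin (2 * m)),
          (if σ * σ = 1 ∧ (∀ x, σ x ≠ x) then Fintype.card F ^ crossings σ else 0) := by
  rw [natCard_good, perm_sum_eq]
  exact diag_count (2 * m) d hd m 0 rfl
end

section
/- Touchard–Riordan formula: for every nonnegative integer m, (q−1)^m · T_m(q) = ∑_{j=0}^{2m} (−1)^j · binom(2m, j) · q^{binom(m−j+1, 2)}, where T_m(q) = ∑_σ q^{v(σ)} over fixed-point-free involutions σ of {1,…,2m} counted by their number of crossings v(σ), binom(2m,j) is the ordinary binomial coefficient, and binom(m−j+1,2) = (m−j+1)(m−j)/2 (nonnegative for all integers j). -/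
open Polynomial

/-- `binom2 a = a * (a-1) / 2`, a nonnegative integer for every integer `a`. -/
def binom2 (a : ℤ) : ℕ := (a * (a - 1) / 2).toNat

namespace TR

/-- q-binomial `[k+j choose j]`. -/
noncomputable def G : ℕ → ℕ → Polynomial ℤ
  | _, 0 => 1
  | 0, _ + 1 => 1
  | k + 1, j + 1 => G k (j + 1) + X ^ (k + 1) * G (k + 1) j

lemma G_zero_right (k : ℕ) : G k 0 = 1 := by cases k <;> simp [G]
lemma G_zero_left (j : ℕ) : G 0 j = 1 := by cases j <;> simp [G]
lemma G_succ (k j : ℕ) : G (k + 1) (j + 1) = G k (j + 1) + X ^ (k + 1) * G (k + 1) j := by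
  rw [G]

lemma G_id (n : ℕ) : ∀ k j, k + j = n →
    (1 - X ^ (k + 1)) * G (k + 1) j = (1 - X ^ (k + j + 1)) * G k j ∧
    (1 - X ^ (j + 1)) * G k (j + 1) = (1 - X ^ (k + j + 1)) * G k j := by
  induction n with
  | zero =>
    intro k j h
    obtain ⟨rfl, rfl⟩ : k = 0 ∧ j = 0 := by omega
    simp [G]
  | succ n ih =>
    intro k j h
    constructor
    · cases j with
      | zero => simp [G_zero_right]
      | succ j =>
        obtain ⟨h1, h2⟩ := ih k j (by omega)
        rw [G_succ]
        linear_combination (X : Polynomial ℤ) ^ (k + 1) * h1 - (X : Polynomial ℤ) ^ (k + 1) * h2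
    · cases k with
      | zero => simp [G_zero_left]
      | succ k =>
        obtain ⟨h1, h2⟩ := ih k j (by omega)
        rw [G_succ]
        linear_combination h2 - h1

lemma G_one (k j : ℕ) :
    (1 - X ^ (k + 1)) * G (k + 1) j = (1 - X ^ (k + j + 1)) * G k j := (G_id _ k j rfl).1

/-- Number of walks. -/
def W : ℕ → ℤ → ℤ
  | 0, l => if l = 0 then 1 else 0
  | n + 1, l => W n (l - 1) + W n (l + 1)

lemma W_neg (n : ℕ) : ∀ l, W n (-l) = W n l := by
  induction n with
  | zero => intro l; simp [W]
  | succ n ih =>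
    intro l
    simp only [W]
    rw [show -l - 1 = -(l + 1) by ring, show -l + 1 = -(l - 1) by ring, ih, ih, add_comm]

lemma W_big (n : ℕ) : ∀ l : ℤ, (n : ℤ) < l → W n l = 0 := by
  induction n with
  | zero => intro l h; simp [W]; push_cast at h; omega
  | succ n ih =>
    intro l h
    push_cast at h
    simp only [W]
    rw [ih _ (by omega), ih _ (by omega), add_zero]

lemma W_choose (n : ℕ) : ∀ i : ℕ, W n ((n : ℤ) - 2 * i) = n.choose i := by
  induction n with
  | zero => intro i; cases i <;> simp [W]; omega
  | succ n ih =>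
    intro i
    simp only [W]
    cases i with
    | zero =>
      rw [W_big n (((n + 1 : ℕ) : ℤ) - 2 * (0 : ℕ) + 1) (by push_cast; omega)]
      have := ih 0
      rw [show ((n + 1 : ℕ) : ℤ) - 2 * (0 : ℕ) - 1 = (n : ℤ) - 2 * (0 : ℕ) by push_cast; ring, this]
      simp
    | succ i =>
      rw [show ((n + 1 : ℕ) : ℤ) - 2 * (i + 1 : ℕ) - 1 = (n : ℤ) - 2 * (i + 1 : ℕ) by push_cast; ring,
        show ((n + 1 : ℕ) : ℤ) - 2 * (i + 1 : ℕ) + 1 = (n : ℤ) - 2 * (i : ℕ) by push_cast; ring,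
        ih, ih, Nat.choose_succ_succ]
      push_cast; ring

/-- Ballot numbers. -/
def t (n : ℕ) (l : ℤ) : ℤ := W n l - W n (l + 2)

lemma t_succ (n : ℕ) (l : ℤ) : t (n + 1) l = t n (l - 1) + t n (l + 1) := by
  simp only [t, W]
  rw [show l + 2 - 1 = l - 1 + 2 by ring, show l + 2 + 1 = l + 1 + 2 by ring]
  ring

lemma t_neg_one (n : ℕ) : t n (-1) = 0 := by
  simp only [t]; rw [W_neg]; norm_num

lemma t_big (n : ℕ) (l : ℤ) (h : (n : ℤ) < l) : t n l = 0 := by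
  simp only [t]; rw [W_big n l h, W_big n _ (by omega)]; norm_num

/-- triangular numbers -/
def e : ℕ → ℕ
  | 0 => 0
  | j + 1 => e j + (j + 1)

noncomputable def c (k j : ℕ) : Polynomial ℤ := (-1) ^ j * X ^ e j * G k j

noncomputable def b (M n k : ℕ) : Polynomial ℤ :=
  ∑ j ∈ Finset.range M, c k j * ((t n ((k : ℤ) + 2 * j) : ℤ) : Polynomial ℤ)

lemma c_zero (k : ℕ) : c k 0 = 1 := by simp [c, e, G_zero_right]

lemma c_rec (k j : ℕ) : c (k + 1) (j + 1) + c (k + 1) j =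
    c k (j + 1) + (1 - X ^ (k + 2)) * c (k + 2) j := by
  have h := G_one (k + 1) j
  simp only [c, e, G_succ]
  linear_combination (-(-1) ^ j * (X : Polynomial ℤ) ^ e j) * h

lemma c_rec0 (j : ℕ) : c 0 (j + 1) + c 0 j = (1 - X) * c 1 j := by
  have h := G_one 0 j
  simp only [c, e, G_zero_left] at h ⊢
  simp only [zero_add, pow_one] at h
  linear_combination (-(-1) ^ j * (X : Polynomial ℤ) ^ e j) * h

lemma b_aux (N n k : ℕ) (h : n < 2 * N + 1) : b (N + 1) (n + 1) k =
    ((t n ((k : ℤ) - 1) : ℤ) : Polynomial ℤ) + ∑ j ∈ Finset.range N, (c k (j + 1) + c k j) *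
      ((t n ((k : ℤ) + 1 + 2 * j) : ℤ) : Polynomial ℤ) := by
  simp only [b, t_succ]
  push_cast
  simp only [mul_add, add_mul, Finset.sum_add_distrib]
  rw [Finset.sum_range_succ', Finset.sum_range_succ _ N, c_zero,
    t_big n ((k : ℤ) + 2 * N + 1) (by omega)]
  have h1 : ∀ j : ℕ, (k : ℤ) + 2 * ((j + 1 : ℕ) : ℤ) - 1 = k + 1 + 2 * j := by
    intro j; push_cast; ring
  have h2 : ∀ j : ℕ, (k : ℤ) + 2 * (j : ℤ) + 1 = k + 1 + 2 * j := by
    intro j; ring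
  simp only [h1, h2]
  simp
  ring

lemma b_rec (N n k : ℕ) (h : n < 2 * N + 1) : b (N + 1) (n + 1) (k + 1) =
    b (N + 1) n k + (1 - X ^ (k + 2)) * b (N + 1) n (k + 2) := by
  rw [b_aux N n _ h]
  simp only [c_rec]
  simp only [b]
  rw [Finset.sum_range_succ', Finset.sum_range_succ _ N, c_zero,
    t_big n (((k + 2 : ℕ) : ℤ) + 2 * N) (by push_cast; omega)]
  have h1 : ∀ j : ℕ, (k : ℤ) + 2 * ((j + 1 : ℕ) : ℤ) = k + 2 + 2 * j := by
    intro j; push_cast; ring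
  have h2 : ∀ j : ℕ, ((k + 1 : ℕ) : ℤ) + 1 + 2 * j = k + 2 + 2 * j := by
    intro j; push_cast; ring
  have h3 : ∀ j : ℕ, ((k + 2 : ℕ) : ℤ) + 2 * j = k + 2 + 2 * j := by
    intro j; push_cast; ring
  simp only [h1, h2, h3, add_mul, Finset.sum_add_distrib, mul_add, Finset.mul_sum, mul_assoc]
  simp
  ring

lemma b_rec0 (N n : ℕ) (h : n < 2 * N + 1) : b (N + 1) (n + 1) 0 =
    (1 - X) * b (N + 1) n 1 := by
  rw [b_aux N n _ h]
  simp only [c_rec0]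
  simp only [b]
  rw [Finset.sum_range_succ _ N,
    t_big n (((1 : ℕ) : ℤ) + 2 * N) (by push_cast; omega)]
  have := t_neg_one n
  simp [this, mul_add, Finset.mul_sum, mul_assoc]

/-! ### Combinatorial part -/

/-- generalised crossing weight -/
def w {n : ℕ} (σ : Equiv.Perm (Fin n)) : ℕ :=
  ∑ i, ∑ k, if i < k ∧ k < σ i ∧ (σ i < σ k ∨ σ k = k) then 1 else 0

/-- fixed points -/
def F {n : ℕ} (σ : Equiv.Perm (Fin n)) : Finset (Fin n) := Finset.univ.filter (fun x => σ x = x)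

noncomputable def S (n k : ℕ) : Polynomial ℤ :=
  ∑ σ : Equiv.Perm (Fin n), if σ * σ = 1 ∧ (F σ).card = k then X ^ w σ else 0

lemma crossings_eq {n : ℕ} (σ : Equiv.Perm (Fin n)) (h : ∀ x, σ x ≠ x) : crossings σ = w σ := by
  classical
  unfold crossings w
  rw [Nat.card_eq_fintype_card, Fintype.card_subtype, Finset.card_filter, Fintype.sum_prod_type]
  simp [h]

lemma geom (n : ℕ) (s : Finset (Fin n)) :
    ∑ r ∈ s, (X : Polynomial ℤ) ^ (s.filter (· < r)).card = ∑ i ∈ Finset.range s.card, X ^ i := by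
  induction s using Finset.induction_on_max with
  | empty => simp
  | insert a s ha ih =>
    have hn : a ∉ s := fun h => lt_irrefl _ (ha a h)
    rw [Finset.sum_insert hn, Finset.card_insert_of_notMem hn, Finset.sum_range_succ, ← ih, add_comm]
    congr 1
    · apply Finset.sum_congr rfl
      intro r hr
      rw [Finset.filter_insert, if_neg (not_lt.mpr (ha r hr).le)]
    · rw [Finset.filter_insert, if_neg (lt_irrefl _), Finset.filter_true_of_mem ha]

lemma dec_zero {n : ℕ} (τ : Equiv.Perm (Fin n)) :
    let σ := Equiv.Perm.decomposeFin.symm (0, τ)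
    (σ * σ = 1 ↔ τ * τ = 1) ∧ (F σ).card = (F τ).card + 1 ∧ w σ = w τ := by
  intro σ
  have h0 : σ 0 = 0 := by simp [σ]
  have hs : ∀ i : Fin n, σ i.succ = (τ i).succ := by intro i; simp [σ]
  refine ⟨?_, ?_, ?_⟩
  · simp [Equiv.Perm.ext_iff, Fin.forall_fin_succ, h0, hs]
  · simp only [F, Finset.card_filter, Fin.sum_univ_succ, h0, hs, Fin.succ_inj]
    simp [add_comm]
  · simp only [w, Fin.sum_univ_succ, h0, hs, Fin.succ_inj, Fin.succ_lt_succ_iff]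
    simp

lemma dec_succ_inv {n : ℕ} (τ : Equiv.Perm (Fin n)) (r : Fin n) :
    let σ := Equiv.Perm.decomposeFin.symm (r.succ, τ)
    (σ * σ = 1 ↔ τ * τ = 1 ∧ τ r = r) := by
  intro σ
  have h0 : σ 0 = r.succ := by simp [σ]
  have hs : ∀ i : Fin n, σ i.succ = if τ i = r then 0 else (τ i).succ := by
    intro i
    simp only [σ, Equiv.Perm.decomposeFin_symm_apply_succ, Equiv.swap_apply_def]
    simp [Fin.succ_ne_zero]
  simp only [Equiv.Perm.ext_iff, Fin.forall_fin_succ, Equiv.Perm.mul_apply, h0, hs,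
    Equiv.Perm.one_apply]
  constructor
  · rintro ⟨h1, h2⟩
    have hr : τ r = r := by
      by_contra hne
      simp [hne, Fin.succ_ne_zero] at h1
    refine ⟨?_, hr⟩
    intro i
    have := h2 i
    by_cases hi : τ i = r
    · rw [if_pos hi, h0] at this
      rw [hi, hr]; exact Fin.succ_injective _ this
    · rw [if_neg hi, hs] at this
      split_ifs at this with h3
      · exact absurd this.symm (Fin.succ_ne_zero _)
      · exact Fin.succ_injective _ this
  · rintro ⟨h1, hr⟩
    refine ⟨by simp [hr], ?_⟩
    intro i
    by_cases hi : τ i = r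
    · rw [if_pos hi, h0]
      rw [← h1 i, hi, hr]
    · rw [if_neg hi, hs, h1 i, if_neg]
      rintro rfl
      exact hi hr

lemma dec_succ {n : ℕ} (τ : Equiv.Perm (Fin n)) (r : Fin n) (hτ : τ r = r) :
    let σ := Equiv.Perm.decomposeFin.symm (r.succ, τ)
    (F σ).card + 1 = (F τ).card ∧ w σ = w τ + ((F τ).filter (· < r)).card := by
  intro σ
  have hinj : ∀ i, τ i = r ↔ i = r := by
    intro i
    constructor
    · intro h; exact τ.injective (h.trans hτ.symm)
    · rintro rfl; exact hτ
  have h0 : σ 0 = r.succ := by simp [σ]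
  have hs : ∀ i : Fin n, σ i.succ = if i = r then 0 else (τ i).succ := by
    intro i
    simp only [σ, Equiv.Perm.decomposeFin_symm_apply_succ, Equiv.swap_apply_def]
    simp [Fin.succ_ne_zero, hinj]
  constructor
  · have : F σ = ((F τ).erase r).map (Fin.succEmb n) := by
      ext x
      refine Fin.cases ?_ (fun i => ?_) x
      · simp [F, h0, Fin.succ_ne_zero]
      · simp only [F, Finset.mem_filter, Finset.mem_univ, true_and, hs, Finset.mem_map,
          Finset.mem_erase, Fin.coe_succEmb, Fin.succ_inj, exists_eq_right]
        by_cases hi : i = r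
        · simp [hi, (Fin.succ_ne_zero _).symm]
        · simp [hi]
    rw [this, Finset.card_map, Finset.card_erase_of_mem (by simp [F, hτ])]
    have : 0 < (F τ).card := Finset.card_pos.mpr ⟨r, by simp [F, hτ]⟩
    omega
  · have hA : w σ = (∑ k, if k < r ∧ (r < τ k ∨ τ k = k) then 1 else 0) +
        ∑ i, ∑ k, if k ≠ r ∧ i < k ∧ k < τ i ∧ (τ i < τ k ∨ τ k = k) then 1 else 0 := by
      unfold w
      rw [Fin.sum_univ_succ]
      congr 1
      · rw [Fin.sum_univ_succ, if_neg (by simp), zero_add]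
        refine Finset.sum_congr rfl fun k _ => ?_
        refine if_congr ?_ rfl rfl
        rw [h0, hs]
        by_cases hk : k = r
        · simp [hk]
        · simp [hk]
      · refine Finset.sum_congr rfl fun i _ => ?_
        rw [Fin.sum_univ_succ, if_neg (by simp), zero_add]
        refine Finset.sum_congr rfl fun k _ => ?_
        refine if_congr ?_ rfl rfl
        rw [hs, hs]
        by_cases hi : i = r
        · subst hi
          simp only [hτ]
          simp
          intro _ h1 h2
          exact absurd (h1.trans h2) (lt_irrefl _)
        · by_cases hk : k = r
          · simp [hk, hi, (Fin.succ_ne_zero _).symm]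
          · simp [hi, hk]
    have hB : w τ = (∑ i, if i < r ∧ r < τ i then 1 else 0) +
        ∑ i, ∑ k, if k ≠ r ∧ i < k ∧ k < τ i ∧ (τ i < τ k ∨ τ k = k) then 1 else 0 := by
      unfold w
      rw [← Finset.sum_add_distrib]
      refine Finset.sum_congr rfl fun i _ => ?_
      rw [← Finset.add_sum_erase _ _ (Finset.mem_univ r),
        ← Finset.add_sum_erase (a := r) Finset.univ (fun k => if k ≠ r ∧ _ then 1 else 0)
          (Finset.mem_univ r)]
      simp only [hτ, ne_eq, not_true_eq_false, false_and, if_false, zero_add, or_true, and_true]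
      congr 1
      refine Finset.sum_congr rfl fun k hk => ?_
      simp [Finset.ne_of_mem_erase hk]
    rw [hA, hB]
    have hC : (∑ k, if k < r ∧ (r < τ k ∨ τ k = k) then 1 else 0) =
        (∑ i, if i < r ∧ r < τ i then 1 else 0) + ((F τ).filter (· < r)).card := by
      rw [F, Finset.filter_filter, Finset.card_filter, ← Finset.sum_add_distrib]
      refine Finset.sum_congr rfl fun k _ => ?_
      by_cases h1 : k < r <;> by_cases h2 : τ k = k <;> simp [h1, h2]
      exact h1.le
    rw [hC]; ring

lemma S_split (n k : ℕ) : S (n + 1) k =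
    (∑ τ : Equiv.Perm (Fin n), if τ * τ = 1 ∧ (F τ).card + 1 = k then X ^ w τ else 0) +
      (∑ i ∈ Finset.range (k + 1), X ^ i) * S n (k + 1) := by
  unfold S
  rw [← Equiv.Perm.decomposeFin.symm.sum_comp, Fintype.sum_prod_type, Fin.sum_univ_succ]
  congr 1
  · refine Finset.sum_congr rfl fun τ _ => ?_
    obtain ⟨h1, h2, h3⟩ := dec_zero τ
    rw [h2, h3]
    exact if_congr (and_congr_left' h1) rfl rfl
  · rw [Finset.sum_comm, Finset.mul_sum]
    refine Finset.sum_congr rfl fun τ _ => ?_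
    have key : ∀ r : Fin n, (if Equiv.Perm.decomposeFin.symm (r.succ, τ) *
        Equiv.Perm.decomposeFin.symm (r.succ, τ) = 1 ∧
        (F (Equiv.Perm.decomposeFin.symm (r.succ, τ))).card = k then
        (X : Polynomial ℤ) ^ w (Equiv.Perm.decomposeFin.symm (r.succ, τ)) else 0) =
        if τ r = r then (if τ * τ = 1 ∧ (F τ).card = k + 1 then
          X ^ w τ * X ^ ((F τ).filter (· < r)).card else 0) else 0 := by
      intro r
      have h1 := dec_succ_inv τ r
      by_cases hr : τ r = r
      · obtain ⟨h2, h3⟩ := dec_succ τ r hr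
        rw [if_pos hr, h3, pow_add]
        refine if_congr ?_ rfl rfl
        rw [← h2]
        simp only at h1
        rw [h1]
        simp [hr]
      · rw [if_neg hr, if_neg]
        rintro ⟨h, _⟩
        exact hr (h1.mp h).2
    rw [Finset.sum_congr rfl fun r _ => key r, ← Finset.sum_filter]
    by_cases h : τ * τ = 1 ∧ (F τ).card = k + 1
    · simp only [if_pos h]
      rw [← Finset.mul_sum, mul_comm, ← h.2, ← geom]
      rfl
    · simp [if_neg h]

lemma S_succ (n k : ℕ) : S (n + 1) (k + 1) =
    S n k + (∑ i ∈ Finset.range (k + 2), X ^ i) * S n (k + 2) := by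
  rw [S_split]; simp [S]

lemma S_zero (n : ℕ) : S (n + 1) 0 = S n 1 := by
  rw [S_split]; simp

lemma S_base (k : ℕ) : S 0 k = if k = 0 then 1 else 0 := by
  simp [S, F, w, eq_comm, Subsingleton.elim _ (1 : Equiv.Perm (Fin 0))]

lemma S_big (n : ℕ) : ∀ k, n < k → S n k = 0 := by
  intro k h
  unfold S
  refine Finset.sum_eq_zero fun σ _ => if_neg ?_
  rintro ⟨_, h2⟩
  have := Finset.card_le_univ (F σ)
  simp at this
  omega

lemma b_big (M n k : ℕ) (h : n < k) : b M n k = 0 := by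
  refine Finset.sum_eq_zero fun j _ => ?_
  rw [t_big n _ (by omega)]; simp

lemma geo (k : ℕ) : (1 - (X : Polynomial ℤ)) * ∑ i ∈ Finset.range k, X ^ i = 1 - X ^ k := by
  rw [mul_comm, geom_sum_mul_neg]

lemma b_eq (N n : ℕ) : ∀ k d, n = k + 2 * d → n < 2 * N + 1 →
    b (N + 1) n k = (1 - X) ^ d * S n k := by
  induction n with
  | zero =>
    intro k d h _
    obtain ⟨rfl, rfl⟩ : k = 0 ∧ d = 0 := by omega
    rw [S_base]
    simp only [b]
    rw [Finset.sum_range_succ', c_zero, Finset.sum_eq_zero]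
    · simp [t, W]
    · intro j _
      rw [t_big 0 _ (by push_cast; omega)]; simp
  | succ n ih =>
    intro k d h hN
    cases k with
    | zero =>
      obtain ⟨d, rfl⟩ : ∃ d', d = d' + 1 := ⟨d - 1, by omega⟩
      rw [b_rec0 _ _ (by omega), S_zero, ih 1 d (by omega) (by omega)]
      ring
    | succ k =>
      rw [b_rec _ _ _ (by omega), S_succ, ih k d (by omega) (by omega)]
      cases d with
      | zero => rw [b_big _ _ _ (by omega), S_big n (k + 2) (by omega)]; ring
      | succ d =>
        rw [ih (k + 2) d (by omega) (by omega), ← geo]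
        ring

lemma two_e (j : ℕ) : 2 * (e j : ℤ) = j * (j + 1) := by
  induction j with
  | zero => simp [e]
  | succ j ih => simp only [e]; push_cast; linarith

lemma binom2_pos (j : ℕ) : binom2 ((j : ℤ) + 1) = e j := by
  unfold binom2
  rw [show ((j : ℤ) + 1) * ((j : ℤ) + 1 - 1) = 2 * (e j : ℤ) by rw [two_e]; ring]
  simp

lemma binom2_neg (j : ℕ) : binom2 (-(j : ℤ)) = e j := by
  unfold binom2
  rw [show (-(j : ℤ)) * (-(j : ℤ) - 1) = 2 * (e j : ℤ) by rw [two_e]; ring]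
  simp

lemma final (m : ℕ) : (-1) ^ m * b (m + 1) (2 * m) 0 =
      ∑ j ∈ Finset.range (2 * m + 1),
        (-1 : Polynomial ℤ) ^ j * (Nat.choose (2 * m) j : Polynomial ℤ) *
          (X : Polynomial ℤ) ^ binom2 ((m : ℤ) - j + 1) := by
  rw [show 2 * m + 1 = (m + 1) + m by ring, Finset.sum_range_add, ← Finset.sum_range_reflect]
  have hb : b (m + 1) (2 * m) 0 =
      (∑ j ∈ Finset.range (m + 1), (-1) ^ j * X ^ e j *
        ((W (2 * m) (2 * j) : ℤ) : Polynomial ℤ)) -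
      ∑ j ∈ Finset.range m, (-1) ^ j * X ^ e j *
        ((W (2 * m) (2 * j + 2) : ℤ) : Polynomial ℤ) := by
    have : ∑ j ∈ Finset.range m, (-1) ^ j * X ^ e j *
        ((W (2 * m) (2 * j + 2) : ℤ) : Polynomial ℤ) =
        ∑ j ∈ Finset.range (m + 1), (-1) ^ j * X ^ e j *
        ((W (2 * m) (2 * j + 2) : ℤ) : Polynomial ℤ) := by
      rw [Finset.sum_range_succ, W_big (2 * m) (2 * m + 2) (by push_cast; omega)]
      simp
    rw [this, ← Finset.sum_sub_distrib]
    refine Finset.sum_congr rfl fun j _ => ?_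
    simp [c, t, G_zero_left]
    ring
  rw [hb, mul_sub, sub_eq_add_neg, Finset.mul_sum, Finset.mul_sum, ← Finset.sum_neg_distrib]
  congr 1
  · refine Finset.sum_congr rfl fun j hj => ?_
    have hj : j ≤ m := by simp at hj; omega
    obtain ⟨d, rfl⟩ := Nat.exists_eq_add_of_le hj
    have h1 : j + d + 1 - 1 - j = d := by omega
    have h2 := W_choose (2 * (j + d)) d
    rw [h1]
    rw [show ((2 * (j + d) : ℕ) : ℤ) - 2 * d = 2 * j by push_cast; ring] at h2
    rw [h2, show ((j + d : ℕ) : ℤ) - d + 1 = j + 1 by push_cast; ring, binom2_pos]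
    have h3 : (-1 : Polynomial ℤ) ^ (j + d) * (-1) ^ j = (-1) ^ d := by
      rw [pow_add, mul_right_comm, ← mul_pow]; simp
    push_cast
    linear_combination (X ^ e j * ((2 * (j + d)).choose d : Polynomial ℤ)) * h3
  · refine Finset.sum_congr rfl fun j hj => ?_
    have h2 := W_choose (2 * m) (m + 1 + j)
    rw [show ((2 * m : ℕ) : ℤ) - 2 * (m + 1 + j : ℕ) = -(2 * j + 2) by push_cast; ring, W_neg] at h2
    rw [h2, show (m : ℤ) - (m + 1 + j : ℕ) + 1 = -j by push_cast; ring, binom2_neg]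
    push_cast
    ring

end TR

open Classical in
/-- The Touchard–Riordan formula:
`(q-1)^m T_m(q) = ∑_{j=0}^{2m} (-1)^j binom(2m,j) q^{binom(m-j+1,2)}`,
where `T_m(q) = ∑_σ q^{v(σ)}` over fixed-point-free involutions of `{1, …, 2m}`
counted by crossings, as an identity in the polynomial ring `ℤ[q]`. -/
theorem touchard_riordan (m : ℕ) :
    ((X : Polynomial ℤ) - 1) ^ m *
        ∑ σ : Equiv.Perm (Fin (2 * m)),
          (if σ * σ = 1 ∧ (∀ x, σ x ≠ x) then (X : Polynomial ℤ) ^ crossings σ else 0) =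
      ∑ j ∈ Finset.range (2 * m + 1),
        (-1 : Polynomial ℤ) ^ j * (Nat.choose (2 * m) j : Polynomial ℤ) *
          (X : Polynomial ℤ) ^ binom2 ((m : ℤ) - j + 1) := by
  have hS : (∑ σ : Equiv.Perm (Fin (2 * m)),
      (if σ * σ = 1 ∧ (∀ x, σ x ≠ x) then (X : Polynomial ℤ) ^ crossings σ else 0)) =
      TR.S (2 * m) 0 := by
    unfold TR.S
    refine Finset.sum_congr rfl fun σ _ => ?_
    have hF : (TR.F σ).card = 0 ↔ ∀ x, σ x ≠ x := by
      simp [TR.F, Finset.filter_eq_empty_iff]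
    by_cases h : σ * σ = 1 ∧ (∀ x, σ x ≠ x)
    · rw [if_pos h, if_pos ⟨h.1, hF.mpr h.2⟩, TR.crossings_eq σ h.2]
    · rw [if_neg h, if_neg]
      rintro ⟨h1, h2⟩
      exact h ⟨h1, hF.mp h2⟩
  rw [hS, ← TR.final, TR.b_eq m (2 * m) 0 m (by omega) (by omega), ← mul_assoc, ← mul_pow]
  congr 2
  ring
end

section
/- Let T ∈ M_{2m}(F_q) be a matrix of similarity class type τ_i = {(1,(1^{m+i})), (m−i,(1))} for some 1 ≤ i ≤ m; concretely, T is block diagonal with one block a scalar matrix λ·I of size (m+i)×(m+i) (λ ∈ F_q) and the other block an (m−i)×(m−i) matrix with irreducible characteristic polynomial not having λ as a root. Then the number of j-dimensional T-invariant subspaces of F_q^{2m} equals (m+i choose j)_q + (m+i choose j−m+i)_q, where (· choose ·)_q is the Gaussian binomial coefficient (zero when the lower index is negative or exceeds the upper index). -/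
open Polynomial in
theorem aux_irr {F : Type*} [Field F] {n : ℕ} (A : Matrix (Fin n) (Fin n) F)
    (hirr : Irreducible A.charpoly) (Y : Submodule F (Fin n → F))
    (hY : ∀ y ∈ Y, Matrix.toLin' A y ∈ Y) : Y = ⊥ ∨ Y = ⊤ := by
  by_cases hb : Y = ⊥
  · exact Or.inl hb
  right
  obtain ⟨y, hyY, hy0⟩ := Submodule.exists_mem_ne_zero_of_ne_bot hb
  have hpow : ∀ p : F[X], ∀ z ∈ Y, aeval (Matrix.toLin' A) p z ∈ Y := by
    intro p
    induction p using Polynomial.induction_on' with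
    | add p q hp hq => intro z hz; simpa using Y.add_mem (hp z hz) (hq z hz)
    | monomial k a =>
      intro z hz
      have : ∀ k : ℕ, ((Matrix.toLin' A) ^ k) z ∈ Y := by
        intro k
        induction k with
        | zero => simpa using hz
        | succ k ih => rw [pow_succ']; exact hY _ ih
      rw [aeval_monomial]
      simpa using Y.smul_mem a (this k)
  have hch : aeval (Matrix.toLin' A) A.charpoly = 0 := by
    have := LinearMap.aeval_self_charpoly (Matrix.toLin' A)
    rwa [Matrix.charpoly_toLin'] at this
  let g : F[X] →ₗ[F] Y := LinearMap.codRestrict Y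
    ((LinearMap.applyₗ y).comp (aeval (Matrix.toLin' A)).toLinearMap) (fun p => hpow p y hyY)
  have hg : ∀ p, ((g p : Y) : Fin n → F) = aeval (Matrix.toLin' A) p y := fun p => rfl
  let h : degreeLT F n →ₗ[F] Y := g.comp (degreeLT F n).subtype
  have hinj : Function.Injective h := by
    rw [← LinearMap.ker_eq_bot, LinearMap.ker_eq_bot']
    rintro ⟨c, hc⟩ h0
    by_contra hne
    have hc0 : c ≠ 0 := fun e => hne (by simp [e])
    rw [mem_degreeLT] at hc
    have hnd : ¬ A.charpoly ∣ c := by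
      intro hd
      have := degree_le_of_dvd hd hc0
      rw [Matrix.charpoly_degree_eq_dim, Fintype.card_fin] at this
      exact absurd hc (not_lt.mpr this)
    obtain ⟨u, v, huv⟩ := (hirr.coprime_iff_not_dvd).mpr hnd
    have h1 : aeval (Matrix.toLin' A) c y = 0 := by
      rw [← hg]; exact congrArg Subtype.val h0
    apply hy0
    have := congrArg (fun r => aeval (Matrix.toLin' A) r y) huv
    simpa [hch, h1] using this.symm
  have hle := LinearMap.finrank_le_finrank_of_injective hinj
  rw [(degreeLTEquiv F n).finrank_eq, Module.finrank_fin_fun] at hle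
  apply Submodule.eq_top_of_finrank_eq
  rw [Module.finrank_fin_fun]
  refine le_antisymm ?_ hle
  simpa using Submodule.finrank_le Y

open Polynomial in
theorem aux_split {F : Type*} [Field F] {N n : ℕ} (lam : F) (A : Matrix (Fin n) (Fin n) F)
    (hirr : Irreducible A.charpoly) (hroot : A.charpoly.eval lam ≠ 0)
    (W : Submodule F ((Fin N → F) × (Fin n → F)))
    (hW : W.map (LinearMap.prodMap (lam • LinearMap.id) (Matrix.toLin' A)) ≤ W) :
    ∃ U : Submodule F (Fin N → F), W = U.prod ⊥ ∨ W = U.prod ⊤ := by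
  have hT : ∀ z ∈ W, (lam • z.1, Matrix.toLin' A z.2) ∈ W := by
    intro z hz
    exact hW ⟨z, hz, rfl⟩
  have hpow : ∀ p : F[X], ∀ z ∈ W, (p.eval lam • z.1, aeval (Matrix.toLin' A) p z.2) ∈ W := by
    intro p
    induction p using Polynomial.induction_on' with
    | add p q hp hq =>
      intro z hz
      have := W.add_mem (hp z hz) (hq z hz)
      simpa [add_smul] using this
    | monomial k a =>
      intro z hz
      have : ∀ k : ℕ, (lam ^ k • z.1, ((Matrix.toLin' A) ^ k) z.2) ∈ W := by
        intro k
        induction k with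
        | zero => simpa using hz
        | succ k ih =>
          rw [pow_succ', pow_succ', mul_smul]; exact hT _ ih
      rw [aeval_monomial]
      simpa [mul_smul] using W.smul_mem a (this k)
  have hch : aeval (Matrix.toLin' A) A.charpoly = 0 := by
    have := LinearMap.aeval_self_charpoly (Matrix.toLin' A)
    rwa [Matrix.charpoly_toLin'] at this
  have h1 : ∀ z ∈ W, (z.1, (0 : Fin n → F)) ∈ W := by
    intro z hz
    have := W.smul_mem (A.charpoly.eval lam)⁻¹ (hpow A.charpoly z hz)
    simpa [hch, smul_smul, inv_mul_cancel₀ hroot] using this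
  have h2 : ∀ z ∈ W, ((0 : Fin N → F), z.2) ∈ W := by
    intro z hz
    have := W.sub_mem hz (h1 z hz)
    have e : z - (z.1, (0 : Fin n → F)) = (0, z.2) := by ext <;> simp
    rwa [e] at this
  have hdec : W = (W.comap (LinearMap.inl F _ _)).prod (W.comap (LinearMap.inr F _ _)) := by
    ext z
    simp only [Submodule.mem_prod, Submodule.mem_comap, LinearMap.inl_apply, LinearMap.inr_apply]
    refine ⟨fun hz => ⟨h1 z hz, h2 z hz⟩, fun ⟨ha, hb⟩ => ?_⟩
    simpa using W.add_mem ha hb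
  refine ⟨W.comap (LinearMap.inl F _ _), ?_⟩
  rcases aux_irr A hirr (W.comap (LinearMap.inr F _ _)) (fun y hy => by
    simpa using hT _ hy) with h | h
  · left; rw [h] at hdec; exact hdec
  · right; rw [h] at hdec; exact hdec

/-- number of `k`-dimensional subspaces -/
noncomputable def subCount (F V : Type*) [Field F] [AddCommGroup V] [Module F V] (k : ℕ) : ℕ :=
  Nat.card {W : Submodule F V // Module.finrank F W = k}

theorem subCount_congr {F V V' : Type*} [Field F] [AddCommGroup V] [Module F V]
    [AddCommGroup V'] [Module F V'] (e : V ≃ₗ[F] V') (k : ℕ) :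
    subCount F V k = subCount F V' k := by
  refine Nat.card_congr ((Submodule.orderIsoMapComap e).toEquiv.subtypeEquiv fun W => ?_)
  have : Module.finrank F (W.map (e : V →ₗ[F] V')) = Module.finrank F W :=
    LinearEquiv.finrank_map_eq e W
  exact (by rw [← this]; rfl)

theorem finrank_prod_sub {F V V' : Type*} [Field F] [AddCommGroup V] [Module F V]
    [AddCommGroup V'] [Module F V'] [FiniteDimensional F V] [FiniteDimensional F V']
    (U : Submodule F V) (U' : Submodule F V') :
    Module.finrank F (U.prod U') = Module.finrank F U + Module.finrank F U' := by
  let e : U.prod U' ≃ₗ[F] U × U' :=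
    { toFun := fun z => (⟨z.1.1, z.2.1⟩, ⟨z.1.2, z.2.2⟩)
      invFun := fun z => ⟨(z.1.1, z.2.1), ⟨z.1.2, z.2.2⟩⟩
      map_add' := fun _ _ => rfl
      map_smul' := fun _ _ => rfl
      left_inv := fun _ => rfl
      right_inv := fun _ => rfl }
  rw [e.finrank_eq, Module.finrank_prod]

theorem finrank_graph {F V : Type*} [Field F] [AddCommGroup V] [Module F V]
    (f : V →ₗ.[F] F) : Module.finrank F f.graph = Module.finrank F f.domain := by
  have : f.graph = LinearMap.range (f.domain.subtype.prod f.toFun) := by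
    ext z
    simp only [LinearPMap.mem_graph_iff, LinearMap.mem_range]
    constructor
    · rintro ⟨y, h1, h2⟩; exact ⟨y, Prod.ext h1 h2⟩
    · rintro ⟨y, rfl⟩; exact ⟨y, rfl, rfl⟩
  rw [this]
  apply LinearMap.finrank_range_of_inj
  intro a b h
  exact Subtype.ext (congrArg Prod.fst h)

theorem subCount_step {F V : Type*} [Field F] [Fintype F] [AddCommGroup V] [Module F V]
    [FiniteDimensional F V] (k : ℕ) :
    subCount F (V × F) (k + 1) =
      subCount F V k + Fintype.card F ^ (k + 1) * subCount F V (k + 1) := by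
  classical
  have : Finite V := Module.finite_of_finite F
  let S := {U : Submodule F V // Module.finrank F U = k}
  let S' := {U : Submodule F V // Module.finrank F U = k + 1}
  have : Fintype S' := Fintype.ofFinite _
  let f : S ⊕ (Σ U : S', (U.1 →ₗ[F] F)) →
      {W : Submodule F (V × F) // Module.finrank F W = k + 1} :=
    Sum.elim (fun U => ⟨U.1.prod ⊤, by rw [finrank_prod_sub, U.2]; simp⟩)
      (fun U => ⟨(LinearPMap.mk U.1.1 U.2).graph, by rw [finrank_graph]; exact U.1.2⟩)
  have hl : ∀ U : Submodule F V, ((0 : V), (1 : F)) ∈ U.prod (⊤ : Submodule F F) := by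
    intro U; simp [Submodule.mem_prod]
  have hr : ∀ g : V →ₗ.[F] F, ((0 : V), (1 : F)) ∉ g.graph := by
    intro g h
    have := g.graph_fst_eq_zero_snd h rfl
    exact one_ne_zero this
  have hf : Function.Bijective f := by
    constructor
    · rintro (⟨U, hU⟩ | ⟨⟨U, hU⟩, g⟩) (⟨U', hU'⟩ | ⟨⟨U', hU'⟩, g'⟩) h
      · have h := congrArg Subtype.val h
        change U.prod ⊤ = U'.prod ⊤ at h
        congr 2
        ext x
        have := congrArg (fun P => (x, (0 : F)) ∈ P) h
        simpa [Submodule.mem_prod] using this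
      · have h := congrArg Subtype.val h
        change U.prod ⊤ = LinearPMap.graph _ at h
        exact absurd (h ▸ hl U) (hr _)
      · have h := congrArg Subtype.val h
        change LinearPMap.graph _ = U'.prod ⊤ at h
        exact absurd (h ▸ hl U') (hr _)
      · have h := congrArg Subtype.val h
        have := LinearPMap.eq_of_eq_graph h
        obtain ⟨h1, h2⟩ := LinearPMap.mk.inj this
        change U = U' at h1
        subst h1
        change g ≍ g' at h2
        rw [eq_of_heq h2]
    · rintro ⟨W, hW⟩
      by_cases h : ((0 : V), (1 : F)) ∈ W
      · have hdec : W = (W.comap (LinearMap.inl F V F)).prod ⊤ := by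
          ext ⟨x, c⟩
          simp only [Submodule.mem_prod, Submodule.mem_comap, LinearMap.inl_apply,
            Submodule.mem_top, and_true]
          have hc := W.smul_mem c h
          constructor
          · intro hx; simpa using W.sub_mem hx hc
          · intro hx; simpa using W.add_mem hx hc
        refine ⟨Sum.inl ⟨W.comap (LinearMap.inl F V F), ?_⟩, Subtype.ext hdec.symm⟩
        have h3 := finrank_prod_sub (W.comap (LinearMap.inl F V F)) (⊤ : Submodule F F)
        rw [← hdec, hW] at h3
        simpa using h3.symm
      · have hg : ∀ x ∈ W, x.1 = 0 → x.2 = 0 := by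
          rintro ⟨x, c⟩ hx h0
          by_contra hc
          apply h
          have := W.smul_mem c⁻¹ hx
          simp only at h0 hc
          simpa [h0, inv_mul_cancel₀ hc] using this
        have hgr := W.toLinearPMap_graph_eq hg
        refine ⟨Sum.inr ⟨⟨W.toLinearPMap.domain, ?_⟩, W.toLinearPMap.toFun⟩, Subtype.ext hgr⟩
        rw [← finrank_graph, hgr, hW]
  have hcard := Nat.card_congr (Equiv.ofBijective f hf)
  have : ∀ U : S', Finite (U.1 →ₗ[F] F) := fun U => Module.finite_of_finite F
  unfold subCount
  rw [← hcard, Nat.card_sum, Nat.card_sigma]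
  have : ∀ U : S', Nat.card (U.1 →ₗ[F] F) = Fintype.card F ^ (k + 1) := by
    intro U
    rw [Module.natCard_eq_pow_finrank (K := F), Nat.card_eq_fintype_card]
    have : Module.finrank F (U.1 →ₗ[F] F) = k + 1 := by
      rw [Module.finrank_linearMap_self, U.2]
    rw [this]
  simp only [this, Finset.sum_const, Finset.card_univ, smul_eq_mul, ← Nat.card_eq_fintype_card]
  rw [mul_comm]

theorem subCount_zero {F V : Type*} [Field F] [AddCommGroup V] [Module F V]
    [FiniteDimensional F V] : subCount F V 0 = 1 := by
  unfold subCount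
  rw [Nat.card_eq_one_iff_unique]
  refine ⟨⟨?_⟩, ⟨⟨⊥, by simp⟩⟩⟩
  rintro ⟨a, ha⟩ ⟨b, hb⟩
  rw [Submodule.finrank_eq_zero] at ha hb
  simp [ha, hb]

theorem subCount_eq (F : Type*) [Field F] [Fintype F] (n k : ℕ) :
    (subCount F (Fin n → F) k : ℤ) = gaussBinom (Fintype.card F : ℤ) n k := by
  induction n generalizing k with
  | zero =>
    cases k with
    | zero => simp [subCount_zero, gaussBinom]
    | succ k =>
      simp only [gaussBinom, subCount]
      rw [Nat.cast_eq_zero]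
      have : IsEmpty {W : Submodule F (Fin 0 → F) // Module.finrank F W = k + 1} := by
        refine ⟨fun W => ?_⟩
        have := Submodule.finrank_le W.1
        rw [W.2] at this
        simp at this
      exact Nat.card_of_isEmpty
  | succ n ih =>
    cases k with
    | zero => simp [subCount_zero, gaussBinom]
    | succ k =>
      have e : (Fin (n + 1) → F) ≃ₗ[F] (Fin n → F) × F :=
        LinearEquiv.ofFinrankEq _ _ (by simp)
      rw [subCount_congr e, subCount_step, gaussBinom, ← ih, ← ih]
      push_cast
      rfl

theorem gaussBinom_gt {R : Type*} [CommSemiring R] (q : R) (n k : ℕ) (h : n < k) :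
    gaussBinom q n k = 0 := by
  induction n generalizing k with
  | zero =>
    cases k with
    | zero => omega
    | succ k => rfl
  | succ n ih =>
    cases k with
    | zero => omega
    | succ k => rw [gaussBinom, ih k (by omega), ih (k + 1) (by omega)]; simp

theorem gaussBinomZ_nat {R : Type*} [CommRing R] (q : R) (n k : ℕ) :
    gaussBinomZ q (n : ℤ) (k : ℤ) = gaussBinom q n k := by
  unfold gaussBinomZ
  split_ifs with h
  · simp
  · rw [gaussBinom_gt]; omega

/-- Let `T` be block diagonal on `F^{m+i} × F^{m-i}`, with first block the scalar
matrix `λ·I` and second block a matrix `A` with irreducible characteristic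
polynomial not having `λ` as a root (similarity class type
`τ_i = {(1,(1^{m+i})), (m-i,(1))}`). Then the number of `j`-dimensional
`T`-invariant subspaces is `(m+i choose j)_q + (m+i choose j-m+i)_q`. -/
theorem invariant_subspace_count_taui (F : Type*) [Field F] [Fintype F]
    (m i : ℕ) (hi1 : 1 ≤ i) (him : i ≤ m) (lam : F)
    (A : Matrix (Fin (m - i)) (Fin (m - i)) F)
    (hirr : Irreducible A.charpoly) (hroot : A.charpoly.eval lam ≠ 0)
    (j : ℕ) (hj : j ≤ 2 * m) :
    (Nat.card {W : Submodule F ((Fin (m + i) → F) × (Fin (m - i) → F)) //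
        Module.finrank F W = j ∧
          W.map (LinearMap.prodMap (lam • LinearMap.id) (Matrix.toLin' A)) ≤ W} : ℤ) =
      gaussBinomZ (Fintype.card F : ℤ) ((m : ℤ) + i) (j : ℤ) +
        gaussBinomZ (Fintype.card F : ℤ) ((m : ℤ) + i) ((j : ℤ) - m + i) := by
  classical
  have hd : 0 < m - i := by
    rcases Nat.eq_zero_or_pos (m - i) with h | h
    · exfalso
      apply hirr.not_isUnit
      have := A.charpoly_natDegree_eq_dim
      rw [Fintype.card_fin] at this
      have h1 := (Matrix.charpoly_monic A).natDegree_eq_zero.mp (this.trans h)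
      rw [h1]; exact isUnit_one
    · exact h
  generalize hdd : m - i = d at *
  have : Finite (Fin (m + i) → F) := inferInstance
  let S := {U : Submodule F (Fin (m + i) → F) // Module.finrank F U = j}
  let S' := {U : Submodule F (Fin (m + i) → F) // Module.finrank F U + d = j}
  let f : S ⊕ S' → {W : Submodule F ((Fin (m + i) → F) × (Fin d → F)) //
        Module.finrank F W = j ∧
          W.map (LinearMap.prodMap (lam • LinearMap.id) (Matrix.toLin' A)) ≤ W} :=
    Sum.elim
      (fun U => ⟨U.1.prod ⊥, by rw [finrank_prod_sub, U.2]; simp, by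
        rintro _ ⟨z, hz, rfl⟩
        have hz := Submodule.mem_prod.mp hz
        refine Submodule.mem_prod.mpr ⟨U.1.smul_mem lam hz.1, ?_⟩
        have h2 : z.2 = 0 := by simpa using hz.2
        simp [h2]⟩)
      (fun U => ⟨U.1.prod ⊤, by rw [finrank_prod_sub]; simpa using U.2, by
        rintro _ ⟨z, hz, rfl⟩
        have hz := Submodule.mem_prod.mp hz
        exact Submodule.mem_prod.mpr ⟨U.1.smul_mem lam hz.1, trivial⟩⟩)
  have hbt : (⊥ : Submodule F (Fin d → F)) ≠ ⊤ := by
    have : Nonempty (Fin d) := ⟨⟨0, hd⟩⟩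
    exact bot_ne_top
  have key : ∀ (U U' : Submodule F (Fin (m + i) → F)) (Y Y' : Submodule F (Fin d → F)),
      U.prod Y = U'.prod Y' → U = U' ∧ Y = Y' := by
    intro U U' Y Y' h
    constructor
    · ext x
      have := congrArg (fun P => (x, (0 : Fin d → F)) ∈ P) h
      simpa [Submodule.mem_prod] using this
    · ext x
      have := congrArg (fun P => ((0 : Fin (m + i) → F), x) ∈ P) h
      simpa [Submodule.mem_prod] using this
  have hf : Function.Bijective f := by
    constructor
    · rintro (⟨U, hU⟩ | ⟨U, hU⟩) (⟨U', hU'⟩ | ⟨U', hU'⟩) h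
      · obtain ⟨h1, -⟩ := key _ _ _ _ (congrArg Subtype.val h)
        exact congrArg Sum.inl (Subtype.ext h1)
      · exact absurd (key _ _ _ _ (congrArg Subtype.val h)).2 hbt
      · exact absurd (key _ _ _ _ (congrArg Subtype.val h)).2 hbt.symm
      · obtain ⟨h1, -⟩ := key _ _ _ _ (congrArg Subtype.val h)
        exact congrArg Sum.inr (Subtype.ext h1)
    · rintro ⟨W, hW, hinv⟩
      obtain ⟨U, rfl | rfl⟩ := aux_split lam A hirr hroot W hinv
      · refine ⟨Sum.inl ⟨U, ?_⟩, rfl⟩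
        rw [finrank_prod_sub] at hW
        simpa using hW
      · refine ⟨Sum.inr ⟨U, ?_⟩, rfl⟩
        rw [finrank_prod_sub] at hW
        simpa using hW
  rw [← Nat.card_congr (Equiv.ofBijective f hf), Nat.card_sum, Nat.cast_add]
  have e1 : ((m : ℤ) + i) = ((m + i : ℕ) : ℤ) := by push_cast; rfl
  rw [e1, gaussBinomZ_nat, ← subCount_eq]
  congr 1
  by_cases hjd : d ≤ j
  · have e2 : (j : ℤ) - m + i = ((j - d : ℕ) : ℤ) := by omega
    rw [e2, gaussBinomZ_nat, ← subCount_eq]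
    congr 1
    refine Nat.card_congr (Equiv.subtypeEquivRight fun U => ?_)
    omega
  · have : IsEmpty S' := ⟨fun U => by have := U.2; omega⟩
    rw [Nat.card_of_isEmpty, gaussBinomZ, if_neg (by omega)]
    rfl
end

section
/- Main theorem: for any linear operator T : F_q^{2m} → F_q^{2m} over a finite field F_q, the number of m-dimensional T-splitting subspaces (subspaces W with W + T W = F_q^{2m}) equals q^{binom(m,2)} · ∑_{j=0}^{2m} (−1)^j · X_j^T · q^{binom(m−j+1, 2)}, where X_j^T is the number of j-dimensional T-invariant subspaces of F_q^{2m}. -/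
/-- Gaussian binomial coefficient. -/
def qb (q : ℚ) : ℕ → ℕ → ℚ
  | _, 0 => 1
  | 0, _ + 1 => 0
  | n + 1, k + 1 => qb q n k + q ^ (k + 1) * qb q n (k + 1)

/-- unnormalised q-factorial -/
def qf (q : ℚ) : ℕ → ℚ
  | 0 => 1
  | n + 1 => qf q n * (q ^ (n + 1) - 1)

lemma qb_zero_right (q : ℚ) (n : ℕ) : qb q n 0 = 1 := by
  cases n <;> rfl

lemma qb_succ (q : ℚ) (n k : ℕ) :
    qb q (n + 1) (k + 1) = qb q n k + q ^ (k + 1) * qb q n (k + 1) := rfl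

lemma qb_eq_zero (q : ℚ) : ∀ n k : ℕ, n < k → qb q n k = 0
  | _, 0, h => by omega
  | 0, _ + 1, _ => rfl
  | n + 1, k + 1, h => by
    rw [qb_succ, qb_eq_zero q n k (by omega), qb_eq_zero q n (k + 1) (by omega)]; simp

lemma qb_self (q : ℚ) (n : ℕ) : qb q n n = 1 := by
  induction n with
  | zero => rfl
  | succ n ih => rw [qb_succ, ih, qb_eq_zero q n (n + 1) (by omega)]; simp

lemma qf_succ (q : ℚ) (n : ℕ) : qf q (n + 1) = qf q n * (q ^ (n + 1) - 1) := rfl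

lemma pow_sub_ne {q : ℚ} (hq : 1 < q) {n : ℕ} (hn : n ≠ 0) : q ^ n - 1 ≠ 0 := by
  have := one_lt_pow₀ hq hn
  linarith

lemma qf_ne {q : ℚ} (hq : 1 < q) (n : ℕ) : qf q n ≠ 0 := by
  induction n with
  | zero => simp [qf]
  | succ n ih => rw [qf_succ]; exact mul_ne_zero ih (pow_sub_ne hq (by omega))

lemma qb_mul_qf (q : ℚ) : ∀ a b : ℕ, qb q (a + b) a * qf q a * qf q b = qf q (a + b)
  | 0, b => by simp [qb_zero_right, qf]
  | a + 1, 0 => by simp [qb_self, qf]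
  | a + 1, b + 1 => by
    have h1 := qb_mul_qf q a (b + 1)
    have h2 := qb_mul_qf q (a + 1) b
    have e1 : a + 1 + (b + 1) = (a + (b + 1)) + 1 := by ring
    have e2 : a + 1 + b = a + (b + 1) := by ring
    rw [e2] at h2
    rw [e1, qb_succ, qf_succ q (a + (b + 1))]
    rw [qf_succ q b] at *
    rw [qf_succ q a] at *
    have e3 : q ^ (a + (b + 1) + 1) = q ^ (a + 1) * q ^ (b + 1) := by ring
    rw [e3]
    linear_combination (q ^ (a + 1) - 1) * h1 + q ^ (a + 1) * (q ^ (b + 1) - 1) * h2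
  termination_by a b => a + b

lemma qb_symm {q : ℚ} (hq : 1 < q) (a b : ℕ) : qb q (a + b) a = qb q (a + b) b := by
  have h1 := qb_mul_qf q a b
  have h2 := qb_mul_qf q b a
  rw [add_comm b a] at h2
  have := qf_ne hq a
  have := qf_ne hq b
  have h3 : (qb q (a + b) a - qb q (a + b) b) * (qf q a * qf q b) = 0 := by
    linear_combination h1 - h2
  rcases mul_eq_zero.1 h3 with h | h
  · linarith
  · simp_all

lemma qb_tri {q : ℚ} (hq : 1 < q) (b s l : ℕ) (hl : l ≤ s) :
    qb q (b + s) (b + l) * qb q (b + l) b = qb q (b + s) b * qb q s l := by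
  obtain ⟨t, rfl⟩ := Nat.exists_eq_add_of_le hl
  have h1 := qb_mul_qf q (b + l) t
  have h2 := qb_mul_qf q b l
  have h3 := qb_mul_qf q b (l + t)
  have h4 := qb_mul_qf q l t
  have := qf_ne hq b
  have := qf_ne hq l
  have := qf_ne hq t
  have h5 : qb q (b + l + t) (b + l) * qb q (b + l) b * (qf q b * qf q l * qf q t)
      = qb q (b + (l + t)) b * qb q (l + t) l * (qf q b * qf q l * qf q t) := by
    rw [← h4] at h3
    rw [← h2] at h1
    rw [← add_assoc] at *
    linear_combination h1 - h3
  rw [← add_assoc] at *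
  exact mul_right_cancel₀ (by simp_all) h5

lemma qb_absorb {q : ℚ} (hq : 1 < q) (n k : ℕ) :
    qb q (n + 1) (k + 1) * (q ^ (k + 1) - 1) = (q ^ (n + 1) - 1) * qb q n k := by
  by_cases h : k ≤ n
  · obtain ⟨t, rfl⟩ := Nat.exists_eq_add_of_le h
    have h1 := qb_mul_qf q (k + 1) t
    have h2 := qb_mul_qf q k t
    rw [show k + 1 + t = k + t + 1 by ring, qf_succ, qf_succ, ← h2] at h1
    have := qf_ne hq k
    have := qf_ne hq t
    exact mul_right_cancel₀ (b := qf q k * qf q t) (by simp_all) (by linear_combination h1)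
  · rw [qb_eq_zero q _ _ (by omega), qb_eq_zero q n k (by omega)]; simp

lemma vander1 (q : ℚ) (N : ℕ) : ∀ M r : ℕ,
    ∑ l ∈ Finset.range (r + 1), qb q M l * qb q N (r - l) * q ^ ((r - l) * (M - l))
      = qb q (M + N) r := by
  intro M
  induction M with
  | zero =>
    intro r
    rw [Finset.sum_range_succ']
    simp [qb]
  | succ M ih =>
    intro r
    cases r with
    | zero => simp [qb_zero_right]
    | succ r =>
      rw [show M + 1 + N = M + N + 1 by ring, qb_succ, ← ih r, ← ih (r + 1),
        Finset.sum_range_succ', Finset.sum_range_succ' _ (r + 1), mul_add, ← add_assoc,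
        Finset.mul_sum, ← Finset.sum_add_distrib]
      congr 1
      · apply Finset.sum_congr rfl
        intro l hl
        have hl : l ≤ r := by simpa [Nat.lt_succ_iff] using hl
        rw [qb_succ, show r + 1 - (l + 1) = r - l by omega, show M + 1 - (l + 1) = M - l by omega]
        by_cases h : l + 1 ≤ M
        · obtain ⟨s, rfl⟩ := Nat.exists_eq_add_of_le h
          obtain ⟨t, rfl⟩ := Nat.exists_eq_add_of_le hl
          rw [show l + 1 + s - l = s + 1 by omega, show l + 1 + s - (l + 1) = s by omega,
            show l + t - l = t by omega]
          ring
        · rw [qb_eq_zero q M (l + 1) (by omega)]; ring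
      · simp only [qb_zero_right, Nat.sub_zero]
        ring

/-- Vandermonde weight -/
def wt (q : ℚ) (N r b : ℕ) : ℚ :=
  if b ≤ r then qb q N (r - b) * q ^ (b * (N - (r - b))) else 0

lemma vander2 (q : ℚ) (M N r B : ℕ) (hB : M ≤ B) :
    ∑ b ∈ Finset.range (B + 1), qb q M b * wt q N r b = qb q (M + N) r := by
  have h1 : ∑ b ∈ Finset.range (B + 1), qb q M b * wt q N r b
      = ∑ b ∈ Finset.range (B + r + 1), qb q M b * wt q N r b := by
    apply Finset.sum_subset
    · intro x; simp; omega
    · intro x _ hx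
      rw [qb_eq_zero q M x (by simp at hx; omega)]; simp
  have h2 : ∑ b ∈ Finset.range (r + 1), qb q M b * wt q N r b
      = ∑ b ∈ Finset.range (B + r + 1), qb q M b * wt q N r b := by
    apply Finset.sum_subset
    · intro x; simp; omega
    · intro x _ hx
      rw [wt, if_neg (by simp at hx; omega)]; simp
  rw [h1, ← h2, add_comm M N, ← vander1 q M N r, ← Finset.sum_range_reflect]
  apply Finset.sum_congr rfl
  intro b hb
  have hb : b ≤ r := by simpa [Nat.lt_succ_iff] using hb
  rw [wt, if_pos (by omega), show r + 1 - 1 - b = r - b by omega, show r - (r - b) = b by omega]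
  ring

lemma alt_sum (q : ℚ) (k B : ℕ) (hB : k ≤ B) :
    ∑ b ∈ Finset.range (B + 1), (-1) ^ b * q ^ (b.choose 2) * qb q k b
      = if k = 0 then 1 else 0 := by
  cases k with
  | zero =>
    rw [Finset.sum_range_succ']
    simp [qb]
  | succ k =>
    rw [Finset.sum_range_succ']
    have : ∀ b, (-1) ^ (b + 1) * q ^ ((b + 1).choose 2) * qb q (k + 1) (b + 1)
      = (fun b => (-1) ^ b * q ^ ((b + 1).choose 2) * qb q k b) (b + 1) -
        (fun b => (-1) ^ b * q ^ ((b + 1).choose 2) * qb q k b) b := by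
      intro b
      have : (b + 1 + 1).choose 2 = (b + 1).choose 2 + (b + 1) := by
        rw [Nat.choose_succ_succ' (b + 1) 1]; simp; ring
      simp only [qb_succ, this]
      ring
    simp only [this]
    rw [Finset.sum_range_sub (fun b => (-1) ^ b * q ^ ((b + 1).choose 2) * qb q k b)]
    simp [qb_eq_zero q k B (by omega), qb_zero_right]

/-- closed form for the irreducible pair count -/
def Kc (q : ℚ) (n c a : ℕ) : ℚ :=
  (q ^ n - 1) / (q ^ c - 1) * qb q c a * qb q (n - a - 1) (c - a - 1)

/-- closed form for the irreducible profile count -/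
def Np (q : ℚ) (n a k : ℕ) : ℚ :=
  (q ^ n - 1) / (q ^ a - 1) * qb q a k * qb q (n - a - 1) (a - k - 1) *
    q ^ ((a - k) * (a - k - 1))

lemma Kc_eq {q : ℚ} (hq : 1 < q) (n a b : ℕ) (hb : b < a) (ha : a < n) :
    ∑ k ∈ Finset.range a, Np q n a k * qb q k b = Kc q n a b := by
  obtain ⟨p, rfl⟩ := Nat.exists_eq_add_of_lt hb
  obtain ⟨e, rfl⟩ := Nat.exists_eq_add_of_lt ha
  rw [add_assoc b p 1, Finset.sum_range_add, Finset.sum_eq_zero, zero_add]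
  · rw [Kc, show b + (p + 1) + e + 1 - b - 1 = p + 1 + e by omega,
      show b + (p + 1) - b - 1 = p by omega, ← vander1 q e (p + 1) p, Finset.mul_sum]
    apply Finset.sum_congr rfl
    intro l hl
    have hl : l ≤ p := by simpa [Nat.lt_succ_iff] using hl
    have := qb_tri hq b (p + 1) l (by omega)
    rw [Np, show b + (p + 1) + e + 1 - (b + (p + 1)) - 1 = e by omega,
      show b + (p + 1) - (b + l) - 1 = p - l by omega,
      show b + (p + 1) - (b + l) = p + 1 - l by omega]
    linear_combination (q ^ (b + (p + 1) + e + 1) - 1) / (q ^ (b + (p + 1)) - 1) *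
      qb q e (p - l) * q ^ ((p + 1 - l) * (p - l)) * this
  · intro k hk
    rw [qb_eq_zero q k b (by simpa using hk)]; simp

lemma Kc_eq2 {q : ℚ} (hq : 1 < q) (n c a : ℕ) (ha0 : 0 < a) (hac : a < c) (hcn : c ≤ n)
    (han : 2 * a ≤ n) :
    ∑ k ∈ Finset.range a, Np q n a k * qb q (k + (n - 2 * a)) (n - c) = Kc q n c a := by
  obtain ⟨t, rfl⟩ := Nat.exists_eq_add_of_lt hac
  obtain ⟨f, rfl⟩ := Nat.exists_eq_add_of_le hcn
  obtain ⟨a, rfl⟩ : ∃ a', a = a' + 1 := ⟨a - 1, by omega⟩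
  have key : ∀ k ∈ Finset.range (a + 1),
      Np q (a + 1 + t + 1 + f) (a + 1) k *
        qb q (k + (a + 1 + t + 1 + f - 2 * (a + 1))) (a + 1 + t + 1 + f - (a + 1 + t + 1))
      = (q ^ (a + 1 + t + 1 + f) - 1) / (q ^ (a + 1) - 1) * qb q (f + t) f *
       (qb q (a + 1) k * qb q t (a - k) * q ^ ((a - k) * (a + 1 - k))) := by
    intro k hk
    have hk : k ≤ a := by simpa [Nat.lt_succ_iff] using hk
    obtain ⟨i, rfl⟩ := Nat.exists_eq_add_of_le hk
    rw [Np, show k + i + 1 + t + 1 + f - (k + i + 1) - 1 = f + t by omega,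
      show k + i + 1 - k - 1 = i by omega, show k + i + 1 - k = i + 1 by omega,
      show k + (k + i + 1 + t + 1 + f - 2 * (k + i + 1)) = f + t - i by omega,
      show k + i + 1 + t + 1 + f - (k + i + 1 + t + 1) = f by omega,
      show k + i - k = i by omega]
    have : qb q (f + t) i * qb q (f + t - i) f = qb q (f + t) f * qb q t i := by
      by_cases hi : i ≤ t
      · obtain ⟨s, rfl⟩ := Nat.exists_eq_add_of_le hi
        have h1 := qb_tri hq f (i + s) s (by omega)
        rw [show f + (i + s) - i = f + s by omega, show f + (i + s) = i + (f + s) by ring,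
          qb_symm hq i (f + s), qb_symm hq i s]
        rw [show f + (i + s) = i + (f + s) by ring] at h1
        exact h1
      · rw [qb_eq_zero q t i (by omega), qb_eq_zero q (f + t - i) f (by omega)]; simp
    linear_combination (q ^ (k + i + 1 + t + 1 + f) - 1) / (q ^ (k + i + 1) - 1) *
      qb q (k + i + 1) k * q ^ ((i + 1) * i) * this
  rw [Finset.sum_congr rfl key, ← Finset.mul_sum, vander1, Kc,
    show a + 1 + t + 1 + f - (a + 1) - 1 = f + t by omega,
    show a + 1 + t + 1 - (a + 1) - 1 = t by omega]
  have h1 := qb_absorb hq (a + 1 + t) a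
  have h2 := pow_sub_ne hq (n := a + 1) (by omega)
  have h3 := pow_sub_ne hq (n := a + 1 + t + 1) (by omega)
  rw [qb_symm hq f t]
  have h4 : qb q (a + 1 + t) a / (q ^ (a + 1) - 1)
      = qb q (a + 1 + t + 1) (a + 1) / (q ^ (a + 1 + t + 1) - 1) := by
    rw [div_eq_div_iff h2 h3]; linear_combination -h1
  linear_combination (q ^ (a + 1 + t + 1 + f) - 1) * qb q (f + t) t * h4

lemma Kc_zero {q : ℚ} (hq : 1 < q) (n c : ℕ) (hc : 0 < c) (hcn : c ≤ n) :
    Kc q n c 0 = qb q n c := by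
  obtain ⟨c, rfl⟩ : ∃ a', c = a' + 1 := ⟨c - 1, by omega⟩
  obtain ⟨n, rfl⟩ : ∃ a', n = a' + 1 := ⟨n - 1, by omega⟩
  have h1 := qb_absorb hq n c
  have h2 := pow_sub_ne hq (n := c + 1) (by omega)
  rw [Kc, qb_zero_right]
  simp only [Nat.sub_zero, Nat.add_sub_cancel]
  field_simp
  linear_combination -h1

lemma Kc_rec {q : ℚ} (hq : 1 < q) (n c a : ℕ) (ha0 : 0 < a) (hac : a < c) (hcn : c ≤ n)
    (han : 2 * a ≤ n) :
    ∑ b ∈ Finset.range a, Kc q n a b * wt q (n - 2 * a) (n - c) b = Kc q n c a := by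
  rw [← Kc_eq2 hq n c a ha0 hac hcn han]
  have h1 : ∀ b ∈ Finset.range a, Kc q n a b * wt q (n - 2 * a) (n - c) b
      = ∑ k ∈ Finset.range a, Np q n a k * (qb q k b * wt q (n - 2 * a) (n - c) b) := by
    intro b hb
    rw [← Kc_eq hq n a b (by simpa using hb) (by omega), Finset.sum_mul]
    exact Finset.sum_congr rfl fun _ _ => by ring
  rw [Finset.sum_congr rfl h1, Finset.sum_comm]
  apply Finset.sum_congr rfl
  intro k hk
  rw [← Finset.mul_sum]
  obtain ⟨a, rfl⟩ : ∃ a', a = a' + 1 := ⟨a - 1, by omega⟩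
  rw [vander2 _ _ _ _ _ (by simpa [Nat.lt_succ_iff] using hk)]

lemma wt_shift (q : ℚ) (n a c b j : ℕ) (hj : j ≤ b) (hjr : j ≤ n - c) (hb : b ≤ a) (hac : a ≤ c)
    (hcn : c ≤ n) (han : 2 * a ≤ n) :
    q ^ (j * (a - b)) * wt q (n - 2 * a) (n - c) b
      = q ^ (j * (c - a)) * wt q ((n - 2 * j) - 2 * (a - j)) ((n - 2 * j) - (c - j)) (b - j) := by
  rw [show n - 2 * j - 2 * (a - j) = n - 2 * a by omega,
    show n - 2 * j - (c - j) = n - c - j by omega]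
  unfold wt
  by_cases h : b ≤ n - c
  · rw [if_pos h, if_pos (by omega), show n - c - j - (b - j) = n - c - b by omega]
    by_cases h2 : n - c - b ≤ n - 2 * a
    · have e : j * (a - b) + b * (n - 2 * a - (n - c - b))
          = j * (c - a) + (b - j) * (n - 2 * a - (n - c - b)) := by
        rw [show n - 2 * a - (n - c - b) = c + b - 2 * a by omega]
        obtain ⟨x, rfl⟩ := Nat.exists_eq_add_of_le hj
        obtain ⟨y, rfl⟩ := Nat.exists_eq_add_of_le hb
        obtain ⟨z, rfl⟩ := Nat.exists_eq_add_of_le hac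
        obtain ⟨w, rfl⟩ : ∃ w, z = y + w := ⟨z - y, by omega⟩
        rw [show j + x + y - (j + x) = y by omega, show j + x + y + (y + w) - (j + x + y) = y + w by omega,
          show j + x - j = x by omega,
          show j + x + y + (y + w) + (j + x) - 2 * (j + x + y) = w by omega]
        ring
      have e' := congrArg (q ^ ·) e
      simp only [pow_add] at e'
      linear_combination qb q (n - 2 * a) (n - c - b) * e'
    · rw [qb_eq_zero q (n - 2 * a) _ (by omega)]; simp
  · rw [if_neg h, if_neg (by omega)]; simp

theorem A_formula {q : ℚ} (hq : 1 < q) (n : ℕ) (A : ℕ → ℕ → ℚ) (X : ℕ → ℚ)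
    (hX : ∀ a, A a a = X a)
    (hR : ∀ a c, 2 * a ≤ n → a ≤ c → c ≤ n →
      A c a = ∑ b ∈ Finset.range (a + 1), A a b * wt q (n - 2 * a) (n - c) b) :
    ∀ a c, a < c → c + a ≤ n →
      A c a = ∑ j ∈ Finset.range (a + 1), X j * q ^ (j * (c - a)) *
        Kc q (n - 2 * j) (c - j) (a - j) := by
  intro a
  induction a using Nat.strong_induction_on with
  | _ a ih =>
    intro c hac hcn
    rw [hR a c (by omega) hac.le (by omega), Finset.sum_range_succ, Finset.sum_range_succ]
    congr 1
    · have h1 : ∀ b ∈ Finset.range a, A a b * wt q (n - 2 * a) (n - c) b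
        = ∑ j ∈ Finset.range a, if j ≤ b then X j * q ^ (j * (c - a)) *
          (Kc q (n - 2 * j) (a - j) (b - j) *
            wt q ((n - 2 * j) - 2 * (a - j)) ((n - 2 * j) - (c - j)) (b - j)) else 0 := by
        intro b hb
        have hb : b < a := by simpa using hb
        rw [ih b hb a hb (by omega), Finset.sum_mul, ← Finset.sum_filter]
        have : Finset.filter (fun j => j ≤ b) (Finset.range a) = Finset.range (b + 1) := by
          ext x; simp; omega
        rw [this]
        apply Finset.sum_congr rfl
        intro j hj
        have hj : j ≤ b := by simpa [Nat.lt_succ_iff] using hj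
        have := wt_shift q n a c b j hj (by omega) hb.le hac.le (by omega) (by omega)
        linear_combination X j * Kc q (n - 2 * j) (a - j) (b - j) * this
      rw [Finset.sum_congr rfl h1, Finset.sum_comm]
      apply Finset.sum_congr rfl
      intro j hj
      have hj : j < a := by simpa using hj
      rw [← Kc_rec hq (n - 2 * j) (c - j) (a - j) (by omega) (by omega) (by omega) (by omega),
        Finset.mul_sum, ← Finset.sum_filter]
      symm
      apply Finset.sum_bij' (fun b _ => b + j) (fun b _ => b - j)
      all_goals simp
      all_goals omega
    · rw [hX, Nat.sub_self, Kc_zero hq _ _ (by omega) (by omega), wt, if_pos (by omega)]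
      have e1 : n - 2 * a = (c - a) + (n - c - a) := by omega
      rw [e1, ← qb_symm hq, show c - a + (n - c - a) - (n - c - a) = c - a by omega]
      ring

theorem X_symm {q : ℚ} (hq : 1 < q) (n : ℕ) (A A' : ℕ → ℕ → ℚ) (X X' : ℕ → ℚ)
    (hX : ∀ a, A a a = X a)
    (hR : ∀ a c, 2 * a ≤ n → a ≤ c → c ≤ n →
      A c a = ∑ b ∈ Finset.range (a + 1), A a b * wt q (n - 2 * a) (n - c) b)
    (hX' : ∀ a, A' a a = X' a)
    (hR' : ∀ a c, 2 * a ≤ n → a ≤ c → c ≤ n →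
      A' c a = ∑ b ∈ Finset.range (a + 1), A' a b * wt q (n - 2 * a) (n - c) b)
    (hAA : ∀ a ≤ n, A (n - a) a = A' (n - a) a) :
    ∀ a, 2 * a < n → X a = X' a := by
  intro a
  induction a using Nat.strong_induction_on with
  | _ a ih =>
    intro han
    have h1 := A_formula hq n A X hX hR a (n - a) (by omega) (by omega)
    have h2 := A_formula hq n A' X' hX' hR' a (n - a) (by omega) (by omega)
    rw [hAA a (by omega), h2, Finset.sum_range_succ, Finset.sum_range_succ] at h1
    rw [Finset.sum_congr rfl (fun j hj => by
      rw [← ih j (by simpa using hj) (by simp at hj; omega)])] at h1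
    have h3 := add_left_cancel h1
    rw [Nat.sub_self, Kc_zero hq _ _ (by omega) (by omega),
      show n - a - a = n - 2 * a by omega, qb_self] at h3
    have : q ^ (a * (n - 2 * a)) ≠ 0 := by positivity
    simp only [mul_one] at h3
    exact (mul_right_cancel₀ this h3).symm

lemma binom2_up (d : ℕ) : binom2 ((d : ℤ) + 1) = (d + 1).choose 2 := by
  unfold binom2
  rw [Nat.choose_two_right]
  have : ((d : ℤ) + 1) * ((d : ℤ) + 1 - 1) / 2 = (((d + 1) * (d + 1 - 1) / 2 : ℕ) : ℤ) := by
    push_cast; simp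
  rw [this, Int.toNat_natCast]

lemma binom2_down (d : ℕ) : binom2 (-(d : ℤ) + 1) = d.choose 2 := by
  unfold binom2
  rw [Nat.choose_two_right]
  have : (-(d : ℤ) + 1) * (-(d : ℤ) + 1 - 1) / 2 = ((d * (d - 1) / 2 : ℕ) : ℤ) := by
    cases d with
    | zero => simp
    | succ d => push_cast; congr 1; simp; ring
  rw [this, Int.toNat_natCast]

lemma two_choose_two (d : ℕ) : 2 * d.choose 2 + d = d * d := by
  induction d with
  | zero => simp
  | succ d ih => rw [Nat.choose_succ_succ' d 1]; simp; linarith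

lemma choose_two_add (j d : ℕ) : (j + d).choose 2 = j.choose 2 + d.choose 2 + j * d := by
  have h1 := two_choose_two (j + d)
  have h2 := two_choose_two j
  have h3 := two_choose_two d
  have : (j + d) * (j + d) = j * j + d * d + 2 * (j * d) := by ring
  omega

lemma Kc_alt {q : ℚ} (hq : 1 < q) (d : ℕ) (hd : 0 < d) :
    ∑ i ∈ Finset.range d, (-1) ^ i * q ^ (i.choose 2) * Kc q (2 * d) d i
      = q ^ (d * (d - 1)) * (q ^ d + 1) := by
  have h1 : ∀ i ∈ Finset.range d, (-1) ^ i * q ^ (i.choose 2) * Kc q (2 * d) d i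
      = ∑ k ∈ Finset.range d, Np q (2 * d) d k * ((-1) ^ i * q ^ (i.choose 2) * qb q k i) := by
    intro b hb
    rw [← Kc_eq hq (2 * d) d b (by simpa using hb) (by omega), Finset.mul_sum]
    exact Finset.sum_congr rfl fun _ _ => by ring
  rw [Finset.sum_congr rfl h1, Finset.sum_comm]
  obtain ⟨e, rfl⟩ : ∃ a', d = a' + 1 := ⟨d - 1, by omega⟩
  have h2 : ∀ k ∈ Finset.range (e + 1), ∑ i ∈ Finset.range (e + 1),
      Np q (2 * (e + 1)) (e + 1) k * ((-1) ^ i * q ^ (i.choose 2) * qb q k i)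
      = if k = 0 then Np q (2 * (e + 1)) (e + 1) k else 0 := by
    intro k hk
    rw [← Finset.mul_sum, alt_sum _ _ _ (by simpa [Nat.lt_succ_iff] using hk)]
    simp
  rw [Finset.sum_congr rfl h2, Finset.sum_ite_eq' ]
  simp only [Finset.mem_range, Nat.succ_pos, if_true]
  rw [Np, qb_zero_right, show 2 * (e + 1) - (e + 1) - 1 = e by omega,
    show e + 1 - 0 - 1 = e by omega, qb_self]
  have := pow_sub_ne hq (n := e + 1) (by omega)
  simp only [Nat.sub_zero, Nat.add_sub_cancel]
  field_simp
  ring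

theorem final_sum {q : ℚ} (hq : 1 < q) (m : ℕ) (A : ℕ → ℕ → ℚ) (X : ℕ → ℚ)
    (hX : ∀ a, A a a = X a)
    (hR : ∀ a c, 2 * a ≤ 2 * m → a ≤ c → c ≤ 2 * m →
      A c a = ∑ b ∈ Finset.range (a + 1), A a b * wt q (2 * m - 2 * a) (2 * m - c) b)
    (hs : ∀ a, 2 * a < 2 * m → X a = X (2 * m - a)) :
    ∑ b ∈ Finset.range (m + 1), (-1) ^ b * q ^ (b.choose 2) * A m b
      = q ^ (m.choose 2) * ∑ j ∈ Finset.range (2 * m + 1), (-1) ^ j * X j *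
        q ^ (binom2 ((m : ℤ) - j + 1)) := by
  have hr : ∑ j ∈ Finset.range (2 * m + 1), (-1) ^ j * X j * q ^ (binom2 ((m : ℤ) - j + 1))
      = ∑ j ∈ Finset.range m, (-1) ^ j * X j * (q ^ ((m - j + 1).choose 2) + q ^ ((m - j).choose 2))
        + (-1) ^ m * X m := by
    rw [show 2 * m + 1 = (m + 1) + m by ring, Finset.sum_range_add, Finset.sum_range_succ,
      ← Finset.sum_range_reflect (fun x => (-1) ^ (m + 1 + x) * X (m + 1 + x) * _)]
    have e0 : binom2 ((m : ℤ) - m + 1) = 0 := by simp [binom2]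
    rw [e0]
    simp only [mul_add, Finset.sum_add_distrib]
    have e1 : ∀ j ∈ Finset.range m, (-1) ^ j * X j * q ^ (binom2 ((m : ℤ) - j + 1))
        = (-1) ^ j * X j * q ^ ((m - j + 1).choose 2) := by
      intro j hj
      have hj : j < m := by simpa using hj
      rw [← binom2_up, Nat.cast_sub hj.le]
    have e2 : ∀ j ∈ Finset.range m, (-1) ^ (m + 1 + (m - 1 - j)) * X (m + 1 + (m - 1 - j)) *
          q ^ (binom2 ((m : ℤ) - ((m + 1 + (m - 1 - j) : ℕ) : ℤ) + 1))
        = (-1) ^ j * X j * q ^ ((m - j).choose 2) := by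
      intro j hj
      have hj : j < m := by simpa using hj
      rw [← binom2_down, hs j (by omega), show m + 1 + (m - 1 - j) = 2 * m - j by omega]
      congr 2
      · rw [show 2 * m - j = j + 2 * (m - j) by omega, pow_add, pow_mul]; simp
      · congr 1
        omega
    rw [Finset.sum_congr rfl e1, Finset.sum_congr rfl e2]
    ring
  rw [hr, mul_add, Finset.sum_range_succ, hX]
  congr 1
  swap
  · ring
  have h1 : ∀ b ∈ Finset.range m, (-1) ^ b * q ^ (b.choose 2) * A m b
      = ∑ j ∈ Finset.range m, if j ≤ b then (-1) ^ j * X j * q ^ (j.choose 2 + j * (m - j)) *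
          ((-1) ^ (b - j) * q ^ ((b - j).choose 2) *
          Kc q (2 * (m - j)) (m - j) (b - j)) else 0 := by
    intro b hb
    have hb : b < m := by simpa using hb
    rw [A_formula hq (2 * m) A X hX hR b m hb (by omega), Finset.mul_sum, ← Finset.sum_filter]
    have : Finset.filter (fun j => j ≤ b) (Finset.range m) = Finset.range (b + 1) := by
      ext x; simp; omega
    rw [this]
    apply Finset.sum_congr rfl
    intro j hj
    have hj : j ≤ b := by simpa [Nat.lt_succ_iff] using hj
    obtain ⟨i, rfl⟩ := Nat.exists_eq_add_of_le hj
    obtain ⟨s, rfl⟩ := Nat.exists_eq_add_of_lt hb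
    rw [choose_two_add, show j + i + s + 1 - j = i + s + 1 by omega,
      show j + i + s + 1 - (j + i) = s + 1 by omega, show j + i - j = i by omega,
      show 2 * (j + i + s + 1) - 2 * j = 2 * (i + s + 1) by omega]
    ring
  rw [Finset.sum_congr rfl h1, Finset.sum_comm, Finset.mul_sum]
  apply Finset.sum_congr rfl
  intro j hj
  have hj : j < m := by simpa using hj
  have h2 : ∑ b ∈ Finset.range m, (if j ≤ b then (-1) ^ j * X j * q ^ (j.choose 2 + j * (m - j)) *
          ((-1) ^ (b - j) * q ^ ((b - j).choose 2) *
          Kc q (2 * (m - j)) (m - j) (b - j)) else 0)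
      = ∑ i ∈ Finset.range (m - j), (-1) ^ j * X j * q ^ (j.choose 2 + j * (m - j)) *
          ((-1) ^ i * q ^ (i.choose 2) * Kc q (2 * (m - j)) (m - j) i) := by
    rw [← Finset.sum_filter]
    symm
    apply Finset.sum_bij' (fun b _ => b + j) (fun b _ => b - j)
    all_goals simp
    all_goals omega
  rw [h2, ← Finset.mul_sum, Kc_alt hq (m - j) (by omega)]
  obtain ⟨d, rfl⟩ : ∃ d, m = j + d + 1 := ⟨m - j - 1, by omega⟩
  rw [show j + d + 1 - j = d + 1 by omega]
  rw [show j + d + 1 = j + (d + 1) by ring, choose_two_add, Nat.add_sub_cancel]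
  have t1 := two_choose_two (d + 1)
  have t2 := choose_two_add (d + 1) 1
  have e1 : (d + 1) * d = 2 * (d + 1).choose 2 := by
    have : (d + 1) * (d + 1) = (d + 1) * d + (d + 1) := by ring
    omega
  rw [t2, e1]
  simp
  ring

section comb

open Module

lemma prod_qf (q : ℚ) (k : ℕ) : ∀ t : ℕ,
    (∏ i ∈ Finset.range k, (q ^ (k + t) - q ^ i)) * qf q t = q ^ (k.choose 2) * qf q (k + t) := by
  suffices H : ∀ l t : ℕ, (∏ i ∈ Finset.range l, (q ^ (l + t) - q ^ i)) * qf q t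
      = q ^ (l.choose 2) * qf q (l + t) from H k
  intro l
  induction l with
  | zero => intro t; simp
  | succ l ih =>
    intro t
    have h := ih (t + 1)
    rw [show l + (t + 1) = l + 1 + t by ring, qf_succ] at h
    rw [Finset.prod_range_succ, show (l + 1).choose 2 = l.choose 2 + l from by
      rw [choose_two_add]; simp]
    have e : q ^ (l + 1 + t) = q ^ l * q ^ (t + 1) := by ring
    rw [pow_add q (l.choose 2) l]
    calc _ = (∏ i ∈ Finset.range l, (q ^ (l + 1 + t) - q ^ i)) *
            (q ^ l * q ^ (t + 1) - q ^ l) * qf q t := by rw [← e]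
      _ = _ := by linear_combination q ^ l * h

variable {F : Type*} [Field F] [Fintype F]

lemma one_lt_card : (1 : ℚ) < (Fintype.card F : ℚ) := by
  exact_mod_cast Fintype.one_lt_card

instance finite_sub (V : Type*) [AddCommGroup V] [Module F V] [FiniteDimensional F V] :
    Finite (Submodule F V) := by
  have : Finite V := Module.finite_of_finite F
  infer_instance

lemma card_LI (V : Type*) [AddCommGroup V] [Module F V] [FiniteDimensional F V] (k t : ℕ)
    (h : finrank F V = k + t) :
    (Nat.card {s : Fin k → V // LinearIndependent F s} : ℚ) * qf (Fintype.card F) t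
      = (Fintype.card F : ℚ) ^ (k.choose 2) * qf (Fintype.card F) (k + t) := by
  have : Finite V := Module.finite_of_finite F
  rw [card_linearIndependent (by omega), ← prod_qf, h,
    ← Fin.prod_univ_eq_prod_range (fun i => (Fintype.card F : ℚ) ^ (k + t) - (Fintype.card F : ℚ) ^ i),
    Nat.cast_prod]
  congr 1
  apply Finset.prod_congr rfl
  intro i _
  rw [Nat.cast_sub]
  · push_cast; rfl
  · exact Nat.pow_le_pow_right Fintype.card_pos (by omega)

lemma card_sub_s19 (V : Type*) [AddCommGroup V] [Module F V] [FiniteDimensional F V] (k : ℕ) :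
    (Nat.card {U : Submodule F V // finrank F U = k} : ℚ)
      = qb (Fintype.card F) (finrank F V) k := by
  have hq := one_lt_card (F := F)
  by_cases hk : finrank F V < k
  · rw [qb_eq_zero _ _ _ hk]
    have : IsEmpty {U : Submodule F V // finrank F U = k} := by
      constructor
      rintro ⟨U, hU⟩
      have := Submodule.finrank_le U
      omega
    simp
  obtain ⟨t, ht⟩ := Nat.exists_eq_add_of_le (not_lt.1 hk)
  have : Finite V := Module.finite_of_finite F
  let f : (Σ U : {U : Submodule F V // finrank F U = k},
      {s : Fin k → U.1 // LinearIndependent F s}) → {s : Fin k → V // LinearIndependent F s} :=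
    fun p => ⟨fun i => (p.2.1 i : V), p.2.2.map' p.1.1.subtype (Submodule.ker_subtype _)⟩
  have hspan : ∀ p, Submodule.span F (Set.range (f p).1) = p.1.1 := by
    intro p
    apply Submodule.eq_of_le_of_finrank_eq
    · rw [Submodule.span_le]
      rintro _ ⟨i, rfl⟩
      exact (p.2.1 i).2
    · rw [finrank_span_eq_card (f p).2, p.1.2]; simp
  have hf : Function.Bijective f := by
    constructor
    · intro p p' h
      have h1 := hspan p
      rw [h, hspan p'] at h1
      obtain ⟨⟨U, hU⟩, s, hs⟩ := p
      obtain ⟨⟨U', hU'⟩, s', hs'⟩ := p'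
      dsimp only at h1
      subst h1
      congr 2
      ext i
      have := congrFun (congrArg Subtype.val h) i
      simpa [f] using this
    · rintro ⟨s, hs⟩
      refine ⟨⟨⟨Submodule.span F (Set.range s), ?_⟩,
        ⟨fun i => ⟨s i, Submodule.subset_span ⟨i, rfl⟩⟩, ?_⟩⟩, ?_⟩
      · rw [finrank_span_eq_card hs]; simp
      · exact linearIndependent_span hs
      · rfl
  have hc := Nat.card_congr (Equiv.ofBijective f hf)
  have := Fintype.ofFinite {U : Submodule F V // finrank F U = k}
  rw [Nat.card_sigma] at hc
  have h0 : ∀ U : {U : Submodule F V // finrank F U = k},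
      (Nat.card {s : Fin k → U.1 // LinearIndependent F s} : ℚ)
        = (Fintype.card F : ℚ) ^ (k.choose 2) * qf (Fintype.card F) k := by
    intro U
    have := card_LI U.1 k 0 (by simpa using U.2)
    simpa [qf] using this
  have h1 := card_LI V k t ht
  rw [← hc] at h1
  push_cast at h1
  rw [Finset.sum_congr rfl (fun U _ => h0 U)] at h1
  rw [← qb_mul_qf _ k t] at h1
  simp only [Finset.sum_const, Finset.card_univ, nsmul_eq_mul] at h1
  rw [Nat.card_eq_fintype_card, ht]
  have a1 := qf_ne hq k
  have a2 := qf_ne hq t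
  have a3 : (Fintype.card F : ℚ) ^ (k.choose 2) ≠ 0 := by positivity
  exact mul_right_cancel₀ (mul_ne_zero (mul_ne_zero a1 a2) a3) (by linear_combination h1)

lemma card_le (V : Type*) [AddCommGroup V] [Module F V] [FiniteDimensional F V]
    (S : Submodule F V) (k : ℕ) :
    (Nat.card {U : Submodule F V // finrank F U = k ∧ U ≤ S} : ℚ)
      = qb (Fintype.card F) (finrank F S) k := by
  rw [← card_sub_s19 S k]
  congr 1
  apply Nat.card_congr
  refine Equiv.symm ?_
  refine
    { toFun := fun U => ⟨U.1.map S.subtype, ?_, Submodule.map_subtype_le _ _⟩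
      invFun := fun U => ⟨U.1.comap S.subtype, ?_⟩
      left_inv := ?_
      right_inv := ?_ }
  · rw [Submodule.finrank_map_subtype_eq]; exact U.2
  · rw [(Submodule.comapSubtypeEquivOfLe U.2.2).finrank_eq]; exact U.2.1
  · intro U
    ext x
    simp
  · intro U
    apply Subtype.ext
    simp [Submodule.map_comap_subtype, U.2.2]

lemma card_ge (V : Type*) [AddCommGroup V] [Module F V] [FiniteDimensional F V]
    (S : Submodule F V) (c : ℕ) (hc : c ≤ finrank F V) :
    (Nat.card {W : Submodule F V // finrank F W = c ∧ S ≤ W} : ℚ)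
      = qb (Fintype.card F) (finrank F V - finrank F S) (finrank F V - c) := by
  have h1 := Subspace.finrank_add_finrank_dualAnnihilator_eq S
  rw [show finrank F V - finrank F S = finrank F S.dualAnnihilator by omega, ← card_le]
  congr 1
  apply Nat.card_congr
  refine Equiv.subtypeEquiv (Subspace.orderIsoFiniteDimensional (K := F) (V := V)).toEquiv ?_
  intro W
  have h2 := Subspace.finrank_add_finrank_dualAnnihilator_eq W
  have e : ((Subspace.orderIsoFiniteDimensional (K := F) (V := V)).toEquiv W : Submodule F (Dual F V))
    = W.dualAnnihilator := rfl
  constructor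
  · rintro ⟨h3, h4⟩
    refine ⟨?_, ?_⟩
    · change finrank F W.dualAnnihilator = _
      omega
    · change W.dualAnnihilator ≤ S.dualAnnihilator
      exact Subspace.dualAnnihilator_le_dualAnnihilator_iff.2 h4
  · rintro ⟨h3, h4⟩
    change finrank F W.dualAnnihilator = _ at h3
    change W.dualAnnihilator ≤ S.dualAnnihilator at h4
    exact ⟨by omega, Subspace.dualAnnihilator_le_dualAnnihilator_iff.1 h4⟩

section op

variable {V : Type*} [AddCommGroup V] [Module F V] [FiniteDimensional F V] (T : V →ₗ[F] V)

/-- dimension of `W ∩ T⁻¹ W` -/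
noncomputable def kk (W : Submodule F V) : ℕ := finrank F (W ⊓ W.comap T : Submodule F V)

lemma finrank_map_ker (U : Submodule F V) :
    finrank F (U.map T) + finrank F (U ⊓ LinearMap.ker T : Submodule F V) = finrank F U := by
  have h := LinearMap.finrank_range_add_finrank_ker (T.domRestrict U)
  rw [LinearMap.range_domRestrict, LinearMap.ker_domRestrict] at h
  rw [← h, ← Submodule.finrank_map_subtype_eq U, Submodule.map_comap_subtype]

lemma finrank_sup_kk (U : Submodule F V) :
    finrank F (U ⊔ U.map T : Submodule F V) + kk T U = 2 * finrank F U := by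
  have h1 := finrank_map_ker T U
  have h2 := finrank_map_ker T (U ⊓ U.comap T)
  have h3 := Submodule.finrank_sup_add_finrank_inf_eq U (U.map T)
  have e1 : (U ⊓ U.comap T).map T = U ⊓ U.map T := by
    ext x
    simp only [Submodule.mem_map, Submodule.mem_inf, Submodule.mem_comap]
    constructor
    · rintro ⟨y, ⟨hy, hy2⟩, rfl⟩
      exact ⟨hy2, y, hy, rfl⟩
    · rintro ⟨hx, y, hy, rfl⟩
      exact ⟨y, ⟨hy, hx⟩, rfl⟩
  have e2 : (U ⊓ U.comap T) ⊓ LinearMap.ker T = U ⊓ LinearMap.ker T := by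
    ext x
    simp only [Submodule.mem_inf, Submodule.mem_comap, LinearMap.mem_ker]
    constructor
    · rintro ⟨⟨h, _⟩, h'⟩
      exact ⟨h, h'⟩
    · rintro ⟨h, h'⟩
      exact ⟨⟨h, by rw [h']; exact U.zero_mem⟩, h'⟩
  rw [e1, e2] at h2
  unfold kk
  omega

/-- pairs `(U, W)` with `U + T U ≤ W` -/
def PT (c a : ℕ) : Type _ :=
  {p : Submodule F V × Submodule F V //
    finrank F p.1 = a ∧ finrank F p.2 = c ∧ p.1 ≤ p.2 ∧ p.1.map T ≤ p.2}

noncomputable instance fsub (c : ℕ) : Fintype {W : Submodule F V // finrank F W = c} :=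
  Fintype.ofFinite _

lemma PT_left (c a : ℕ) :
    (Nat.card (PT T c a) : ℚ)
      = ∑ W : {W : Submodule F V // finrank F W = c}, qb (Fintype.card F) (kk T W.1) a := by
  have e : PT T c a ≃ Σ W : {W : Submodule F V // finrank F W = c},
      {U : Submodule F V // finrank F U = a ∧ U ≤ W.1 ⊓ W.1.comap T} :=
    { toFun := fun p => ⟨⟨p.1.2, p.2.2.1⟩, ⟨p.1.1, p.2.1,
        le_inf p.2.2.2.1 (Submodule.map_le_iff_le_comap.1 p.2.2.2.2)⟩⟩
      invFun := fun p => ⟨(p.2.1, p.1.1), p.2.2.1, p.1.2, p.2.2.2.trans inf_le_left,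
        Submodule.map_le_iff_le_comap.2 (p.2.2.2.trans inf_le_right)⟩
      left_inv := fun _ => rfl
      right_inv := fun _ => rfl }
  rw [Nat.card_congr e, Nat.card_sigma]
  push_cast
  exact Finset.sum_congr rfl fun W _ => card_le V _ a

lemma PT_right (c a : ℕ) (hc : c ≤ finrank F V) :
    (Nat.card (PT T c a) : ℚ)
      = ∑ U : {W : Submodule F V // finrank F W = a}, qb (Fintype.card F)
        (finrank F V - finrank F (U.1 ⊔ U.1.map T : Submodule F V)) (finrank F V - c) := by
  have e : PT T c a ≃ Σ U : {W : Submodule F V // finrank F W = a},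
      {W : Submodule F V // finrank F W = c ∧ U.1 ⊔ U.1.map T ≤ W} :=
    { toFun := fun p => ⟨⟨p.1.1, p.2.1⟩, ⟨p.1.2, p.2.2.1,
        sup_le p.2.2.2.1 p.2.2.2.2⟩⟩
      invFun := fun p => ⟨(p.1.1, p.2.1), p.1.2, p.2.2.1, le_sup_left.trans p.2.2.2,
        le_sup_right.trans p.2.2.2⟩
      left_inv := fun _ => rfl
      right_inv := fun _ => rfl }
  rw [Nat.card_congr e, Nat.card_sigma]
  push_cast
  exact Finset.sum_congr rfl fun W _ => card_ge V _ c hc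

lemma PT_rec (n : ℕ) (hn : finrank F V = n) (a c : ℕ) (ha : 2 * a ≤ n) (hc : c ≤ n) :
    (Nat.card (PT T c a) : ℚ) = ∑ b ∈ Finset.range (a + 1), (Nat.card (PT T a b) : ℚ) *
      wt (Fintype.card F) (n - 2 * a) (n - c) b := by
  rw [PT_right T c a (by omega), hn]
  simp only [PT_left, Finset.sum_mul]
  rw [Finset.sum_comm]
  apply Finset.sum_congr rfl
  rintro ⟨U, hU⟩ _
  have h1 := finrank_sup_kk T U
  have h2 : kk T U ≤ finrank F U := Submodule.finrank_mono inf_le_left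
  have h3 := Submodule.finrank_le (U ⊔ U.map T)
  rw [vander2 _ _ _ _ _ (by simpa [hU] using h2)]
  congr 1
  dsimp only
  omega

/-- number of invariant subspaces -/
noncomputable def XX (j : ℕ) : ℕ :=
  Nat.card {W : Submodule F V // finrank F W = j ∧ W.map T ≤ W}

lemma PT_diag (a : ℕ) : Nat.card (PT T a a) = XX T a := by
  apply Nat.card_congr
  exact
    { toFun := fun p => ⟨p.1.2, p.2.2.1, by
        have h := Submodule.eq_of_le_of_finrank_eq p.2.2.2.1 (p.2.1.trans p.2.2.1.symm)
        have h2 := p.2.2.2.2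
        rwa [h] at h2⟩
      invFun := fun W => ⟨(W.1, W.1), W.2.1, W.2.1, le_rfl, W.2.2⟩
      left_inv := fun p => by
        have h := Submodule.eq_of_le_of_finrank_eq p.2.2.2.1 (p.2.1.trans p.2.2.1.symm)
        apply Subtype.ext
        exact Prod.ext h.symm rfl
      right_inv := fun _ => rfl }

lemma dual_map_iff (U W : Submodule F V) :
    W.dualAnnihilator.map T.dualMap ≤ U.dualAnnihilator ↔ U.map T ≤ W := by
  rw [Submodule.map_le_iff_le_comap]
  have : U.dualAnnihilator.comap T.dualMap = (U.map T).dualAnnihilator := by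
    ext φ
    simp [Submodule.mem_dualAnnihilator]
  rw [this, Subspace.dualAnnihilator_le_dualAnnihilator_iff]

lemma XX_dual (j : ℕ) (hj : j ≤ finrank F V) :
    XX T.dualMap j = XX T (finrank F V - j) := by
  symm
  apply Nat.card_congr
  refine Equiv.subtypeEquiv (Subspace.orderIsoFiniteDimensional (K := F) (V := V)).toEquiv ?_
  intro W
  have h2 := Subspace.finrank_add_finrank_dualAnnihilator_eq W
  change _ ↔ finrank F W.dualAnnihilator = j ∧
    W.dualAnnihilator.map T.dualMap ≤ W.dualAnnihilator
  rw [dual_map_iff]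
  constructor
  · rintro ⟨h3, h4⟩
    exact ⟨by omega, h4⟩
  · rintro ⟨h3, h4⟩
    exact ⟨by omega, h4⟩

lemma PT_dual (a : ℕ) (ha : a ≤ finrank F V) :
    Nat.card (PT T (finrank F V - a) a) = Nat.card (PT T.dualMap (finrank F V - a) a) := by
  apply Nat.card_congr
  let e := (Subspace.orderIsoFiniteDimensional (K := F) (V := V)).toEquiv
  refine Equiv.subtypeEquiv ((Equiv.prodComm _ _).trans (Equiv.prodCongr e e)) ?_
  rintro ⟨U, W⟩
  have h1 := Subspace.finrank_add_finrank_dualAnnihilator_eq U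
  have h2 := Subspace.finrank_add_finrank_dualAnnihilator_eq W
  change (finrank F U = a ∧ finrank F W = finrank F V - a ∧ U ≤ W ∧ U.map T ≤ W) ↔
    (finrank F W.dualAnnihilator = a ∧ finrank F U.dualAnnihilator = finrank F V - a ∧
      W.dualAnnihilator ≤ U.dualAnnihilator ∧ W.dualAnnihilator.map T.dualMap ≤ U.dualAnnihilator)
  rw [dual_map_iff, Subspace.dualAnnihilator_le_dualAnnihilator_iff]
  constructor
  · rintro ⟨h3, h4, h5⟩
    exact ⟨by omega, by omega, h5⟩
  · rintro ⟨h3, h4, h5⟩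
    exact ⟨by omega, by omega, h5⟩

theorem XX_symm (n : ℕ) (hn : finrank F V = n) (a : ℕ) (ha : 2 * a < n) :
    XX T a = XX T (n - a) := by
  have h := X_symm (one_lt_card (F := F)) n (fun c a => (Nat.card (PT T c a) : ℚ))
    (fun c a => (Nat.card (PT T.dualMap c a) : ℚ)) (fun a => (XX T a : ℚ))
    (fun a => (XX T.dualMap a : ℚ)) (fun a => by rw [PT_diag])
    (fun a c h1 _ h2 => PT_rec T n hn a c h1 h2) (fun a => by rw [PT_diag])
    (fun a c h1 _ h2 => PT_rec T.dualMap n (by rw [Subspace.dual_finrank_eq, hn]) a c h1 h2)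
    (fun a h => by subst hn; rw [PT_dual T a h]) a ha
  have h' : XX T a = XX T.dualMap a := by exact_mod_cast h
  rw [h', XX_dual T a (by omega), hn]

lemma splitting_sum (m : ℕ) (hn : finrank F V = 2 * m) :
    (Nat.card {W : Submodule F V // finrank F W = m ∧ W ⊔ W.map T = ⊤} : ℚ)
      = ∑ b ∈ Finset.range (m + 1), (-1) ^ b * (Fintype.card F : ℚ) ^ (b.choose 2) *
        (Nat.card (PT T m b) : ℚ) := by
  classical
  simp only [PT_left, Finset.mul_sum]
  rw [Finset.sum_comm]
  have h1 : ∀ W : {W : Submodule F V // finrank F W = m},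
      ∑ b ∈ Finset.range (m + 1), (-1) ^ b * (Fintype.card F : ℚ) ^ (b.choose 2) *
        qb (Fintype.card F) (kk T W.1) b = if W.1 ⊔ W.1.map T = ⊤ then 1 else 0 := by
    rintro ⟨W, hW⟩
    have h1 := finrank_sup_kk T W
    have h2 : kk T W ≤ finrank F W := Submodule.finrank_mono inf_le_left
    rw [alt_sum _ _ _ (by simpa [hW] using h2)]
    congr 1
    apply propext
    dsimp only
    constructor
    · intro h
      apply Submodule.eq_top_of_finrank_eq
      omega
    · intro h
      rw [h, finrank_top] at h1
      omega
  rw [Finset.sum_congr rfl (fun W _ => h1 W), Finset.sum_boole]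
  congr 1
  rw [← Fintype.card_subtype, ← Nat.card_eq_fintype_card]
  exact Nat.card_congr (Equiv.subtypeSubtypeEquivSubtypeInter _ _).symm

end op

end comb

/-- Main theorem: for any linear operator `T` on `F_q^{2m}`, the number of
`m`-dimensional `T`-splitting subspaces (`W + T W = F_q^{2m}`) equals
`q^{binom(m,2)} ∑_{j=0}^{2m} (-1)^j X_j^T q^{binom(m-j+1,2)}`, where `X_j^T` is
the number of `j`-dimensional `T`-invariant subspaces. -/
theorem card_splitting_subspaces (F : Type*) [Field F] [Fintype F] (m : ℕ)
    (T : (Fin (2 * m) → F) →ₗ[F] (Fin (2 * m) → F)) :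
    (Nat.card {W : Submodule F (Fin (2 * m) → F) //
        Module.finrank F W = m ∧ W ⊔ W.map T = ⊤} : ℤ) =
      (Fintype.card F : ℤ) ^ (m * (m - 1) / 2) *
        ∑ j ∈ Finset.range (2 * m + 1),
          (-1 : ℤ) ^ j *
            (Nat.card {W : Submodule F (Fin (2 * m) → F) //
                Module.finrank F W = j ∧ W.map T ≤ W} : ℤ) *
            (Fintype.card F : ℤ) ^ binom2 ((m : ℤ) - j + 1) := by
  have h := final_sum (one_lt_card (F := F)) m (fun c a => (Nat.card (PT T c a) : ℚ))
    (fun a => (XX T a : ℚ)) (fun a => by rw [PT_diag])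
    (fun a c h1 _ h2 => PT_rec T (2 * m) (by simp) a c h1 h2)
    (fun a h => by rw [XX_symm T (2 * m) (by simp) a h])
  rw [← splitting_sum T m (by simp), Nat.choose_two_right] at h
  unfold XX at h
  exact_mod_cast h
end
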